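/- Fix an integer r ≥ 1 and real numbers σ ∈ (0,1), ν > 0 and C₀ > 0. There exist a constant c > 0 and a constant C > 0, depending only on r, σ, ν, C₀, with the following property. Let N ≥ 1 and let (w,P_w) be a smooth global solution of the Navier–Stokes equations with viscosity ν on 𝕋³ × [0,∞) whose initial datum w₀ has zero mean and which satisfies (∫₀^∞ ‖∇^m w(·,t)‖²_{L^∞} dt)^{1/2} ≤ C₀(1 + N^{m−1}) for every 0 ≤ m ≤ r. If u₀ is a smooth divergence-free field on 𝕋³ with zero mean and ‖u₀ − w₀‖_{H^r} ≤ c · N^{1−r}, then there is a global smooth solution u of the Navier–Stokes equations with viscosity ν and initial datum u₀, and for every 0 ≤ m ≤ r and t > 0 one has ‖u(·,t) − w(·,t)‖_{H^m} ≤ C (N^{m−1} + 1) e^{−νσt} ‖u₀ − w₀‖_{H^m}. -/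

import Mathlib

open MeasureTheory Real Set

noncomputable section

abbrev E3 := Fin 3 → ℝ

def T3 : Set E3 := Set.Icc 0 (fun _ => 2 * Real.pi)

def SpacePeriodic {ι : Type*} (f : E3 → ι) : Prop :=
  ∀ (x : E3) (j : Fin 3), f (x + (2 * Real.pi) • (Pi.single j 1 : E3)) = f x

def pd (j : Fin 3) (f : E3 → ℝ) : E3 → ℝ := fun x => fderiv ℝ f x (Pi.single j 1 : E3)

def pdM (β : Fin 3 → ℕ) (f : E3 → ℝ) : E3 → ℝ :=
  (pd 0)^[β 0] ((pd 1)^[β 1] ((pd 2)^[β 2] f))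

def midx (m : ℕ) : Finset (Fin 3 → ℕ) := Finset.Nat.antidiagonalTuple 3 m

def gradSq {ι : Type*} [Fintype ι] (m : ℕ) (f : E3 → ι → ℝ) (x : E3) : ℝ :=
  ∑ i : ι, ∑ β ∈ midx m, (pdM β (fun y => f y i) x) ^ 2

def HnormSq {ι : Type*} [Fintype ι] (r : ℕ) (f : E3 → ι → ℝ) : ℝ :=
  ∑ m ∈ Finset.range (r + 1), ∫ x in T3, gradSq m f x

def Hnorm {ι : Type*} [Fintype ι] (r : ℕ) (f : E3 → ι → ℝ) : ℝ :=
  Real.sqrt (HnormSq r f)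

def L2norm {ι : Type*} [Fintype ι] (f : E3 → ι → ℝ) : ℝ := Hnorm 0 f

def LinfGrad {ι : Type*} [Fintype ι] (m : ℕ) (f : E3 → ι → ℝ) : ℝ :=
  ⨆ x : E3, Real.sqrt (gradSq m f x)

def Linf {ι : Type*} [Fintype ι] (f : E3 → ι → ℝ) : ℝ := LinfGrad 0 f

def ZeroMean {ι : Type*} [Fintype ι] (f : E3 → ι → ℝ) : Prop :=
  ∀ i, (∫ x in T3, f x i) = 0

def vdiv (u : E3 → E3) : E3 → ℝ := fun x => ∑ j, pd j (fun y => u y j) x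

def vcurl (u : E3 → E3) : E3 → E3 := fun x =>
  ![pd 1 (fun y => u y 2) x - pd 2 (fun y => u y 1) x,
    pd 2 (fun y => u y 0) x - pd 0 (fun y => u y 2) x,
    pd 0 (fun y => u y 1) x - pd 1 (fun y => u y 0) x]

def lap (f : E3 → ℝ) : E3 → ℝ := fun x => ∑ j, pd j (pd j f) x

def IsNS (ν : ℝ) (I : Set ℝ) (u : E3 → ℝ → E3) (P : E3 → ℝ → ℝ) : Prop :=
  (∀ t ∈ I, ∀ (x : E3) (i : Fin 3),
      derivWithin (fun τ => u x τ i) I t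
        + (∑ j, u x t j * pd j (fun y => u y t i) x)
        - ν * lap (fun y => u y t i) x
        = - pd i (fun y => P y t) x) ∧
  (∀ t ∈ I, ∀ x : E3, vdiv (fun y => u y t) x = 0)

def SmoothOnTime (u : E3 → ℝ → E3) (I : Set ℝ) : Prop :=
  ContDiffOn ℝ (⊤ : ℕ∞) (fun p : E3 × ℝ => u p.1 p.2) (Set.univ ×ˢ I)

def wNormInf (m : ℕ) (w : E3 → ℝ → E3) (t : ℝ) : ℝ := LinfGrad m (fun x => w x t)

def Q (w : E3 → ℝ → E3) : ℕ → ℝ → ℝ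
  | 0, _ => 1
  | (j + 1), t => 1 + ∑ m ∈ (Finset.range (j + 1)).attach,
      Q w m.1 t * ∫ τ in (0:ℝ)..t, (wNormInf (j + 1 - m.1) w τ) ^ 2
  decreasing_by exact Finset.mem_range.mp m.2

def Qinf (w : E3 → ℝ → E3) (r : ℕ) : ℝ := ⨆ t : Set.Ici (0:ℝ), Q w r t

/-- Smoothness of a time-dependent scalar function (e.g. the pressure) on `𝕋³ × I`. -/
def SmoothOnTimeS (P : E3 → ℝ → ℝ) (I : Set ℝ) : Prop :=
  ContDiffOn ℝ (⊤ : ℕ∞) (fun p : E3 × ℝ => P p.1 p.2) (Set.univ ×ˢ I)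

namespace NSF

/-- Frequencies of the torus. -/
abbrev K3 := Fin 3 → ℤ

/-- Squared length of a frequency. -/
def lam (k : K3) : ℝ := ∑ j, (k j : ℝ) ^ 2

lemma lam_nonneg (k : K3) : 0 ≤ lam k := Finset.sum_nonneg fun _ _ => sq_nonneg _

lemma lam_zero : lam 0 = 0 := by simp [lam]

lemma sq_le_lam (k : K3) (a : Fin 3) : (k a : ℝ) ^ 2 ≤ lam k :=
  Finset.single_le_sum (f := fun j => (k j : ℝ) ^ 2) (fun _ _ => sq_nonneg _) (Finset.mem_univ a)

lemma one_le_lam {k : K3} (hk : k ≠ 0) : 1 ≤ lam k := by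
  obtain ⟨a, ha⟩ := Function.ne_iff.mp hk
  refine le_trans ?_ (sq_le_lam k a)
  have h : (1 : ℤ) ≤ (k a) ^ 2 := Int.add_one_le_of_lt (lt_of_le_of_ne (sq_nonneg _) (Ne.symm (pow_ne_zero 2 ha)))
  exact_mod_cast h

lemma lam_neg (k : K3) : lam (-k) = lam k := by simp [lam]

lemma lam_le (k l : K3) : lam k ≤ 2 * (lam (k - l) + lam l) := by
  simp only [lam, ← Finset.sum_add_distrib, Finset.mul_sum]
  refine Finset.sum_le_sum fun j _ => ?_
  simp only [Pi.sub_apply, Int.cast_sub]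
  nlinarith [sq_nonneg ((k j : ℝ) - 2 * l j)]

lemma one_add_lam_le (k l : K3) : 1 + lam k ≤ 2 * ((1 + lam (k - l)) * (1 + lam l)) := by
  nlinarith [lam_le k l, lam_nonneg k, lam_nonneg l, lam_nonneg (k - l),
    mul_nonneg (lam_nonneg (k - l)) (lam_nonneg l)]

lemma abs_le_one_add_lam (k : K3) (a : Fin 3) : |(k a : ℝ)| ≤ 1 + lam k := by
  have := sq_le_lam k a
  rw [← sq_abs] at this
  nlinarith [sq_nonneg (|(k a : ℝ)| - 1)]

lemma lam_pow_le (m : ℕ) (k : K3) : lam k ^ m ≤ 3 ^ m * ∑ a, ((k a : ℝ) ^ m) ^ 2 := by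
  obtain ⟨a, -, ha⟩ := Finset.exists_max_image Finset.univ (fun j => (k j : ℝ) ^ 2) ⟨0, by simp⟩
  have h1 : lam k ≤ 3 * (k a : ℝ) ^ 2 := by
    have := Finset.sum_le_card_nsmul Finset.univ (fun j => (k j : ℝ) ^ 2) _ ha
    simpa [lam] using this
  calc lam k ^ m ≤ (3 * (k a : ℝ) ^ 2) ^ m := by gcongr; exact lam_nonneg k
    _ = 3 ^ m * ((k a : ℝ) ^ m) ^ 2 := by rw [mul_pow, ← pow_mul, ← pow_mul, mul_comm 2 m]
    _ ≤ _ := by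
      gcongr
      exact Finset.single_le_sum (f := fun j => ((k j : ℝ) ^ m) ^ 2) (fun _ _ => sq_nonneg _)
        (Finset.mem_univ a)

lemma summable_int_aux : Summable fun n : ℤ => (((1 + (n : ℝ) ^ 2) ^ (2 / 3 : ℝ)))⁻¹ := by
  have h : Summable fun n : ℤ => |(n : ℝ)| ^ (-(4 / 3) : ℝ) :=
    Real.summable_abs_int_rpow (by norm_num)
  refine Summable.of_norm_bounded_eventually (g := fun n : ℤ => |(n : ℝ)| ^ (-(4 / 3) : ℝ)) h ?_
  filter_upwards [(Set.finite_singleton (0 : ℤ)).compl_mem_cofinite] with n hn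
  have hn' : 0 < |(n : ℝ)| := by
    simp only [mem_compl_iff, mem_singleton_iff] at hn
    positivity
  rw [Real.norm_of_nonneg (by positivity), Real.rpow_neg hn'.le]
  gcongr
  calc |(n : ℝ)| ^ (4 / 3 : ℝ) = (|(n : ℝ)| ^ (2 : ℝ)) ^ (2 / 3 : ℝ) := by
        rw [← Real.rpow_mul hn'.le]; norm_num
    _ ≤ _ := by
        gcongr
        rw [Real.rpow_two, sq_abs]; linarith

lemma summable_weight : Summable fun k : K3 => ((1 + lam k) ^ 2)⁻¹ := by
  have h1 := summable_int_aux
  have h3 : Summable fun p : ℤ × ℤ × ℤ => (((1 + (p.1 : ℝ) ^ 2) ^ (2 / 3 : ℝ)))⁻¹ *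
      ((((1 + (p.2.1 : ℝ) ^ 2) ^ (2 / 3 : ℝ)))⁻¹ * (((1 + (p.2.2 : ℝ) ^ 2) ^ (2 / 3 : ℝ)))⁻¹) :=
    h1.mul_of_nonneg (h1.mul_of_nonneg h1 (fun _ => by positivity) (fun _ => by positivity))
      (fun _ => by positivity) (fun _ => by simp only [Pi.zero_apply]; positivity)
  have h4 := h3.comp_injective (i := fun k : K3 => (k 0, k 1, k 2)) (by
    intro k l h
    simp only [Prod.mk.injEq] at h
    funext j; fin_cases j <;> simp [h])
  refine Summable.of_nonneg_of_le (fun k => by positivity) (fun k => ?_) h4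
  simp only [Function.comp]
  rw [← mul_inv, ← mul_inv]
  have hl : ∀ a : Fin 3, (1 + (k a : ℝ) ^ 2) ^ (2 / 3 : ℝ) ≤ (1 + lam k) ^ (2 / 3 : ℝ) :=
    fun a => by gcongr; exact sq_le_lam k a
  have h0 := lam_nonneg k
  gcongr
  calc _ ≤ (1 + lam k) ^ (2 / 3 : ℝ) * ((1 + lam k) ^ (2 / 3 : ℝ) * (1 + lam k) ^ (2 / 3 : ℝ)) := by
        gcongr <;> exact sq_le_lam k _
    _ = (1 + lam k) ^ 2 := by
        rw [← Real.rpow_add (by positivity), ← Real.rpow_add (by positivity), ← Real.rpow_natCast]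
        norm_num

/-- Total mass of the summable weight. -/
def Lam0 : ℝ := ∑' k : K3, ((1 + lam k) ^ 2)⁻¹

lemma Lam0_nonneg : 0 ≤ Lam0 := tsum_nonneg fun k => by have := lam_nonneg k; positivity

lemma sum_inv_lam_sq_le (s : Finset K3) (hs : ∀ k ∈ s, k ≠ 0) :
    ∑ k ∈ s, (lam k ^ 2)⁻¹ ≤ 4 * Lam0 := by
  calc ∑ k ∈ s, (lam k ^ 2)⁻¹ ≤ ∑ k ∈ s, 4 * ((1 + lam k) ^ 2)⁻¹ := by
        refine Finset.sum_le_sum fun k hk => ?_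
        have := one_le_lam (hs k hk)
        rw [← div_eq_mul_inv, inv_le_comm₀ (by positivity) (by positivity), inv_div,
          div_le_iff₀ (by norm_num)]
        nlinarith
    _ = 4 * ∑ k ∈ s, ((1 + lam k) ^ 2)⁻¹ := by rw [Finset.mul_sum]
    _ ≤ _ := by
        gcongr
        exact summable_weight.sum_le_tsum s (fun k _ => by positivity)

end NSF

namespace NSF

/-- Homogeneous Sobolev energy of order `m` of the coefficients `c` over the frequencies `s`. -/
def En (s : Finset K3) (m : ℕ) (c : K3 → Fin 3 → ℂ) : ℝ :=
  ∑ k ∈ s, lam k ^ m * ∑ i, ‖c k i‖ ^ 2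

/-- Divergence of a matrix-valued flux in Fourier variables. -/
def zdiv (k : K3) (S : Fin 3 → Fin 3 → ℂ) (i : Fin 3) : ℂ :=
  Complex.I * ∑ j, (k j : ℂ) * S i j

/-- Leray projection in Fourier variables. -/
def lerayP (k : K3) (z : Fin 3 → ℂ) (i : Fin 3) : ℂ :=
  z i - (k i : ℂ) * ((∑ j, (k j : ℂ) * z j) / (lam k : ℂ))

/-- The linear part of the flux. -/
def fluxL (W : Fin 3 → K3 → ℂ) (s : Finset K3) (c : K3 → Fin 3 → ℂ) (k : K3)
    (i j : Fin 3) : ℂ :=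
  ∑ l ∈ s, W i (k - l) * c l j + ∑ l ∈ s, W j (k - l) * c l i

/-- The quadratic part of the flux. -/
def fluxQ (s : Finset K3) (c : K3 → Fin 3 → ℂ) (k : K3) (i j : Fin 3) : ℂ :=
  ∑ l ∈ s, c (k - l) i * c l j

/-- Right-hand side of the (truncated) perturbation equation in Fourier variables. -/
def rhs (ν : ℝ) (W : Fin 3 → K3 → ℂ) (s : Finset K3) (θ : ℝ) (c : K3 → Fin 3 → ℂ) (k : K3)
    (i : Fin 3) : ℂ :=
  -(ν * lam k : ℝ) * c k i -
    lerayP k (zdiv k fun i j => fluxL W s c k i j + θ * fluxQ s c k i j) i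

lemma En_nonneg (s : Finset K3) (m : ℕ) (c : K3 → Fin 3 → ℂ) : 0 ≤ En s m c :=
  Finset.sum_nonneg fun k _ => mul_nonneg (pow_nonneg (lam_nonneg k) _)
    (Finset.sum_nonneg fun _ _ => sq_nonneg _)

lemma En_mono {s : Finset K3} (hs : ∀ k ∈ s, k ≠ 0) {m n : ℕ} (hmn : m ≤ n)
    (c : K3 → Fin 3 → ℂ) : En s m c ≤ En s n c := by
  refine Finset.sum_le_sum fun k hk => ?_
  gcongr
  exact one_le_lam (hs k hk)

lemma norm_zdiv_sq_le (k : K3) (S : Fin 3 → Fin 3 → ℂ) :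
    ∑ i, ‖zdiv k S i‖ ^ 2 ≤ lam k * ∑ i, ∑ j, ‖S i j‖ ^ 2 := by
  rw [Finset.mul_sum]
  refine Finset.sum_le_sum fun i _ => ?_
  have h1 : ‖zdiv k S i‖ ≤ ∑ j, |(k j : ℝ)| * ‖S i j‖ := by
    rw [zdiv, norm_mul, Complex.norm_I, one_mul]
    refine (norm_sum_le _ _).trans (le_of_eq ?_)
    refine Finset.sum_congr rfl fun j _ => ?_
    rw [norm_mul, Complex.norm_intCast]
  calc ‖zdiv k S i‖ ^ 2 ≤ (∑ j, |(k j : ℝ)| * ‖S i j‖) ^ 2 := by gcongr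
    _ ≤ (∑ j, |(k j : ℝ)| ^ 2) * ∑ j, ‖S i j‖ ^ 2 := Finset.sum_mul_sq_le_sq_mul_sq _ _ _
    _ = _ := by simp only [sq_abs, lam]

lemma norm_lerayP_sq_le {k : K3} (hk : k ≠ 0) (z : Fin 3 → ℂ) :
    ∑ i, ‖lerayP k z i‖ ^ 2 ≤ ∑ i, ‖z i‖ ^ 2 := by
  have hl : lam k ≠ 0 := (lt_of_lt_of_le one_pos (one_le_lam hk)).ne'
  set q : ℂ := (∑ j, (k j : ℂ) * z j) / (lam k : ℂ) with hq
  have hq' : (lam k : ℂ) * q = ∑ j, (k j : ℂ) * z j := by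
    rw [hq, mul_div_cancel₀ _ (Complex.ofReal_ne_zero.mpr hl)]
  have hre : lam k * q.re = ∑ j, (k j : ℝ) * (z j).re := by
    have := congrArg Complex.re hq'
    simpa [Complex.re_sum] using this
  have him : lam k * q.im = ∑ j, (k j : ℝ) * (z j).im := by
    have := congrArg Complex.im hq'
    simpa [Complex.im_sum] using this
  have hterm : ∀ i, ‖lerayP k z i‖ ^ 2 = ‖z i‖ ^ 2 - 2 * q.re * ((k i : ℝ) * (z i).re)
      - 2 * q.im * ((k i : ℝ) * (z i).im) + (k i : ℝ) ^ 2 * (q.re ^ 2 + q.im ^ 2) := by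
    intro i
    rw [lerayP, ← hq, ← Complex.normSq_eq_norm_sq, ← Complex.normSq_eq_norm_sq,
      Complex.normSq_apply, Complex.normSq_apply]
    simp
    ring
  simp only [hterm, Finset.sum_add_distrib, Finset.sum_sub_distrib, ← Finset.mul_sum,
    ← Finset.sum_mul]
  rw [← hre, ← him]
  change _ + lam k * _ ≤ _
  nlinarith [mul_nonneg (lam_nonneg k) (sq_nonneg q.re), mul_nonneg (lam_nonneg k) (sq_nonneg q.im)]

lemma energy_pointwise {ν ε : ℝ} (hε : 0 < ε) {k : K3} (hk : k ≠ 0) (c : Fin 3 → ℂ)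
    (S : Fin 3 → Fin 3 → ℂ) :
    ∑ i, ((starRingEnd ℂ) (c i) * (-(ν * lam k : ℝ) * c i - lerayP k (zdiv k S) i)).re ≤
      -(ν - ε) * (lam k * ∑ i, ‖c i‖ ^ 2) + 1 / (4 * ε) * ∑ i, ∑ j, ‖S i j‖ ^ 2 := by
  have hl : 0 < lam k := lt_of_lt_of_le one_pos (one_le_lam hk)
  have h1 : ∀ i, ((starRingEnd ℂ) (c i) * (-(ν * lam k : ℝ) * c i - lerayP k (zdiv k S) i)).re ≤
      -(ν - ε) * (lam k * ‖c i‖ ^ 2) + 1 / (4 * ε * lam k) * ‖lerayP k (zdiv k S) i‖ ^ 2 := by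
    intro i
    have e1 : ((starRingEnd ℂ) (c i) * (-(ν * lam k : ℝ) * c i - lerayP k (zdiv k S) i)).re =
        -(ν * lam k) * ‖c i‖ ^ 2 - ((starRingEnd ℂ) (c i) * lerayP k (zdiv k S) i).re := by
      rw [← Complex.normSq_eq_norm_sq, Complex.normSq_apply]
      simp
      ring
    have e2 : -((starRingEnd ℂ) (c i) * lerayP k (zdiv k S) i).re ≤
        ‖c i‖ * ‖lerayP k (zdiv k S) i‖ := by
      refine (neg_le_abs _).trans ((Complex.abs_re_le_norm _).trans (le_of_eq ?_))
      rw [norm_mul, RCLike.norm_conj]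
    have e3 : ‖c i‖ * ‖lerayP k (zdiv k S) i‖ ≤ ε * lam k * ‖c i‖ ^ 2 +
        1 / (4 * ε * lam k) * ‖lerayP k (zdiv k S) i‖ ^ 2 := by
      have hp : 0 < ε * lam k := by positivity
      have : ε * lam k * ‖c i‖ ^ 2 + 1 / (4 * ε * lam k) * ‖lerayP k (zdiv k S) i‖ ^ 2 -
          ‖c i‖ * ‖lerayP k (zdiv k S) i‖ =
          1 / (4 * ε * lam k) * (2 * (ε * lam k) * ‖c i‖ - ‖lerayP k (zdiv k S) i‖) ^ 2 := by
        field_simp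
        ring
      have h4 : 0 ≤ 1 / (4 * ε * lam k) *
        (2 * (ε * lam k) * ‖c i‖ - ‖lerayP k (zdiv k S) i‖) ^ 2 := by positivity
      linarith
    rw [e1]
    linarith
  refine (Finset.sum_le_sum fun i _ => h1 i).trans ?_
  rw [Finset.sum_add_distrib, ← Finset.mul_sum, ← Finset.mul_sum, ← Finset.mul_sum]
  refine add_le_add le_rfl ?_
  calc 1 / (4 * ε * lam k) * ∑ i, ‖lerayP k (zdiv k S) i‖ ^ 2
      ≤ 1 / (4 * ε * lam k) * (lam k * ∑ i, ∑ j, ‖S i j‖ ^ 2) := by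
        gcongr
        exact (norm_lerayP_sq_le hk _).trans (norm_zdiv_sq_le k S)
    _ = _ := by
        rw [← mul_assoc]
        congr 1
        field_simp

/-- Energy identity in inequality form. -/
lemma energy_sum {ν ε θ : ℝ} (hε : 0 < ε) {s : Finset K3} (hs : ∀ k ∈ s, k ≠ 0)
    (W : Fin 3 → K3 → ℂ) (c : K3 → Fin 3 → ℂ) (m : ℕ) :
    ∑ k ∈ s, lam k ^ m * ∑ i, ((starRingEnd ℂ) (c k i) * rhs ν W s θ c k i).re ≤
      -(ν - ε) * En s (m + 1) c +
        1 / (2 * ε) * (∑ k ∈ s, lam k ^ m * ∑ i, ∑ j, ‖fluxL W s c k i j‖ ^ 2) +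
        1 / (2 * ε) * (θ ^ 2 * ∑ k ∈ s, lam k ^ m * ∑ i, ∑ j, ‖fluxQ s c k i j‖ ^ 2) := by
  have key : ∀ k ∈ s, lam k ^ m * ∑ i, ((starRingEnd ℂ) (c k i) * rhs ν W s θ c k i).re ≤
      -(ν - ε) * (lam k ^ (m + 1) * ∑ i, ‖c k i‖ ^ 2) +
        1 / (2 * ε) * (lam k ^ m * ∑ i, ∑ j, ‖fluxL W s c k i j‖ ^ 2) +
        1 / (2 * ε) * (θ ^ 2 * (lam k ^ m * ∑ i, ∑ j, ‖fluxQ s c k i j‖ ^ 2)) := by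
    intro k hk
    have h1 := energy_pointwise (ν := ν) hε (hs k hk) (c k)
      (fun i j => fluxL W s c k i j + θ * fluxQ s c k i j)
    have h2 : ∑ i, ∑ j, ‖fluxL W s c k i j + θ * fluxQ s c k i j‖ ^ 2 ≤
        2 * (∑ i, ∑ j, ‖fluxL W s c k i j‖ ^ 2) +
          2 * (θ ^ 2 * ∑ i, ∑ j, ‖fluxQ s c k i j‖ ^ 2) := by
      simp only [Finset.mul_sum, ← Finset.sum_add_distrib]
      refine Finset.sum_le_sum fun i _ => Finset.sum_le_sum fun j _ => ?_
      have h3 := norm_add_le (fluxL W s c k i j) (θ * fluxQ s c k i j)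
      rw [norm_mul, Complex.norm_real, Real.norm_eq_abs] at h3
      calc _ ≤ (‖fluxL W s c k i j‖ + |θ| * ‖fluxQ s c k i j‖) ^ 2 := by gcongr
        _ ≤ 2 * ‖fluxL W s c k i j‖ ^ 2 + 2 * (|θ| ^ 2 * ‖fluxQ s c k i j‖ ^ 2) := by
          nlinarith [sq_nonneg (‖fluxL W s c k i j‖ - |θ| * ‖fluxQ s c k i j‖)]
        _ = _ := by rw [sq_abs]
    have hp : 0 ≤ lam k ^ m := pow_nonneg (lam_nonneg k) m
    calc _ ≤ lam k ^ m * (-(ν - ε) * (lam k * ∑ i, ‖c k i‖ ^ 2) + 1 / (4 * ε) *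
          (2 * (∑ i, ∑ j, ‖fluxL W s c k i j‖ ^ 2) +
          2 * (θ ^ 2 * ∑ i, ∑ j, ‖fluxQ s c k i j‖ ^ 2))) := by
          refine mul_le_mul_of_nonneg_left (h1.trans ?_) hp
          gcongr
      _ = _ := by
          field_simp
          ring
  refine (Finset.sum_le_sum key).trans (le_of_eq ?_)
  simp only [Finset.sum_add_distrib, ← Finset.mul_sum, En]

lemma weight_inv_le {k l : K3} (hl : l ≠ 0) (hkl : k - l ≠ 0) {m q : ℕ} (hq : q ≤ 2) :
    lam k ^ m * (max (lam l) (lam (k - l)) ^ (m + 2 - q) * min (lam l) (lam (k - l)) ^ q)⁻¹ ≤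
      4 ^ m * ((lam l ^ 2)⁻¹ + (lam (k - l) ^ 2)⁻¹) := by
  have h1 := one_le_lam hl
  have h2 := one_le_lam hkl
  have h3 := lam_le k l
  set x := lam l
  set y := lam (k - l)
  have hmin : 1 ≤ min x y := le_min h1 h2
  have hmm : min x y ≤ max x y := min_le_max
  have hmax : 0 < max x y := by linarith
  have h4 : lam k ≤ 4 * max x y := by linarith [le_max_left x y, le_max_right x y]
  have h5 : min x y ^ 2 * max x y ^ m ≤ max x y ^ (m + 2 - q) * min x y ^ q := by
    have e1 : m + 2 - q = m + (2 - q) := by omega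
    calc min x y ^ 2 * max x y ^ m = max x y ^ m * (min x y ^ (2 - q) * min x y ^ q) := by
          rw [← pow_add, Nat.sub_add_cancel hq]; ring
      _ ≤ max x y ^ m * (max x y ^ (2 - q) * min x y ^ q) := by gcongr
      _ = _ := by rw [e1, pow_add]; ring
  have h6 : (min x y ^ 2)⁻¹ ≤ (x ^ 2)⁻¹ + (y ^ 2)⁻¹ := by
    rcases min_choice x y with h | h <;> rw [h]
    · linarith [show 0 ≤ (y ^ 2)⁻¹ by positivity]
    · linarith [show 0 ≤ (x ^ 2)⁻¹ by positivity]
  calc _ ≤ (4 * max x y) ^ m * (min x y ^ 2 * max x y ^ m)⁻¹ := by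
        gcongr
        exact lam_nonneg k
    _ = 4 ^ m * (min x y ^ 2)⁻¹ := by
        rw [mul_pow]
        have : max x y ^ m ≠ 0 := by positivity
        field_simp
    _ ≤ _ := by gcongr

lemma max_pow_mul_min_pow_le {x y : ℝ} (hx : 0 ≤ x) (hy : 0 ≤ y) (a b : ℕ) :
    max x y ^ a * min x y ^ b ≤ x ^ b * y ^ a + x ^ a * y ^ b := by
  rcases le_total x y with h | h
  · rw [max_eq_right h, min_eq_left h]
    nlinarith [mul_nonneg (pow_nonneg hx a) (pow_nonneg hy b)]
  · rw [max_eq_left h, min_eq_right h]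
    nlinarith [mul_nonneg (pow_nonneg hx b) (pow_nonneg hy a)]

lemma fluxQ_pointwise {s : Finset K3} (hs : ∀ k ∈ s, k ≠ 0) (c : K3 → Fin 3 → ℂ)
    (hc : ∀ k ∉ s, c k = 0) (m q : ℕ) (hq : q ≤ 2) (k : K3) :
    lam k ^ m * ∑ i, ∑ j, ‖fluxQ s c k i j‖ ^ 2 ≤
      4 ^ m * (8 * Lam0) * ∑ l ∈ s.filter (fun l => k - l ∈ s),
        (lam l ^ q * lam (k - l) ^ (m + 2 - q) + lam l ^ (m + 2 - q) * lam (k - l) ^ q) *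
        ((∑ i, ‖c (k - l) i‖ ^ 2) * ∑ j, ‖c l j‖ ^ 2) := by
  set sk := s.filter (fun l => k - l ∈ s) with hsk
  set ω : K3 → ℝ := fun l =>
    max (lam l) (lam (k - l)) ^ (m + 2 - q) * min (lam l) (lam (k - l)) ^ q with hω
  have hmem : ∀ l ∈ sk, l ≠ 0 ∧ k - l ≠ 0 := fun l hl =>
    ⟨hs l (Finset.mem_filter.mp hl).1, hs _ (Finset.mem_filter.mp hl).2⟩
  have hωpos : ∀ l ∈ sk, 0 < ω l := by
    intro l hl
    have h1 := one_le_lam (hmem l hl).1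
    have h2 := one_le_lam (hmem l hl).2
    have : 0 < min (lam l) (lam (k - l)) := lt_min (by linarith) (by linarith)
    have : 0 < max (lam l) (lam (k - l)) := lt_max_of_lt_left (by linarith)
    simp only [hω]
    positivity
  have hCS : ∀ i j, ‖fluxQ s c k i j‖ ^ 2 ≤
      (∑ l ∈ sk, (ω l)⁻¹) * ∑ l ∈ sk, ω l * (‖c (k - l) i‖ ^ 2 * ‖c l j‖ ^ 2) := by
    intro i j
    have e1 : fluxQ s c k i j = ∑ l ∈ sk, c (k - l) i * c l j := by
      rw [fluxQ, hsk, Finset.sum_filter]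
      refine Finset.sum_congr rfl fun l _ => ?_
      split_ifs with h
      · rfl
      · simp [hc _ h]
    have e2 : ‖fluxQ s c k i j‖ ≤ ∑ l ∈ sk, ‖c (k - l) i‖ * ‖c l j‖ := by
      rw [e1]
      refine (norm_sum_le _ _).trans (le_of_eq ?_)
      simp only [norm_mul]
    calc _ ≤ (∑ l ∈ sk, ‖c (k - l) i‖ * ‖c l j‖) ^ 2 := by gcongr
      _ ≤ _ := by
        refine Finset.sum_sq_le_sum_mul_sum_of_sq_le_mul sk
          (fun l hl => (inv_pos.mpr (hωpos l hl)).le)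
          (fun l hl => mul_nonneg (hωpos l hl).le (by positivity)) fun l hl => ?_
        rw [← mul_assoc, inv_mul_cancel₀ (hωpos l hl).ne', one_mul, mul_pow]
  have hsum : ∑ i, ∑ j, ‖fluxQ s c k i j‖ ^ 2 ≤ (∑ l ∈ sk, (ω l)⁻¹) *
      ∑ l ∈ sk, ω l * ((∑ i, ‖c (k - l) i‖ ^ 2) * ∑ j, ‖c l j‖ ^ 2) := by
    refine (Finset.sum_le_sum fun i _ => Finset.sum_le_sum fun j _ => hCS i j).trans
      (le_of_eq ?_)
    simp only [← Finset.mul_sum]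
    congr 1
    rw [Finset.sum_congr rfl fun i _ => Finset.sum_comm, Finset.sum_comm]
    refine Finset.sum_congr rfl fun l _ => ?_
    rw [Finset.sum_mul_sum]
    simp only [Finset.mul_sum]
  have hinv : lam k ^ m * ∑ l ∈ sk, (ω l)⁻¹ ≤ 4 ^ m * (8 * Lam0) := by
    rw [Finset.mul_sum]
    calc _ ≤ ∑ l ∈ sk, 4 ^ m * ((lam l ^ 2)⁻¹ + (lam (k - l) ^ 2)⁻¹) :=
          Finset.sum_le_sum fun l hl => weight_inv_le (hmem l hl).1 (hmem l hl).2 hq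
      _ = 4 ^ m * (∑ l ∈ sk, (lam l ^ 2)⁻¹ + ∑ l ∈ sk, (lam (k - l) ^ 2)⁻¹) := by
          rw [← Finset.mul_sum, Finset.sum_add_distrib]
      _ ≤ 4 ^ m * (4 * Lam0 + 4 * Lam0) := by
          gcongr
          · exact sum_inv_lam_sq_le sk fun l hl => (hmem l hl).1
          · have hinj : Set.InjOn (fun l : K3 => k - l) sk :=
              fun a _ b _ h => sub_right_injective h
            rw [← Finset.sum_image (f := fun l => (lam l ^ 2)⁻¹) hinj]
            refine sum_inv_lam_sq_le _ fun l hl => ?_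
            obtain ⟨a, ha, rfl⟩ := Finset.mem_image.mp hl
            exact (hmem a ha).2
      _ = _ := by ring
  have hlp : 0 ≤ lam k ^ m := pow_nonneg (lam_nonneg k) m
  calc lam k ^ m * ∑ i, ∑ j, ‖fluxQ s c k i j‖ ^ 2
      ≤ lam k ^ m * ((∑ l ∈ sk, (ω l)⁻¹) *
        ∑ l ∈ sk, ω l * ((∑ i, ‖c (k - l) i‖ ^ 2) * ∑ j, ‖c l j‖ ^ 2)) := by gcongr
    _ = (lam k ^ m * ∑ l ∈ sk, (ω l)⁻¹) *
        ∑ l ∈ sk, ω l * ((∑ i, ‖c (k - l) i‖ ^ 2) * ∑ j, ‖c l j‖ ^ 2) := by ring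
    _ ≤ (4 ^ m * (8 * Lam0)) *
        ∑ l ∈ sk, ω l * ((∑ i, ‖c (k - l) i‖ ^ 2) * ∑ j, ‖c l j‖ ^ 2) := by
        refine mul_le_mul_of_nonneg_right hinv (Finset.sum_nonneg fun l hl =>
          mul_nonneg (hωpos l hl).le (by positivity))
    _ ≤ _ := by
        have := Lam0_nonneg
        gcongr with l hl
        exact max_pow_mul_min_pow_le (lam_nonneg l) (lam_nonneg _) _ _

/-- Bilinear estimate for the quadratic flux. -/
lemma fluxQ_bound {s : Finset K3} (hs : ∀ k ∈ s, k ≠ 0) (c : K3 → Fin 3 → ℂ)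
    (hc : ∀ k ∉ s, c k = 0) (m q : ℕ) (hq : q ≤ 2) :
    ∑ k ∈ s, lam k ^ m * ∑ i, ∑ j, ‖fluxQ s c k i j‖ ^ 2 ≤
      4 ^ m * (16 * Lam0) * (En s q c * En s (m + 2 - q) c) := by
  have hL := Lam0_nonneg
  set n : K3 → ℝ := fun l => ∑ i, ‖c l i‖ ^ 2 with hn
  have hn0 : ∀ l, 0 ≤ n l := fun l => Finset.sum_nonneg fun _ _ => sq_nonneg _
  set G : K3 → K3 → ℝ := fun l l' =>
    (lam l ^ q * lam l' ^ (m + 2 - q) + lam l ^ (m + 2 - q) * lam l' ^ q) * (n l' * n l) with hG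
  have hG0 : ∀ l l', 0 ≤ G l l' := fun l l' => by
    have h1 := lam_nonneg l
    have h2 := lam_nonneg l'
    have h3 := hn0 l
    have h4 := hn0 l'
    simp only [hG]
    positivity
  have h1 : ∑ k ∈ s, ∑ l ∈ s.filter (fun l => k - l ∈ s), G l (k - l) ≤
      ∑ l ∈ s, ∑ l' ∈ s, G l l' := by
    simp only [Finset.sum_filter]
    rw [Finset.sum_comm]
    refine Finset.sum_le_sum fun l _ => ?_
    rw [← Finset.sum_filter]
    have hinj : Set.InjOn (fun k : K3 => k - l) (s.filter fun k => k - l ∈ s) :=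
      fun a _ b _ h => sub_left_injective h
    rw [← Finset.sum_image (f := fun l' => G l l') hinj]
    refine Finset.sum_le_sum_of_subset_of_nonneg ?_ fun _ _ _ => hG0 _ _
    intro x hx
    obtain ⟨a, ha, rfl⟩ := Finset.mem_image.mp hx
    exact (Finset.mem_filter.mp ha).2
  have h2 : ∑ l ∈ s, ∑ l' ∈ s, G l l' = 2 * (En s q c * En s (m + 2 - q) c) := by
    have e : ∀ l l', G l l' = (lam l ^ q * n l) * (lam l' ^ (m + 2 - q) * n l') +
        (lam l ^ (m + 2 - q) * n l) * (lam l' ^ q * n l') := fun l l' => by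
      simp only [hG]; ring
    simp only [e, Finset.sum_add_distrib]
    rw [← Finset.sum_mul_sum, ← Finset.sum_mul_sum]
    simp only [En, hn]
    ring
  calc _ ≤ ∑ k ∈ s, 4 ^ m * (8 * Lam0) * ∑ l ∈ s.filter (fun l => k - l ∈ s), G l (k - l) :=
        Finset.sum_le_sum fun k _ => fluxQ_pointwise hs c hc m q hq k
    _ = 4 ^ m * (8 * Lam0) * ∑ k ∈ s, ∑ l ∈ s.filter (fun l => k - l ∈ s), G l (k - l) := by
        rw [← Finset.mul_sum]
    _ ≤ 4 ^ m * (8 * Lam0) * (2 * (En s q c * En s (m + 2 - q) c)) := by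
        rw [← h2]; gcongr
    _ = _ := by ring

end NSF

namespace NSF

/-- Convolution with the `p`-th pure derivatives of `W` is bounded on `ℓ²` by `M`. -/
def ConvBd (W : Fin 3 → K3 → ℂ) (p : ℕ) (M : ℝ) : Prop :=
  ∀ (i a : Fin 3) (A B : Finset K3) (b : K3 → ℂ),
    ∑ k ∈ A, ‖∑ l ∈ B, (((k - l) a : ℤ) : ℂ) ^ p * W i (k - l) * b l‖ ^ 2 ≤
      M ^ 2 * ∑ l ∈ B, ‖b l‖ ^ 2

/-- Constant in the bound of the linear flux. -/
def CL (m : ℕ) : ℝ := 36 * 12 ^ m * (m + 1)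

lemma CL_pos (m : ℕ) : 0 < CL m := by unfold CL; positivity

lemma conv_leibniz (W : K3 → ℂ) (s : Finset K3) (b : K3 → ℂ) (m : ℕ) (a : Fin 3) (k : K3) :
    (k a : ℂ) ^ m * ∑ l ∈ s, W (k - l) * b l =
      ∑ p ∈ Finset.range (m + 1), (m.choose p : ℂ) *
        ∑ l ∈ s, (((k - l) a : ℤ) : ℂ) ^ p * W (k - l) * ((l a : ℂ) ^ (m - p) * b l) := by
  simp only [Finset.mul_sum]
  rw [Finset.sum_comm]
  refine Finset.sum_congr rfl fun l _ => ?_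
  have h : (k a : ℂ) = (((k - l) a : ℤ) : ℂ) + (l a : ℂ) := by
    simp
  conv_lhs => rw [h, add_pow, Finset.sum_mul]
  refine Finset.sum_congr rfl fun p _ => ?_
  ring

lemma conv_pow_bound {W : Fin 3 → K3 → ℂ} {M : ℕ → ℝ} {m : ℕ}
    (hW : ∀ p ≤ m, ConvBd W p (M p)) (s : Finset K3) (b : K3 → ℂ) (i a : Fin 3) :
    ∑ k ∈ s, ((k a : ℝ) ^ m) ^ 2 * ‖∑ l ∈ s, W i (k - l) * b l‖ ^ 2 ≤
      (m + 1) * 4 ^ m * ∑ p ∈ Finset.range (m + 1), M p ^ 2 *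
        ∑ l ∈ s, lam l ^ (m - p) * ‖b l‖ ^ 2 := by
  set g : ℕ → K3 → ℂ := fun p k =>
    ∑ l ∈ s, (((k - l) a : ℤ) : ℂ) ^ p * W i (k - l) * ((l a : ℂ) ^ (m - p) * b l) with hg
  have h1 : ∀ k, ((k a : ℝ) ^ m) ^ 2 * ‖∑ l ∈ s, W i (k - l) * b l‖ ^ 2 ≤
      (m + 1) * 4 ^ m * ∑ p ∈ Finset.range (m + 1), ‖g p k‖ ^ 2 := by
    intro k
    have e1 : ((k a : ℝ) ^ m) ^ 2 * ‖∑ l ∈ s, W i (k - l) * b l‖ ^ 2 =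
        ‖(k a : ℂ) ^ m * ∑ l ∈ s, W i (k - l) * b l‖ ^ 2 := by
      rw [norm_mul, mul_pow, norm_pow, Complex.norm_intCast, ← abs_pow, sq_abs]
    rw [e1, conv_leibniz]
    have e2 : ‖∑ p ∈ Finset.range (m + 1), (m.choose p : ℂ) * g p k‖ ≤
        ∑ p ∈ Finset.range (m + 1), 2 ^ m * ‖g p k‖ := by
      refine (norm_sum_le _ _).trans (Finset.sum_le_sum fun p _ => ?_)
      rw [norm_mul, Complex.norm_natCast]
      gcongr
      exact_mod_cast Nat.choose_le_two_pow m p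
    calc _ ≤ (∑ p ∈ Finset.range (m + 1), 2 ^ m * ‖g p k‖) ^ 2 := by gcongr
      _ ≤ (Finset.range (m + 1)).card * ∑ p ∈ Finset.range (m + 1), (2 ^ m * ‖g p k‖) ^ 2 :=
          sq_sum_le_card_mul_sum_sq
      _ = _ := by
          simp only [mul_pow, ← Finset.mul_sum, Finset.card_range]
          rw [← pow_mul, mul_comm m 2, pow_mul]
          push_cast
          norm_num
          ring
  calc _ ≤ ∑ k ∈ s, (m + 1) * 4 ^ m * ∑ p ∈ Finset.range (m + 1), ‖g p k‖ ^ 2 :=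
        Finset.sum_le_sum fun k _ => h1 k
    _ = (m + 1) * 4 ^ m * ∑ p ∈ Finset.range (m + 1), ∑ k ∈ s, ‖g p k‖ ^ 2 := by
        rw [← Finset.mul_sum, Finset.sum_comm]
    _ ≤ _ := by
        gcongr with p hp
        refine (hW p (by simpa [Nat.lt_succ_iff] using hp) i a s s _).trans ?_
        gcongr with l hl
        rw [norm_mul, mul_pow, norm_pow, Complex.norm_intCast]
        gcongr
        rw [← pow_mul, mul_comm, pow_mul, sq_abs]
        gcongr
        exact sq_le_lam l a

lemma fluxL_bound {W : Fin 3 → K3 → ℂ} {M : ℕ → ℝ} {m : ℕ}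
    (hW : ∀ p ≤ m, ConvBd W p (M p)) (s : Finset K3) (c : K3 → Fin 3 → ℂ) :
    ∑ k ∈ s, lam k ^ m * ∑ i, ∑ j, ‖fluxL W s c k i j‖ ^ 2 ≤
      CL m * ∑ p ∈ Finset.range (m + 1), M p ^ 2 * En s (m - p) c := by
  set f : Fin 3 → Fin 3 → K3 → ℂ := fun i j k => ∑ l ∈ s, W i (k - l) * c l j with hf
  have h1 : ∀ k, ∑ i, ∑ j, ‖fluxL W s c k i j‖ ^ 2 ≤ 4 * ∑ i, ∑ j, ‖f i j k‖ ^ 2 := by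
    intro k
    have : ∀ i j, ‖fluxL W s c k i j‖ ^ 2 ≤ 2 * ‖f i j k‖ ^ 2 + 2 * ‖f j i k‖ ^ 2 := by
      intro i j
      have h3 : ‖fluxL W s c k i j‖ ≤ ‖f i j k‖ + ‖f j i k‖ := norm_add_le _ _
      calc _ ≤ (‖f i j k‖ + ‖f j i k‖) ^ 2 := by gcongr
        _ ≤ _ := by nlinarith [sq_nonneg (‖f i j k‖ - ‖f j i k‖)]
    refine (Finset.sum_le_sum fun i _ => Finset.sum_le_sum fun j _ => this i j).trans ?_
    simp only [Finset.sum_add_distrib, ← Finset.mul_sum]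
    rw [Finset.sum_comm (f := fun i j => ‖f j i k‖ ^ 2)]
    linarith
  have h2 : ∀ i j, ∑ k ∈ s, lam k ^ m * ‖f i j k‖ ^ 2 ≤ 3 ^ m * (3 * ((m + 1) * 4 ^ m *
      ∑ p ∈ Finset.range (m + 1), M p ^ 2 * ∑ l ∈ s, lam l ^ (m - p) * ‖c l j‖ ^ 2)) := by
    intro i j
    calc _ ≤ ∑ k ∈ s, (3 ^ m * ∑ a, ((k a : ℝ) ^ m) ^ 2) * ‖f i j k‖ ^ 2 := by
          gcongr with k hk
          exact lam_pow_le m k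
      _ = 3 ^ m * ∑ a, ∑ k ∈ s, ((k a : ℝ) ^ m) ^ 2 * ‖f i j k‖ ^ 2 := by
          rw [Finset.sum_comm, Finset.mul_sum]
          simp only [Finset.sum_mul, Finset.mul_sum, mul_assoc]
      _ ≤ 3 ^ m * ∑ a : Fin 3, ((m + 1) * 4 ^ m *
          ∑ p ∈ Finset.range (m + 1), M p ^ 2 * ∑ l ∈ s, lam l ^ (m - p) * ‖c l j‖ ^ 2) := by
          gcongr with a
          exact conv_pow_bound hW s (fun l => c l j) i a
      _ = _ := by simp
  calc _ ≤ ∑ k ∈ s, lam k ^ m * (4 * ∑ i, ∑ j, ‖f i j k‖ ^ 2) := by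
        gcongr with k hk
        · exact pow_nonneg (lam_nonneg k) m
        · exact h1 k
    _ = 4 * ∑ i, ∑ j, ∑ k ∈ s, lam k ^ m * ‖f i j k‖ ^ 2 := by
        rw [Finset.sum_congr rfl fun i _ => Finset.sum_comm, Finset.sum_comm, Finset.mul_sum]
        refine Finset.sum_congr rfl fun k _ => ?_
        simp only [Finset.mul_sum]
        refine Finset.sum_congr rfl fun i _ => Finset.sum_congr rfl fun j _ => ?_
        ring
    _ ≤ 4 * ∑ i : Fin 3, ∑ j, 3 ^ m * (3 * ((m + 1) * 4 ^ m *
      ∑ p ∈ Finset.range (m + 1), M p ^ 2 * ∑ l ∈ s, lam l ^ (m - p) * ‖c l j‖ ^ 2)) := by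
        gcongr with i _ j _
        exact h2 i j
    _ = _ := by
        have e : ∑ j, ∑ p ∈ Finset.range (m + 1), M p ^ 2 * ∑ l ∈ s, lam l ^ (m - p) * ‖c l j‖ ^ 2
            = ∑ p ∈ Finset.range (m + 1), M p ^ 2 * En s (m - p) c := by
          rw [Finset.sum_comm]
          refine Finset.sum_congr rfl fun p _ => ?_
          rw [← Finset.mul_sum, Finset.sum_comm, En]
          simp only [Finset.mul_sum]
        simp only [← Finset.mul_sum, e, Finset.sum_const, Finset.card_univ, Fintype.card_fin]
        rw [CL, show (12 : ℝ) = 3 * 4 by norm_num, mul_pow]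
        simp only [nsmul_eq_mul]
        push_cast
        ring

/-- Constant in the bound of the quadratic flux. -/
def CQ (m : ℕ) : ℝ := 4 ^ m * (16 * Lam0)

lemma CQ_nonneg (m : ℕ) : 0 ≤ CQ m := by have := Lam0_nonneg; unfold CQ; positivity

/-- Damped differential inequality, valid while the quadratic term is small. -/
lemma energy_small {ν ε θ : ℝ} (hε : 0 < ε) (h2ε : 2 * ε ≤ ν) {s : Finset K3}
    (hs : ∀ k ∈ s, k ≠ 0)
    {W : Fin 3 → K3 → ℂ} {M : ℕ → ℝ} {c : K3 → Fin 3 → ℂ} (hc : ∀ k ∉ s, c k = 0) {m : ℕ}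
    (hW : ∀ p ≤ m, ConvBd W p (M p)) (hθ : θ ^ 2 * En s 1 c * CQ m ≤ 2 * ε ^ 2) :
    2 * ∑ k ∈ s, lam k ^ m * ∑ i, ((starRingEnd ℂ) (c k i) * rhs ν W s θ c k i).re ≤
      -(2 * (ν - 2 * ε)) * En s m c +
        CL m / ε * ∑ p ∈ Finset.range (m + 1), M p ^ 2 * En s (m - p) c := by
  have h1 := energy_sum (ν := ν) (θ := θ) hε hs W c m
  have h2 := fluxL_bound hW s c
  have h3 := fluxQ_bound hs c hc m 1 (by norm_num)
  rw [show m + 2 - 1 = m + 1 by omega] at h3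
  have h4 : θ ^ 2 * ∑ k ∈ s, lam k ^ m * ∑ i, ∑ j, ‖fluxQ s c k i j‖ ^ 2 ≤
      2 * ε ^ 2 * En s (m + 1) c := by
    calc _ ≤ θ ^ 2 * (4 ^ m * (16 * Lam0) * (En s 1 c * En s (m + 1) c)) := by gcongr
      _ = θ ^ 2 * En s 1 c * CQ m * En s (m + 1) c := by rw [CQ]; ring
      _ ≤ _ := by gcongr; exact En_nonneg _ _ _
  have h5 := En_mono hs (Nat.le_succ m) c
  have h6 : 1 / (2 * ε) * (∑ k ∈ s, lam k ^ m * ∑ i, ∑ j, ‖fluxL W s c k i j‖ ^ 2) ≤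
      1 / (2 * ε) * (CL m * ∑ p ∈ Finset.range (m + 1), M p ^ 2 * En s (m - p) c) := by gcongr
  have h7 : 1 / (2 * ε) * (θ ^ 2 * ∑ k ∈ s, lam k ^ m * ∑ i, ∑ j, ‖fluxQ s c k i j‖ ^ 2) ≤
      ε * En s (m + 1) c := by
    calc _ ≤ 1 / (2 * ε) * (2 * ε ^ 2 * En s (m + 1) c) := by gcongr
      _ = _ := by field_simp
  have h8 : CL m / ε * ∑ p ∈ Finset.range (m + 1), M p ^ 2 * En s (m - p) c =
      2 * (1 / (2 * ε) * (CL m * ∑ p ∈ Finset.range (m + 1), M p ^ 2 * En s (m - p) c)) := by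
    field_simp
  rw [h8]
  have h9 : (ν - 2 * ε) * En s m c ≤ (ν - 2 * ε) * En s (m + 1) c :=
    mul_le_mul_of_nonneg_left h5 (by linarith)
  linarith

/-- Differential inequality in terms of the second order energy. -/
lemma energy_crude {ν θ : ℝ} (hν : 0 < ν) (hθ : θ ^ 2 ≤ 1) {s : Finset K3}
    (hs : ∀ k ∈ s, k ≠ 0)
    {W : Fin 3 → K3 → ℂ} {M : ℕ → ℝ} {c : K3 → Fin 3 → ℂ} (hc : ∀ k ∉ s, c k = 0) {m : ℕ}
    (hW : ∀ p ≤ m, ConvBd W p (M p)) :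
    2 * ∑ k ∈ s, lam k ^ m * ∑ i, ((starRingEnd ℂ) (c k i) * rhs ν W s θ c k i).re ≤
      (1 / ν * (CL m * ∑ p ∈ Finset.range (m + 1), M p ^ 2 + CQ m * En s 2 c)) * En s m c := by
  have h1 := energy_sum (ν := ν) (θ := θ) hν hs W c m
  have h2 := fluxL_bound hW s c
  have h3 := fluxQ_bound hs c hc m 2 le_rfl
  rw [show m + 2 - 2 = m by omega] at h3
  have h4 : θ ^ 2 * ∑ k ∈ s, lam k ^ m * ∑ i, ∑ j, ‖fluxQ s c k i j‖ ^ 2 ≤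
      CQ m * (En s 2 c * En s m c) := by
    calc _ ≤ 1 * ∑ k ∈ s, lam k ^ m * ∑ i, ∑ j, ‖fluxQ s c k i j‖ ^ 2 := by
          gcongr
          exact Finset.sum_nonneg fun k _ => mul_nonneg (pow_nonneg (lam_nonneg k) _) (by positivity)
      _ ≤ _ := by rw [one_mul]; exact h3
  have h5 : ∑ p ∈ Finset.range (m + 1), M p ^ 2 * En s (m - p) c ≤
      (∑ p ∈ Finset.range (m + 1), M p ^ 2) * En s m c := by
    rw [Finset.sum_mul]
    gcongr with p hp
    exact En_mono hs (Nat.sub_le m p) c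
  have h6 : 1 / (2 * ν) * (∑ k ∈ s, lam k ^ m * ∑ i, ∑ j, ‖fluxL W s c k i j‖ ^ 2) ≤
      1 / (2 * ν) * (CL m * ((∑ p ∈ Finset.range (m + 1), M p ^ 2) * En s m c)) := by
    have := (CL_pos m).le
    gcongr
    exact h2.trans (by gcongr)
  have h7 : 1 / (2 * ν) * (θ ^ 2 * ∑ k ∈ s, lam k ^ m * ∑ i, ∑ j, ‖fluxQ s c k i j‖ ^ 2) ≤
      1 / (2 * ν) * (CQ m * (En s 2 c * En s m c)) := by gcongr
  have h8 : (1 / ν * (CL m * ∑ p ∈ Finset.range (m + 1), M p ^ 2 + CQ m * En s 2 c)) * En s m c =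
      2 * (1 / (2 * ν) * (CL m * ((∑ p ∈ Finset.range (m + 1), M p ^ 2) * En s m c)) +
        1 / (2 * ν) * (CQ m * (En s 2 c * En s m c))) := by
    field_simp
  rw [h8]
  have : -(ν - ν) * En s (m + 1) c = 0 := by ring
  linarith

/-- Grönwall's inequality with continuous integrable coefficients. -/
lemma gronwall_int {T : ℝ} {y y' a b : ℝ → ℝ}
    (hy : ∀ t ∈ Icc 0 T, HasDerivWithinAt y (y' t) (Icc 0 T) t)
    (ha : Continuous a) (hb : Continuous b) (ha0 : ∀ t, 0 ≤ a t) (hb0 : ∀ t, 0 ≤ b t)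
    (h : ∀ t ∈ Icc 0 T, y' t ≤ a t * y t + b t) :
    ∀ t ∈ Icc 0 T, y t ≤ exp (∫ τ in (0 : ℝ)..t, a τ) * (y 0 + ∫ τ in (0 : ℝ)..t, b τ) := by
  set A : ℝ → ℝ := fun t => ∫ τ in (0 : ℝ)..t, a τ with hA
  set B : ℝ → ℝ := fun t => ∫ τ in (0 : ℝ)..t, b τ with hB
  have hA' : ∀ t, HasDerivAt A (a t) t := fun t => (ha.integral_hasStrictDerivAt 0 t).hasDerivAt
  have hB' : ∀ t, HasDerivAt B (b t) t := fun t => (hb.integral_hasStrictDerivAt 0 t).hasDerivAt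
  have hA0 : ∀ t, 0 ≤ t → 0 ≤ A t := fun t ht =>
    intervalIntegral.integral_nonneg ht fun _ _ => ha0 _
  set z : ℝ → ℝ := fun t => exp (-A t) * y t - B t with hz
  have hz' : ∀ t ∈ Icc 0 T, HasDerivWithinAt z
      (exp (-A t) * (-a t) * y t + exp (-A t) * y' t - b t) (Icc 0 T) t := fun t ht =>
    (((hA' t).neg.exp.hasDerivWithinAt).mul (hy t ht)).sub (hB' t).hasDerivWithinAt
  have hanti : AntitoneOn z (Icc 0 T) := by
    refine antitoneOn_of_deriv_nonpos (convex_Icc 0 T)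
      (fun t ht => (hz' t ht).continuousWithinAt) (fun t ht => ?_) fun t ht => ?_
    · exact ((hz' t (interior_subset ht)).mono interior_subset).differentiableWithinAt
    · have ht' := interior_subset ht
      rw [((hz' t ht').hasDerivAt (mem_interior_iff_mem_nhds.mp ht)).deriv]
      have h1 := h t ht'
      have h2 : exp (-A t) ≤ 1 := by
        rw [exp_le_one_iff]; linarith [hA0 t ht'.1]
      have h3 := exp_pos (-A t)
      have h4 := hb0 t
      nlinarith [mul_le_mul_of_nonneg_left h1 h3.le]
  intro t ht
  have h1 := hanti (left_mem_Icc.mpr (ht.1.trans ht.2)) ht ht.1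
  have hz0 : z 0 = y 0 := by simp [hz, hA, hB]
  rw [hz0] at h1
  simp only [hz] at h1
  have h2 : exp (-A t) * y t ≤ y 0 + B t := by linarith
  calc y t = exp (A t) * (exp (-A t) * y t) := by
        rw [← mul_assoc, ← Real.exp_add]; simp
    _ ≤ _ := by gcongr

end NSF

namespace NSF

/-- Solutions of the truncated system on the finite mode set `s`. -/
structure Gal (ν : ℝ) (W : Fin 3 → K3 → ℝ → ℂ) (s : Finset K3) (T : ℝ) (θ : ℝ → ℝ)
    (c : K3 → Fin 3 → ℝ → ℂ) : Prop where
  nz : ∀ k ∈ s, k ≠ 0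
  supp : ∀ k ∉ s, ∀ i t, c k i t = 0
  ode : ∀ k ∈ s, ∀ i, ∀ t ∈ Icc 0 T, HasDerivWithinAt (c k i)
    (rhs ν (fun i k => W i k t) s (θ t) (fun k i => c k i t) k i) (Icc 0 T) t

/-- The energy of order `m` along a curve of coefficients. -/
def Et (s : Finset K3) (m : ℕ) (c : K3 → Fin 3 → ℝ → ℂ) (t : ℝ) : ℝ :=
  En s m fun k i => c k i t

lemma Et_nonneg (s : Finset K3) (m : ℕ) (c : K3 → Fin 3 → ℝ → ℂ) (t : ℝ) : 0 ≤ Et s m c t :=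
  En_nonneg _ _ _

lemma hasDerivWithinAt_Et {ν T : ℝ} {W : Fin 3 → K3 → ℝ → ℂ} {s : Finset K3} {θ : ℝ → ℝ}
    {c : K3 → Fin 3 → ℝ → ℂ} (h : Gal ν W s T θ c) (m : ℕ) {t : ℝ} (ht : t ∈ Icc 0 T) :
    HasDerivWithinAt (Et s m c) (2 * ∑ k ∈ s, lam k ^ m * ∑ i, ((starRingEnd ℂ) (c k i t) *
      rhs ν (fun i k => W i k t) s (θ t) (fun k i => c k i t) k i).re) (Icc 0 T) t := by
  have h1 : ∀ k ∈ s, HasDerivWithinAt (fun t => lam k ^ m * ∑ i, ‖c k i t‖ ^ 2)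
      (lam k ^ m * ∑ i, 2 * ((starRingEnd ℂ) (c k i t) *
      rhs ν (fun i k => W i k t) s (θ t) (fun k i => c k i t) k i).re) (Icc 0 T) t := by
    intro k hk
    refine HasDerivWithinAt.const_mul _ (HasDerivWithinAt.fun_sum fun i _ => ?_)
    have := (h.ode k hk i t ht).norm_sq
    rw [Complex.inner, mul_comm (rhs _ _ _ _ _ _ _)] at this
    exact this
  have h2 := HasDerivWithinAt.fun_sum h1
  refine h2.congr_deriv ?_
  rw [Finset.mul_sum]
  refine Finset.sum_congr rfl fun k _ => ?_
  rw [← Finset.mul_sum]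
  ring

/-- Integral bounds for the coefficient functions of the linear part. -/
def IntB (M : ℕ → ℝ → ℝ) (N C1 : ℝ) (r : ℕ) (T : ℝ) : Prop :=
  ∀ p ≤ r, ∀ τ ∈ Icc 0 T, ∫ t in (0 : ℝ)..τ, M p t ^ 2 ≤ (C1 * N ^ (p - 1)) ^ 2

/-- Damped a priori bounds. -/
lemma apriori {ν σ C1 : ℝ} (hν : 0 < ν) (hσ : σ ∈ Ioo (0 : ℝ) 1) (m : ℕ) :
    ∃ D : ℝ, 0 < D ∧ ∀ (N : ℝ), 1 ≤ N → ∀ (r : ℕ), m ≤ r →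
      ∀ (W : Fin 3 → K3 → ℝ → ℂ) (M : ℕ → ℝ → ℝ) (s : Finset K3) (T : ℝ) (θ : ℝ → ℝ)
        (c : K3 → Fin 3 → ℝ → ℂ), Gal ν W s T θ c → (∀ p, Continuous (M p)) →
        (∀ p t, 0 ≤ t → ConvBd (fun i k => W i k t) p (M p t)) → IntB M N C1 r T →
        (∀ j ≤ m, ∀ t ∈ Icc 0 T, θ t ^ 2 * Et s 1 c t * CQ j ≤ 2 * (ν * (1 - σ) / 2) ^ 2) →
        ∀ t ∈ Icc 0 T, Et s m c t ≤
          D * (N ^ (m - 1)) ^ 2 * exp (-(2 * (ν * σ) * t)) * Et s m c 0 := by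
  induction m using Nat.strong_induction_on with
  | _ m ih =>
  choose! D hD0 hD using ih
  set ε : ℝ := ν * (1 - σ) / 2 with hε
  have hε0 : 0 < ε := by
    have : 0 < 1 - σ := by linarith [hσ.2]
    positivity
  set κ : ℝ := CL m / ε with hκ
  have hκ0 : 0 < κ := div_pos (CL_pos m) hε0
  set SD : ℝ := ∑ p ∈ Finset.range m, D (m - (p + 1)) with hSD
  have hSD0 : 0 ≤ SD := Finset.sum_nonneg fun p hp => (hD0 _ (by
    have := Finset.mem_range.mp hp; omega)).le
  refine ⟨exp (κ * C1 ^ 2) * (1 + κ * C1 ^ 2 * SD), by positivity, ?_⟩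
  intro N hN r hmr W M s T θ c hG hM hW hI hθ
  have hIh : ∀ j < m, ∀ t ∈ Icc 0 T, Et s j c t ≤
      D j * (N ^ (j - 1)) ^ 2 * exp (-(2 * (ν * σ) * t)) * Et s m c 0 := by
    intro j hj t ht
    refine (hD j hj N hN r (by omega) W M s T θ c hG hM hW hI
      (fun i hi => hθ i (by omega)) t ht).trans ?_
    have h0 := hD0 j hj
    have := En_mono hG.nz hj.le (fun k i => c k i 0)
    have h2 : Et s j c 0 ≤ Et s m c 0 := this
    gcongr
  have hy : ∀ t ∈ Icc 0 T, HasDerivWithinAt (fun t => exp (2 * (ν * σ) * t) * Et s m c t)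
      (exp (2 * (ν * σ) * t) * (2 * (ν * σ)) * Et s m c t + exp (2 * (ν * σ) * t) *
      (2 * ∑ k ∈ s, lam k ^ m * ∑ i, ((starRingEnd ℂ) (c k i t) *
      rhs ν (fun i k => W i k t) s (θ t) (fun k i => c k i t) k i).re)) (Icc 0 T) t := by
    intro t ht
    have h1 : HasDerivAt (fun t : ℝ => exp (2 * (ν * σ) * t))
        (exp (2 * (ν * σ) * t) * (2 * (ν * σ))) t := by
      simpa using ((hasDerivAt_id t).const_mul (2 * (ν * σ))).exp
    exact h1.hasDerivWithinAt.mul (hasDerivWithinAt_Et hG m ht)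
  have key := gronwall_int hy (a := fun t => κ * M 0 t ^ 2)
    (b := fun t => κ * ∑ p ∈ Finset.range m, M (p + 1) t ^ 2 *
      (D (m - (p + 1)) * (N ^ (m - (p + 1) - 1)) ^ 2 * Et s m c 0))
    (by have := hM 0; fun_prop)
    (by
      refine continuous_const.mul (continuous_finsetSum _ fun p _ => ?_)
      have := hM (p + 1); fun_prop)
    (fun t => by positivity)
    (fun t => by
      refine mul_nonneg hκ0.le (Finset.sum_nonneg fun p hp => mul_nonneg (sq_nonneg _) ?_)
      have h0 := hD0 (m - (p + 1)) (by have := Finset.mem_range.mp hp; omega)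
      have := Et_nonneg s m c 0
      positivity)
    (by
      intro t ht
      have h1 := energy_small (ν := ν) (θ := θ t) hε0 (by
        rw [hε]; nlinarith [hσ.1]) hG.nz (c := fun k i => c k i t)
        (fun k hk => funext fun i => hG.supp k hk i t) (m := m)
        (M := fun p => M p t) (fun p _ => hW p t ht.1) (hθ m le_rfl t ht)
      rw [show ν - 2 * ε = ν * σ by rw [hε]; ring] at h1
      rw [Finset.sum_range_succ'] at h1
      have h2 : ∑ p ∈ Finset.range m, M (p + 1) t ^ 2 * En s (m - (p + 1)) (fun k i => c k i t) ≤
          ∑ p ∈ Finset.range m, M (p + 1) t ^ 2 *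
            (D (m - (p + 1)) * (N ^ (m - (p + 1) - 1)) ^ 2 *
              exp (-(2 * (ν * σ) * t)) * Et s m c 0) := by
        refine Finset.sum_le_sum fun p hp => ?_
        have := hIh (m - (p + 1)) (by have := Finset.mem_range.mp hp; omega) t ht
        exact mul_le_mul_of_nonneg_left this (sq_nonneg _)
      have h3 : exp (2 * (ν * σ) * t) * exp (-(2 * (ν * σ) * t)) = 1 := by
        rw [← exp_add]; simp
      have h4 : exp (2 * (ν * σ) * t) * ∑ p ∈ Finset.range m, M (p + 1) t ^ 2 *
            (D (m - (p + 1)) * (N ^ (m - (p + 1) - 1)) ^ 2 *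
              exp (-(2 * (ν * σ) * t)) * Et s m c 0) = ∑ p ∈ Finset.range m, M (p + 1) t ^ 2 *
            (D (m - (p + 1)) * (N ^ (m - (p + 1) - 1)) ^ 2 * Et s m c 0) := by
        rw [Finset.mul_sum]
        refine Finset.sum_congr rfl fun p _ => ?_
        linear_combination (M (p + 1) t ^ 2 * (D (m - (p + 1)) * (N ^ (m - (p + 1) - 1)) ^ 2 *
          Et s m c 0)) * h3
      have he := exp_pos (2 * (ν * σ) * t)
      simp only [Nat.sub_zero] at h1
      change _ ≤ -(2 * (ν * σ)) * Et s m c t + κ * (_ + M 0 t ^ 2 * Et s m c t) at h1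
      have h5 := mul_le_mul_of_nonneg_left h1 he.le
      have h6 := mul_le_mul_of_nonneg_left h2 (mul_pos hκ0 he).le
      have h7 := congrArg (fun z => κ * z) h4
      beta_reduce at h7
      linarith)
  intro t ht
  have h1 := key t ht
  have hE0 := Et_nonneg s m c 0
  have hia : ∫ τ in (0 : ℝ)..t, κ * M 0 τ ^ 2 ≤ κ * C1 ^ 2 := by
    rw [intervalIntegral.integral_const_mul]
    have := hI 0 (Nat.zero_le _) t ht
    simp only [Nat.zero_sub, pow_zero, mul_one] at this
    gcongr
  have hib : ∫ τ in (0 : ℝ)..t, κ * ∑ p ∈ Finset.range m, M (p + 1) τ ^ 2 *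
      (D (m - (p + 1)) * (N ^ (m - (p + 1) - 1)) ^ 2 * Et s m c 0) ≤
      κ * (C1 ^ 2 * SD * ((N ^ (m - 1)) ^ 2 * Et s m c 0)) := by
    rw [intervalIntegral.integral_const_mul, intervalIntegral.integral_finsetSum]
    · refine mul_le_mul_of_nonneg_left ?_ hκ0.le
      rw [hSD, Finset.mul_sum, Finset.sum_mul]
      refine Finset.sum_le_sum fun p hp => ?_
      have hp' := Finset.mem_range.mp hp
      rw [intervalIntegral.integral_mul_const]
      have h2 := hI (p + 1) (by omega) t ht
      have h3 := hD0 (m - (p + 1)) (by omega)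
      have h4 : N ^ (p + 1 - 1) * N ^ (m - (p + 1) - 1) ≤ N ^ (m - 1) := by
        rw [← pow_add]
        exact pow_le_pow_right₀ hN (by omega)
      calc _ ≤ (C1 * N ^ (p + 1 - 1)) ^ 2 *
            (D (m - (p + 1)) * (N ^ (m - (p + 1) - 1)) ^ 2 * Et s m c 0) := by gcongr
        _ = C1 ^ 2 * D (m - (p + 1)) *
            ((N ^ (p + 1 - 1) * N ^ (m - (p + 1) - 1)) ^ 2 * Et s m c 0) := by ring
        _ ≤ _ := by gcongr
    · intro p _
      have := hM (p + 1)
      exact Continuous.intervalIntegrable (by fun_prop) _ _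
  have hN2 : 1 ≤ (N ^ (m - 1)) ^ 2 := one_le_pow₀ (one_le_pow₀ hN)
  have h2 : exp (2 * (ν * σ) * t) * Et s m c t ≤
      exp (κ * C1 ^ 2) * (1 + κ * C1 ^ 2 * SD) * ((N ^ (m - 1)) ^ 2 * Et s m c 0) := by
    refine h1.trans ?_
    simp only [mul_zero, exp_zero, one_mul]
    calc _ ≤ exp (κ * C1 ^ 2) * ((N ^ (m - 1)) ^ 2 * Et s m c 0 +
          κ * (C1 ^ 2 * SD * ((N ^ (m - 1)) ^ 2 * Et s m c 0))) := by
          refine mul_le_mul (exp_le_exp.mpr hia) (add_le_add ?_ hib) ?_ (exp_pos _).le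
          · nlinarith
          · refine add_nonneg hE0 (intervalIntegral.integral_nonneg ht.1 fun τ _ => ?_)
            refine mul_nonneg hκ0.le (Finset.sum_nonneg fun p hp => mul_nonneg (sq_nonneg _) ?_)
            have h0 := hD0 (m - (p + 1)) (by have := Finset.mem_range.mp hp; omega)
            positivity
      _ = _ := by ring
  have h3 : exp (-(2 * (ν * σ) * t)) * exp (2 * (ν * σ) * t) = 1 := by
    rw [← exp_add]; simp
  have h4 := mul_le_mul_of_nonneg_left h2 (exp_pos (-(2 * (ν * σ) * t))).le
  rw [← mul_assoc, h3, one_mul] at h4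
  linarith

/-- Bounds of arbitrary order on bounded time intervals, once the second-order energy is known. -/
lemma crude_bound {ν K2 T : ℝ} (hν : 0 < ν) {W : Fin 3 → K3 → ℝ → ℂ} {M : ℕ → ℝ → ℝ}
    (hM : ∀ p, Continuous (M p))
    (hW : ∀ p t, 0 ≤ t → ConvBd (fun i k => W i k t) p (M p t)) (m : ℕ) :
    ∃ K : ℝ, 0 < K ∧ ∀ (s : Finset K3) (T' : ℝ) (θ : ℝ → ℝ) (c : K3 → Fin 3 → ℝ → ℂ), T ≤ T' →
      Gal ν W s T' θ c → (∀ t, θ t ^ 2 ≤ 1) → (∀ t ∈ Icc 0 T, Et s 2 c t ≤ K2) →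
      ∀ t ∈ Icc 0 T, Et s m c t ≤ K * Et s m c 0 := by
  set a : ℝ → ℝ := fun t => 1 / ν * (CL m * ∑ p ∈ Finset.range (m + 1), M p t ^ 2 + CQ m * |K2|)
    with ha
  have hac : Continuous a := by
    refine continuous_const.mul ((continuous_const.mul
      (continuous_finsetSum _ fun p _ => ?_)).add continuous_const)
    have := hM p; fun_prop
  have ha0 : ∀ t, 0 ≤ a t := fun t => by
    have := CQ_nonneg m
    have := (CL_pos m).le
    have : 0 ≤ ∑ p ∈ Finset.range (m + 1), M p t ^ 2 := Finset.sum_nonneg fun _ _ => sq_nonneg _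
    positivity
  refine ⟨exp (∫ τ in (0 : ℝ)..T, a τ), exp_pos _, ?_⟩
  intro s T' θ c hT hG hθ h2 t ht
  have hsub : Icc 0 T ⊆ Icc 0 T' := Icc_subset_Icc_right hT
  have key := gronwall_int (T := T) (y := Et s m c) (a := a) (b := fun _ => 0)
    (fun t ht => (hasDerivWithinAt_Et hG m (hsub ht)).mono hsub) hac continuous_const ha0
    (fun _ => le_rfl) (by
      intro t ht
      have h1 := energy_crude (θ := θ t) hν (hθ t) hG.nz (c := fun k i => c k i t)
        (fun k hk => funext fun i => hG.supp k hk i t) (m := m)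
        (M := fun p => M p t) (fun p _ => hW p t ht.1)
      rw [add_zero]
      refine h1.trans (mul_le_mul_of_nonneg_right ?_ (Et_nonneg s m c t))
      have := CQ_nonneg m
      have h3 : En s 2 (fun k i => c k i t) ≤ |K2| := (h2 t ht).trans (le_abs_self _)
      rw [ha]
      beta_reduce
      gcongr) t ht
  rw [intervalIntegral.integral_zero, add_zero] at key
  refine key.trans (mul_le_mul_of_nonneg_right (exp_le_exp.mpr ?_) (Et_nonneg s m c 0))
  exact intervalIntegral.integral_mono_interval le_rfl ht.1 ht.2
    (Filter.Eventually.of_forall ha0) (hac.intervalIntegrable _ _)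

/-- Bounds of arbitrary order on bounded time intervals. -/
lemma uniform_bound {ν σ T : ℝ} (hν : 0 < ν) (hσ : σ ∈ Ioo (0 : ℝ) 1) {W : Fin 3 → K3 → ℝ → ℂ}
    {M : ℕ → ℝ → ℝ} (hM : ∀ p, Continuous (M p))
    (hW : ∀ p t, 0 ≤ t → ConvBd (fun i k => W i k t) p (M p t)) {B2 : ℝ} (m : ℕ) :
    ∃ K : ℝ, 0 < K ∧ ∀ (s : Finset K3) (T' : ℝ) (θ : ℝ → ℝ) (c : K3 → Fin 3 → ℝ → ℂ), T ≤ T' →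
      Gal ν W s T' θ c → (∀ t, θ t ^ 2 ≤ 1) →
      (∀ j ≤ 2, ∀ t ∈ Icc 0 T, θ t ^ 2 * Et s 1 c t * CQ j ≤ 2 * (ν * (1 - σ) / 2) ^ 2) →
      Et s 2 c 0 ≤ B2 →
      ∀ t ∈ Icc 0 T, Et s m c t ≤ K * Et s m c 0 := by
  set C1 : ℝ := 1 + ∑ p ∈ Finset.range 3, ∫ t in (0 : ℝ)..T, M p t ^ 2 with hC1
  obtain ⟨D, hD0, hD⟩ := apriori (C1 := C1) hν hσ 2
  obtain ⟨K, hK0, hK⟩ := crude_bound (K2 := D * |B2|) (T := T) hν hM hW m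
  refine ⟨K, hK0, fun s T' θ c hT hG hθ hsm hB t ht => hK s T' θ c hT hG hθ ?_ t ht⟩
  intro τ hτ
  have hsub : Icc 0 T ⊆ Icc 0 T' := Icc_subset_Icc_right hT
  have hG' : Gal ν W s T θ c :=
    ⟨hG.nz, hG.supp, fun k hk i t ht => (hG.ode k hk i t (hsub ht)).mono hsub⟩
  have h1 := hD 1 le_rfl 2 le_rfl W M s T θ c hG' hM hW (by
    intro p hp τ hτ
    have hInt : ∀ p, IntervalIntegrable (fun t => M p t ^ 2) volume 0 T := fun p =>
      ((hM p).pow 2).intervalIntegrable _ _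
    have hnn : ∀ p, 0 ≤ ∫ t in (0 : ℝ)..T, M p t ^ 2 := fun p =>
      intervalIntegral.integral_nonneg (hτ.1.trans hτ.2) fun _ _ => sq_nonneg _
    have h2 : ∫ t in (0 : ℝ)..τ, M p t ^ 2 ≤ ∫ t in (0 : ℝ)..T, M p t ^ 2 :=
      intervalIntegral.integral_mono_interval le_rfl hτ.1 hτ.2
        (Filter.Eventually.of_forall fun _ => sq_nonneg _) (hInt p)
    have h3 : ∫ t in (0 : ℝ)..T, M p t ^ 2 ≤
        ∑ p ∈ Finset.range 3, ∫ t in (0 : ℝ)..T, M p t ^ 2 :=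
      Finset.single_le_sum (f := fun p => ∫ t in (0 : ℝ)..T, M p t ^ 2) (fun p _ => hnn p)
        (Finset.mem_range.mpr (by omega))
    have h4 : 1 ≤ C1 := by
      have := Finset.sum_nonneg (s := Finset.range 3) fun p _ => hnn p
      linarith
    rw [one_pow, mul_one]
    nlinarith) hsm τ hτ
  refine h1.trans ?_
  have h2 : exp (-(2 * (ν * σ) * τ)) ≤ 1 := by
    rw [exp_le_one_iff]
    have := mul_pos hν hσ.1
    nlinarith [hτ.1]
  have h3 : Et s 2 c 0 ≤ |B2| := hB.trans (le_abs_self _)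
  rw [one_pow, one_pow, mul_one]
  have := Et_nonneg s 2 c 0
  calc _ ≤ D * 1 * Et s 2 c 0 := by gcongr
    _ ≤ _ := by rw [mul_one]; gcongr

end NSF

namespace NSF

/-- Smooth cutoff equal to `1` on `(-∞, δ]` and to `0` on `[2δ, ∞)`. -/
def cut (δ z : ℝ) : ℝ := Real.smoothTransition (2 - z / δ)

lemma cut_nonneg (δ z : ℝ) : 0 ≤ cut δ z := Real.smoothTransition.nonneg _

lemma cut_le_one (δ z : ℝ) : cut δ z ≤ 1 := Real.smoothTransition.le_one _

lemma cut_sq_le_one (δ z : ℝ) : cut δ z ^ 2 ≤ 1 := pow_le_one₀ (cut_nonneg _ _) (cut_le_one _ _)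

lemma cut_eq_one {δ z : ℝ} (hδ : 0 < δ) (h : z ≤ δ) : cut δ z = 1 := by
  apply Real.smoothTransition.one_of_one_le
  have : z / δ ≤ 1 := (div_le_one hδ).mpr h
  linarith

lemma cut_eq_zero {δ z : ℝ} (hδ : 0 < δ) (h : 2 * δ ≤ z) : cut δ z = 0 := by
  apply Real.smoothTransition.zero_of_nonpos
  have : 2 ≤ z / δ := (le_div_iff₀ hδ).mpr h
  linarith

lemma contDiff_cut (δ : ℝ) : ContDiff ℝ 1 (cut δ) :=
  Real.smoothTransition.contDiff.comp (contDiff_const.sub (contDiff_id.div_const _))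

lemma cut_sq_mul_le {δ z : ℝ} (hδ : 0 < δ) : cut δ z ^ 2 * z ≤ 2 * δ := by
  rcases le_total (2 * δ) z with h | h
  · rw [cut_eq_zero hδ h]; simp; positivity
  · nlinarith [cut_sq_le_one δ z]

section ODE

variable {ι : Type*} [Fintype ι]

lemma norm_sq_le_sum (x : ι → ℂ) : ‖x‖ ^ 2 ≤ ∑ i, ‖x i‖ ^ 2 := by
  have h : ‖x‖ ≤ √(∑ i, ‖x i‖ ^ 2) := by
    rw [pi_norm_le_iff_of_nonneg (Real.sqrt_nonneg _)]
    intro i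
    refine Real.le_sqrt_of_sq_le ?_
    exact Finset.single_le_sum (f := fun i => ‖x i‖ ^ 2) (fun _ _ => sq_nonneg _)
      (Finset.mem_univ i)
  calc ‖x‖ ^ 2 ≤ √(∑ i, ‖x i‖ ^ 2) ^ 2 := by gcongr
    _ = _ := Real.sq_sqrt (Finset.sum_nonneg fun _ _ => sq_nonneg _)

lemma contDiff_sum_norm_sq : ContDiff ℝ 1 fun x : ι → ℂ => ∑ i, ‖x i‖ ^ 2 :=
  ContDiff.sum fun i _ => (contDiff_apply ℝ ℂ i).norm_sq ℝ

lemma exists_lipschitz_ball {X E F : Type*} [NormedAddCommGroup X] [NormedSpace ℝ X]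
    [FiniteDimensional ℝ X] [NormedAddCommGroup E] [NormedSpace ℝ E] [FiniteDimensional ℝ E]
    [NormedAddCommGroup F] [NormedSpace ℝ F]
    {G : X × E → F} (hG : ContDiff ℝ 1 G) {W : ℝ → X} (hW : Continuous W) (T R : ℝ) :
    ∃ K L : NNReal, ∀ t ∈ Icc 0 T, LipschitzOnWith K (fun x => G (W t, x))
      (Metric.closedBall 0 R) ∧ ∀ x ∈ Metric.closedBall (0 : E) R, ‖G (W t, x)‖ ≤ L := by
  obtain ⟨B, hB⟩ := (isCompact_Icc (a := (0 : ℝ)) (b := T)).exists_bound_of_continuousOn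
    hW.continuousOn
  set S := Metric.closedBall (0 : X × E) (max B R) with hS
  have hmem : ∀ t ∈ Icc 0 T, ∀ x ∈ Metric.closedBall (0 : E) R, (W t, x) ∈ S := by
    intro t ht x hx
    rw [mem_closedBall_zero_iff] at hx
    rw [hS, mem_closedBall_zero_iff, Prod.norm_def]
    exact max_le_max (hB t ht) hx
  have hc : IsCompact S := isCompact_closedBall _ _
  obtain ⟨K, hK⟩ := hc.exists_bound_of_continuousOn (hG.continuous_fderiv one_ne_zero).continuousOn
  obtain ⟨L, hL⟩ := hc.exists_bound_of_continuousOn hG.continuous.continuousOn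
  refine ⟨K.toNNReal, L.toNNReal, fun t ht => ⟨?_, fun x hx => ?_⟩⟩
  · have h1 : LipschitzOnWith K.toNNReal G S :=
      Convex.lipschitzOnWith_of_nnnorm_fderiv_le (𝕜 := ℝ)
        (fun x _ => (hG.differentiable one_ne_zero) x)
        (fun x hx => by
          rw [← norm_toNNReal]
          exact Real.toNNReal_le_toNNReal (hK x hx)) (convex_closedBall _ _)
    intro x hx y hy
    refine (h1 (hmem t ht x hx) (hmem t ht y hy)).trans ?_
    simp [Prod.edist_eq]
  · exact (hL _ (hmem t ht x hx)).trans (Real.le_coe_toNNReal L)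

lemma ode_exists {X : Type*} [NormedAddCommGroup X] [NormedSpace ℝ X] [FiniteDimensional ℝ X]
    {G : X × (ι → ℂ) → ι → ℂ} (hG : ContDiff ℝ 1 G) {W : ℝ → X} (hW : Continuous W) {T : ℝ}
    (hT : 0 ≤ T) {K : ℝ} (hK : ∀ t ∈ Icc 0 T, ∀ x : ι → ℂ,
      2 * ∑ i, ((starRingEnd ℂ) (x i) * G (W t, x) i).re ≤ K * ∑ i, ‖x i‖ ^ 2) (x₀ : ι → ℂ) :
    ∃ x : ℝ → ι → ℂ, x 0 = x₀ ∧ ∀ t ∈ Icc 0 T, HasDerivWithinAt x (G (W t, x t)) (Icc 0 T) t := by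
  set S : (ι → ℂ) → ℝ := fun x => ∑ i, ‖x i‖ ^ 2 with hS
  have hS0 : ∀ x, 0 ≤ S x := fun x => Finset.sum_nonneg fun _ _ => sq_nonneg _
  set R : ℝ := exp (|K| * T) * S x₀ + 1 with hR
  have hR0 : 0 < R := by have := hS0 x₀; positivity
  set g : X × (ι → ℂ) → ι → ℂ := fun z => cut R (S z.2) • G z with hg
  have hgc : ContDiff ℝ 1 g :=
    ((contDiff_cut R).comp (contDiff_sum_norm_sq.comp contDiff_snd)).smul hG
  obtain ⟨K0, L, hL⟩ := exists_lipschitz_ball hgc hW T √(2 * R)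
  have hL' : ∀ t ∈ Icc 0 T, ∀ x, ‖g (W t, x)‖ ≤ L := by
    intro t ht x
    rcases le_total (2 * R) (S x) with h | h
    · simp only [hg, cut_eq_zero hR0 h, zero_smul, norm_zero]
      exact L.2
    · refine (hL t ht).2 x ?_
      rw [mem_closedBall_zero_iff]
      exact Real.le_sqrt_of_sq_le ((norm_sq_le_sum x).trans h)
  set a : NNReal := L * T.toNNReal with ha
  obtain ⟨K1, _, hK1⟩ := exists_lipschitz_ball hgc hW T (‖x₀‖ + a)
  have hpl : IsPicardLindelof (fun t x => g (W t, x)) (tmin := 0) (tmax := T)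
      ⟨0, le_rfl, hT⟩ x₀ a 0 L K1 :=
    { lipschitzOnWith := fun t ht => (hK1 t ht).1.mono (by
        intro y hy
        rw [mem_closedBall_zero_iff]
        rw [Metric.mem_closedBall, dist_eq_norm] at hy
        calc ‖y‖ = ‖x₀ + (y - x₀)‖ := by congr 1; abel
          _ ≤ _ := (norm_add_le _ _).trans (by gcongr))
      continuousOn := fun x _ =>
        (hgc.continuous.comp (hW.prodMk continuous_const)).continuousOn
      norm_le := fun t ht x _ => hL' t ht x
      mul_max_le := by simp [ha, hT] }
  obtain ⟨x, hx0, hx⟩ := hpl.exists_eq_forall_mem_Icc_hasDerivWithinAt₀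
  refine ⟨x, hx0, fun t ht => ?_⟩
  have key := gronwall_int (T := T) (y := fun t => S (x t)) (a := fun _ => |K|) (b := fun _ => 0)
    (y' := fun t => ∑ i, 2 * ((starRingEnd ℂ) (x t i) * g (W t, x t) i).re)
    (fun t ht => HasDerivWithinAt.fun_sum fun i _ => by
      have := ((hasDerivWithinAt_pi.mp (hx t ht)) i).norm_sq
      rw [Complex.inner, mul_comm (g _ _)] at this
      exact this)
    continuous_const continuous_const (fun _ => abs_nonneg _) (fun _ => le_rfl) (by
      intro t ht
      have h1 := hK t ht (x t)
      have h2 : ∑ i, 2 * ((starRingEnd ℂ) (x t i) * g (W t, x t) i).re =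
          cut R (S (x t)) * (2 * ∑ i, ((starRingEnd ℂ) (x t i) * G (W t, x t) i).re) := by
        rw [Finset.mul_sum, Finset.mul_sum]
        refine Finset.sum_congr rfl fun i _ => ?_
        simp only [hg, Pi.smul_apply, Complex.real_smul]
        rw [show (starRingEnd ℂ) (x t i) * ((cut R (S (x t)) : ℂ) * G (W t, x t) i) =
          (cut R (S (x t)) : ℂ) * ((starRingEnd ℂ) (x t i) * G (W t, x t) i) by ring,
          Complex.re_ofReal_mul]
        ring
      rw [h2, add_zero]
      have h3 : 2 * ∑ i, ((starRingEnd ℂ) (x t i) * G (W t, x t) i).re ≤ |K| * S (x t) :=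
        h1.trans (mul_le_mul_of_nonneg_right (le_abs_self K) (hS0 _))
      calc _ ≤ cut R (S (x t)) * (|K| * S (x t)) :=
            mul_le_mul_of_nonneg_left h3 (cut_nonneg _ _)
        _ ≤ 1 * (|K| * S (x t)) :=
            mul_le_mul_of_nonneg_right (cut_le_one _ _) (mul_nonneg (abs_nonneg _) (hS0 _))
        _ = _ := one_mul _) t ht
  rw [hx0] at key
  have hle : S (x t) ≤ R := by
    refine key.trans ?_
    simp only [intervalIntegral.integral_const, smul_eq_mul, sub_zero, mul_zero, add_zero]
    have h1 : exp (t * |K|) ≤ exp (|K| * T) := by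
      rw [mul_comm]
      exact exp_le_exp.mpr (mul_le_mul_of_nonneg_left ht.2 (abs_nonneg _))
    have := mul_le_mul_of_nonneg_right h1 (hS0 x₀)
    linarith
  have := hx t ht
  simp only [hg, cut_eq_one hR0 hle, one_smul] at this
  exact this

lemma ode_unique {X : Type*} [NormedAddCommGroup X] [NormedSpace ℝ X] [FiniteDimensional ℝ X]
    {G : X × (ι → ℂ) → ι → ℂ} (hG : ContDiff ℝ 1 G) {W : ℝ → X} (hW : Continuous W) {T : ℝ}
    {x y : ℝ → ι → ℂ}
    (hx : ∀ t ∈ Icc 0 T, HasDerivWithinAt x (G (W t, x t)) (Icc 0 T) t)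
    (hy : ∀ t ∈ Icc 0 T, HasDerivWithinAt y (G (W t, y t)) (Icc 0 T) t)
    (h0 : x 0 = y 0) : EqOn x y (Icc 0 T) := by
  have hxc : ContinuousOn x (Icc 0 T) := fun t ht => (hx t ht).continuousWithinAt
  have hyc : ContinuousOn y (Icc 0 T) := fun t ht => (hy t ht).continuousWithinAt
  obtain ⟨B1, hB1⟩ := isCompact_Icc.exists_bound_of_continuousOn hxc
  obtain ⟨B2, hB2⟩ := isCompact_Icc.exists_bound_of_continuousOn hyc
  obtain ⟨K, _, hK⟩ := exists_lipschitz_ball hG hW T (max B1 B2)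
  have hr : ∀ {z : ℝ → ι → ℂ}, (∀ t ∈ Icc 0 T, HasDerivWithinAt z (G (W t, z t)) (Icc 0 T) t) →
      ∀ t ∈ Ico 0 T, HasDerivWithinAt z (G (W t, z t)) (Ici t) t := by
    intro z hz t ht
    refine (hz t ⟨ht.1, ht.2.le⟩).mono_of_mem_nhdsWithin ?_
    exact Filter.mem_of_superset (Icc_mem_nhdsGE ht.2) (Icc_subset_Icc_left ht.1)
  refine ODE_solution_unique_of_mem_Icc_right (v := fun t x => G (W t, x))
    (s := fun _ => Metric.closedBall 0 (max B1 B2)) (K := K)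
    (fun t ht => (hK t ⟨ht.1, ht.2.le⟩).1) hxc (hr hx) (fun t ht => ?_) hyc (hr hy)
    (fun t ht => ?_) h0
  · rw [mem_closedBall_zero_iff]
    exact (hB1 t ⟨ht.1, ht.2.le⟩).trans (le_max_left _ _)
  · rw [mem_closedBall_zero_iff]
    exact (hB2 t ⟨ht.1, ht.2.le⟩).trans (le_max_right _ _)

end ODE

end NSF

namespace NSF

lemma contDiff_rhs {Z : Type*} [NormedAddCommGroup Z] [NormedSpace ℝ Z] (ν : ℝ)
    {W : Z → Fin 3 → K3 → ℂ} {s : Finset K3} {θ : Z → ℝ} {c : Z → K3 → Fin 3 → ℂ}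
    (hW : ∀ i k, ContDiff ℝ 1 fun z => W z i k) (hθ : ContDiff ℝ 1 θ)
    (hc : ∀ k i, ContDiff ℝ 1 fun z => c z k i) (k : K3) (i : Fin 3) :
    ContDiff ℝ 1 fun z => rhs ν (W z) s (θ z) (c z) k i := by
  have hθ' : ContDiff ℝ 1 fun z => (θ z : ℂ) := Complex.ofRealCLM.contDiff.comp hθ
  have hz : ∀ i, ContDiff ℝ 1 fun z => zdiv k (fun i j =>
      fluxL (W z) s (c z) k i j + θ z * fluxQ s (c z) k i j) i := by
    intro i
    unfold zdiv fluxL fluxQ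
    refine contDiff_const.mul (ContDiff.sum fun j _ => contDiff_const.mul ?_)
    refine ((ContDiff.sum fun l _ => (hW _ _).mul (hc _ _)).add
      (ContDiff.sum fun l _ => (hW _ _).mul (hc _ _))).add (hθ'.mul ?_)
    exact ContDiff.sum fun l _ => (hc _ _).mul (hc _ _)
  unfold rhs lerayP
  refine (contDiff_const.mul (hc k i)).sub ((hz i).sub (contDiff_const.mul ?_))
  exact (ContDiff.sum fun j _ => contDiff_const.mul (hz j)).div_const _

lemma rhs_congr {ν : ℝ} {W W' : Fin 3 → K3 → ℂ} {s : Finset K3} {θ : ℝ} {c : K3 → Fin 3 → ℂ}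
    {k : K3} (hk : k ∈ s) (h : ∀ i, ∀ k ∈ s, ∀ l ∈ s, W i (k - l) = W' i (k - l)) (i : Fin 3) :
    rhs ν W s θ c k i = rhs ν W' s θ c k i := by
  have : ∀ i j, fluxL W s c k i j = fluxL W' s c k i j := by
    intro i j
    unfold fluxL
    congr 1
    · exact Finset.sum_congr rfl fun l hl => by rw [h i k hk l hl]
    · exact Finset.sum_congr rfl fun l hl => by rw [h j k hk l hl]
  simp only [rhs, this]

lemma sum_neg_reindex {β : Type*} [AddCommMonoid β] {s : Finset K3} (hs : ∀ k ∈ s, -k ∈ s)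
    (f : K3 → β) : ∑ l ∈ s, f (-l) = ∑ l ∈ s, f l := by
  refine Finset.sum_nbij' (fun l => -l) (fun l => -l) hs hs ?_ ?_ ?_ <;> simp

lemma lerayP_conj (k : K3) (z : Fin 3 → ℂ) (i : Fin 3) :
    lerayP k (fun i => (starRingEnd ℂ) (z i)) i = (starRingEnd ℂ) (lerayP (-k) z i) := by
  simp only [lerayP, lam_neg, Pi.neg_apply, map_sub, map_mul, map_div₀, map_sum,
    Complex.conj_ofReal]
  simp [Finset.sum_neg_distrib]
  ring

lemma zdiv_conj (k : K3) (S : Fin 3 → Fin 3 → ℂ) (i : Fin 3) :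
    zdiv k (fun i j => (starRingEnd ℂ) (S i j)) i = (starRingEnd ℂ) (zdiv (-k) S i) := by
  simp [zdiv]

lemma rhs_conj {ν : ℝ} {W : Fin 3 → K3 → ℂ} {s : Finset K3} {θ : ℝ} (c : K3 → Fin 3 → ℂ)
    (hs : ∀ k ∈ s, -k ∈ s) (hW : ∀ i k, W i (-k) = (starRingEnd ℂ) (W i k)) (k : K3) (i : Fin 3) :
    rhs ν W s θ (fun k i => (starRingEnd ℂ) (c (-k) i)) k i =
      (starRingEnd ℂ) (rhs ν W s θ c (-k) i) := by
  have hL : ∀ i j, fluxL W s (fun k i => (starRingEnd ℂ) (c (-k) i)) k i j =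
      (starRingEnd ℂ) (fluxL W s c (-k) i j) := by
    intro i j
    simp only [fluxL, map_add, map_sum, map_mul]
    rw [← sum_neg_reindex hs, ← sum_neg_reindex hs (fun l => W j (k - l) * _)]
    simp only [neg_neg, ← hW]
    congr 1 <;>
    exact Finset.sum_congr rfl fun l _ => by congr 2; abel
  have hQ : ∀ i j, fluxQ s (fun k i => (starRingEnd ℂ) (c (-k) i)) k i j =
      (starRingEnd ℂ) (fluxQ s c (-k) i j) := by
    intro i j
    simp only [fluxQ, map_sum, map_mul]
    rw [← sum_neg_reindex hs]
    refine Finset.sum_congr rfl fun l _ => ?_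
    rw [neg_neg, show -(k - -l) = -k - l by abel]
  have hz : ∀ i, zdiv k (fun i j => fluxL W s (fun k i => (starRingEnd ℂ) (c (-k) i)) k i j +
      θ * fluxQ s (fun k i => (starRingEnd ℂ) (c (-k) i)) k i j) i =
      (starRingEnd ℂ) (zdiv (-k) (fun i j => fluxL W s c (-k) i j + θ * fluxQ s c (-k) i j) i) := by
    intro i
    rw [← zdiv_conj]
    congr 1
    funext i j
    rw [hL, hQ, map_add, map_mul, Complex.conj_ofReal]
  simp only [rhs, map_sub, map_mul, ← lerayP_conj, lam_neg, map_neg, Complex.conj_ofReal]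
  congr 2
  funext i
  exact hz i

lemma En_conj {s : Finset K3} (hs : ∀ k ∈ s, -k ∈ s) (m : ℕ) (c : K3 → Fin 3 → ℂ) :
    En s m (fun k i => (starRingEnd ℂ) (c (-k) i)) = En s m c := by
  unfold En
  rw [← sum_neg_reindex hs]
  simp only [RCLike.norm_conj, neg_neg, lam_neg]

/-- Extension by zero of a finite family of modes. -/
def extc (s : Finset K3) (x : ↥s × Fin 3 → ℂ) (k : K3) (i : Fin 3) : ℂ :=
  if h : k ∈ s then x (⟨k, h⟩, i) else 0

lemma contDiff_extc (s : Finset K3) (k : K3) (i : Fin 3) :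
    ContDiff ℝ 1 fun x : ↥s × Fin 3 → ℂ => extc s x k i := by
  unfold extc
  split_ifs with h
  · exact contDiff_apply ℝ ℂ _
  · exact contDiff_const

/-- Extension by zero of a finite family of coefficients. -/
def extw (D : Finset K3) (x : Fin 3 × ↥D → ℂ) (i : Fin 3) (k : K3) : ℂ :=
  if h : k ∈ D then x (i, ⟨k, h⟩) else 0

lemma contDiff_extw (s : Finset K3) (i : Fin 3) (k : K3) :
    ContDiff ℝ 1 fun x : Fin 3 × ↥s → ℂ => extw s x i k := by
  unfold extw
  split_ifs with h
  · exact contDiff_apply ℝ ℂ _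
  · exact contDiff_const

lemma gal_exists {ν σ δ : ℝ} (hν : 0 < ν) (hσ : σ ∈ Ioo (0 : ℝ) 1) (hδ : 0 < δ)
    (hsm : 2 * δ * CQ 0 ≤ 2 * (ν * (1 - σ) / 2) ^ 2) {W : Fin 3 → K3 → ℝ → ℂ}
    (hWc : ∀ i k, Continuous (W i k)) {M : ℝ → ℝ} (hM : Continuous M)
    (hW : ∀ t, 0 ≤ t → ConvBd (fun i k => W i k t) 0 (M t))
    (hWs : ∀ i k t, W i (-k) t = (starRingEnd ℂ) (W i k t))
    {s : Finset K3} (hs0 : ∀ k ∈ s, k ≠ 0) (hs : ∀ k ∈ s, -k ∈ s) {T : ℝ} (hT : 0 ≤ T)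
    {c0 : K3 → Fin 3 → ℂ} (hc0 : ∀ k i, c0 (-k) i = (starRingEnd ℂ) (c0 k i)) :
    ∃ c : K3 → Fin 3 → ℝ → ℂ, Gal ν W s T (fun t => cut δ (Et s 1 c t)) c ∧
      (∀ k ∈ s, ∀ i, c k i 0 = c0 k i) ∧
      ∀ k i, ∀ t ∈ Icc 0 T, c (-k) i t = (starRingEnd ℂ) (c k i t) := by
  set D : Finset K3 := (s ×ˢ s).image (fun p => p.1 - p.2) with hD
  set Wt : ℝ → Fin 3 × ↥D → ℂ := fun t p => W p.1 p.2 t with hWt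
  have hWtc : Continuous Wt := continuous_pi fun p => hWc _ _
  have hWe : ∀ t i, ∀ k ∈ s, ∀ l ∈ s, extw D (Wt t) i (k - l) = W i (k - l) t := by
    intro t i k hk l hl
    have : k - l ∈ D := Finset.mem_image.mpr ⟨(k, l), Finset.mem_product.mpr ⟨hk, hl⟩, rfl⟩
    rw [extw, dif_pos this]
  set G : (Fin 3 × ↥D → ℂ) × (↥s × Fin 3 → ℂ) → ↥s × Fin 3 → ℂ := fun z p =>
    rhs ν (extw D z.1) s (cut δ (En s 1 (extc s z.2))) (extc s z.2) p.1 p.2 with hG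
  have hGc : ContDiff ℝ 1 G := by
    refine contDiff_pi.mpr fun p => contDiff_rhs ν
      (fun i k => (contDiff_extw D i k).comp contDiff_fst) ?_
      (fun k i => (contDiff_extc s k i).comp contDiff_snd) _ _
    refine (contDiff_cut δ).comp (ContDiff.sum fun k _ => contDiff_const.mul
      (ContDiff.sum fun i _ => ?_))
    exact ((contDiff_extc s k i).comp contDiff_snd).norm_sq ℝ
  have hGe : ∀ t x k (hk : k ∈ s) i, G (Wt t, x) (⟨k, hk⟩, i) =
      rhs ν (fun i k => W i k t) s (cut δ (En s 1 (extc s x))) (extc s x) k i := by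
    intro t x k hk i
    exact rhs_congr hk (hWe t) i
  have hext : ∀ (x : ↥s × Fin 3 → ℂ) (p : ↥s) i, extc s x p i = x (p, i) := by
    intro x p i
    rw [extc, dif_pos p.2]
  have hsupp : ∀ (x : ↥s × Fin 3 → ℂ), ∀ k ∉ s, extc s x k = 0 := by
    intro x k hk
    funext i
    rw [extc, dif_neg hk]; rfl
  obtain ⟨B, hB⟩ := (isCompact_Icc (a := (0 : ℝ)) (b := T)).exists_bound_of_continuousOn
    hM.continuousOn
  set ε : ℝ := ν * (1 - σ) / 2 with hε
  have hε0 : 0 < ε := by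
    have : 0 < 1 - σ := by linarith [hσ.2]
    positivity
  have hEn0 : ∀ x : ↥s × Fin 3 → ℂ, En s 0 (extc s x) = ∑ p, ‖x p‖ ^ 2 := by
    intro x
    simp only [En, pow_zero, one_mul]
    rw [← Finset.sum_coe_sort s, Fintype.sum_prod_type]
    simp only [hext]
  have hen : ∀ t ∈ Icc 0 T, ∀ x : ↥s × Fin 3 → ℂ,
      2 * ∑ p, ((starRingEnd ℂ) (x p) * G (Wt t, x) p).re ≤
        (CL 0 / ε * B ^ 2) * ∑ p, ‖x p‖ ^ 2 := by
    intro t ht x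
    have h1 := energy_small (ν := ν) (θ := cut δ (En s 1 (extc s x))) (ε := ε) hε0
      (by rw [hε]; nlinarith [hσ.1]) hs0 (hsupp x) (m := 0) (W := fun i k => W i k t)
      (M := fun _ => M t)
      (fun p hp => by rw [Nat.le_zero.mp hp]; exact hW t ht.1)
      ((mul_le_mul_of_nonneg_right (cut_sq_mul_le hδ) (CQ_nonneg 0)).trans hsm)
    rw [hEn0] at h1
    have h2 : ∑ k ∈ s, lam k ^ 0 * ∑ i, ((starRingEnd ℂ) (extc s x k i) *
        rhs ν (fun i k => W i k t) s (cut δ (En s 1 (extc s x))) (extc s x) k i).re =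
        ∑ p, ((starRingEnd ℂ) (x p) * G (Wt t, x) p).re := by
      simp only [pow_zero, one_mul]
      rw [← Finset.sum_coe_sort s, Fintype.sum_prod_type]
      refine Finset.sum_congr rfl fun p _ => Finset.sum_congr rfl fun i _ => ?_
      rw [hext, ← hGe t x p p.2 i]
    rw [h2] at h1
    simp only [zero_add, Finset.sum_range_one, Nat.sub_zero] at h1
    rw [hEn0] at h1
    have h3 : M t ^ 2 ≤ B ^ 2 := by
      rw [← sq_abs (M t)]
      have := hB t ht
      rw [Real.norm_eq_abs] at this
      gcongr
    have h4 : 0 ≤ ∑ p, ‖x p‖ ^ 2 := Finset.sum_nonneg fun _ _ => sq_nonneg _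
    have h5 : 0 ≤ CL 0 / ε := (div_pos (CL_pos 0) hε0).le
    have h6 : 0 ≤ 2 * (ν - 2 * ε) := by rw [hε]; nlinarith [hσ.1, mul_pos hν hσ.1]
    calc _ ≤ -(2 * (ν - 2 * ε)) * ∑ p, ‖x p‖ ^ 2 + CL 0 / ε * (M t ^ 2 * ∑ p, ‖x p‖ ^ 2) := h1
      _ ≤ 0 + CL 0 / ε * (B ^ 2 * ∑ p, ‖x p‖ ^ 2) := by
          gcongr
          nlinarith
      _ = _ := by ring
  obtain ⟨x, hx0, hx⟩ := ode_exists hGc hWtc hT hen (fun p => c0 p.1 p.2)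
  set y : ℝ → ↥s × Fin 3 → ℂ := fun t p => (starRingEnd ℂ) (extc s (x t) (-p.1) p.2) with hy
  have hyx : ∀ t, extc s (y t) = fun k i => (starRingEnd ℂ) (extc s (x t) (-k) i) := by
    intro t
    funext k i
    by_cases hk : k ∈ s
    · rw [extc, dif_pos hk]
    · have : -k ∉ s := fun h => hk (by simpa using hs _ h)
      rw [hsupp _ k hk, hsupp _ _ this]; simp
  have hy' : ∀ t ∈ Icc 0 T, HasDerivWithinAt y (G (Wt t, y t)) (Icc 0 T) t := by
    intro t ht
    rw [hasDerivWithinAt_pi]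
    rintro ⟨⟨k, hk⟩, i⟩
    have hk' := hs k hk
    have h1 := (hasDerivWithinAt_pi.mp (hx t ht)) (⟨-k, hk'⟩, i)
    have h2 : HasDerivWithinAt (fun t => (starRingEnd ℂ) (x t (⟨-k, hk'⟩, i)))
        ((starRingEnd ℂ) (G (Wt t, x t) (⟨-k, hk'⟩, i))) (Icc 0 T) t := by
      have := (Complex.conjCLE.toContinuousLinearMap.hasFDerivAt
        (x := x t (⟨-k, hk'⟩, i))).comp_hasDerivWithinAt t h1
      exact this
    have h3 : G (Wt t, y t) (⟨k, hk⟩, i) = (starRingEnd ℂ) (G (Wt t, x t) (⟨-k, hk'⟩, i)) := by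
      rw [hGe, hGe, hyx, En_conj hs, rhs_conj _ hs (fun i k => hWs i k t)]
    rw [h3]
    refine h2.congr_of_mem (fun τ _ => ?_) ht
    simp only [hy]
    rw [extc, dif_pos hk']
  have hxy := ode_unique hGc hWtc hx hy' (by
    rw [hx0]
    funext ⟨⟨k, hk⟩, i⟩
    simp only [hy]
    rw [extc, dif_pos (hs k hk), hx0]
    simp only
    rw [hc0, Complex.conj_conj])
  refine ⟨fun k i t => extc s (x t) k i, ⟨hs0, fun k hk i t => ?_, ?_⟩, ?_, ?_⟩
  · exact congrFun (hsupp (x t) k hk) i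
  · intro k hk i t ht
    have h1 := (hasDerivWithinAt_pi.mp (hx t ht)) (⟨k, hk⟩, i)
    rw [hGe] at h1
    refine h1.congr_of_mem (fun τ _ => ?_) ht
    rw [extc, dif_pos hk]
  · intro k hk i
    beta_reduce
    rw [extc, dif_pos hk, hx0]
  · intro k i t ht
    have h1 := congrFun (congrFun (hyx t) k) i
    rw [← hxy ht] at h1
    beta_reduce
    rw [h1, Complex.conj_conj]

end NSF

namespace NSF

/-- The Sobolev weight. -/
def wt (k : K3) : ℝ := 1 + lam k

lemma one_le_wt (k : K3) : 1 ≤ wt k := by have := lam_nonneg k; unfold wt; linarith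

lemma wt_pos (k : K3) : 0 < wt k := lt_of_lt_of_le one_pos (one_le_wt k)

lemma wt_le (k l : K3) : wt k ≤ 2 * (wt (k - l) * wt l) := one_add_lam_le k l

lemma abs_le_wt (k : K3) (a : Fin 3) : |(k a : ℝ)| ≤ wt k := abs_le_one_add_lam k a

/-- Total mass of the summable weight. -/
def Lam1 : ℝ := ∑' k : K3, (wt k ^ 2)⁻¹

lemma summable_wt : Summable fun k : K3 => (wt k ^ 2)⁻¹ := summable_weight

lemma Lam1_nonneg : 0 ≤ Lam1 := tsum_nonneg fun k => by have := wt_pos k; positivity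

lemma wt_bound_mono {m n : ℕ} (hmn : m ≤ n) {A : ℝ} {k : K3} {z : ℂ} (h : wt k ^ n * ‖z‖ ≤ A) :
    wt k ^ m * ‖z‖ ≤ A :=
  (mul_le_mul_of_nonneg_right (pow_le_pow_right₀ (one_le_wt k) hmn) (norm_nonneg _)).trans h

lemma summable_of_wt {A : ℝ} {a : K3 → ℂ} (h : ∀ k, wt k ^ 2 * ‖a k‖ ≤ A) :
    Summable fun k => ‖a k‖ := by
  refine Summable.of_nonneg_of_le (fun _ => norm_nonneg _) (fun k => ?_) (summable_wt.mul_left A)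
  have := wt_pos k
  rw [← div_eq_mul_inv, le_div_iff₀ (by positivity), mul_comm]
  exact h k

lemma norm_tsum_le_of_wt {A : ℝ} {a : K3 → ℂ} (h : ∀ k, wt k ^ 2 * ‖a k‖ ≤ A) :
    ‖∑' k, a k‖ ≤ A * Lam1 := by
  rw [Lam1, ← tsum_mul_left]
  refine (norm_tsum_le_tsum_norm (summable_of_wt h)).trans
    (Summable.tsum_le_tsum (fun k => ?_) (summable_of_wt h) (summable_wt.mul_left A))
  have := wt_pos k
  rw [← div_eq_mul_inv, le_div_iff₀ (by positivity), mul_comm]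
  exact h k

/-- Discrete convolution. -/
def conv (a b : K3 → ℂ) (k : K3) : ℂ := ∑' l, a (k - l) * b l

lemma conv_term_bound {m : ℕ} {A B : ℝ} {a b : K3 → ℂ} (ha : ∀ k, wt k ^ m * ‖a k‖ ≤ A)
    (hb : ∀ k, wt k ^ (m + 2) * ‖b k‖ ≤ B) (k l : K3) :
    wt l ^ 2 * ‖(wt k ^ m : ℝ) * (a (k - l) * b l)‖ ≤ 2 ^ m * A * B := by
  have h1 := wt_pos k
  have h2 := wt_pos l
  have h3 := wt_pos (k - l)
  rw [norm_mul, norm_mul, Complex.norm_real, Real.norm_of_nonneg (by positivity)]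
  have hA : 0 ≤ A := le_trans (by positivity) (ha (k - l))
  calc wt l ^ 2 * (wt k ^ m * (‖a (k - l)‖ * ‖b l‖))
      ≤ wt l ^ 2 * ((2 * (wt (k - l) * wt l)) ^ m * (‖a (k - l)‖ * ‖b l‖)) := by
        gcongr; exact wt_le k l
    _ = 2 ^ m * (wt (k - l) ^ m * ‖a (k - l)‖) * (wt l ^ (m + 2) * ‖b l‖) := by ring
    _ ≤ 2 ^ m * A * B := by
        refine mul_le_mul ?_ (hb l) (by positivity) (by positivity)
        exact mul_le_mul_of_nonneg_left (ha _) (by positivity)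

lemma conv_summable {m : ℕ} {A B : ℝ} {a b : K3 → ℂ} (ha : ∀ k, wt k ^ m * ‖a k‖ ≤ A)
    (hb : ∀ k, wt k ^ (m + 2) * ‖b k‖ ≤ B) (k : K3) : Summable fun l => a (k - l) * b l := by
  have h := conv_term_bound (m := 0) (fun k => wt_bound_mono (Nat.zero_le m) (ha k))
    (fun k => wt_bound_mono (by omega) (hb k)) k
  simp only [pow_zero, Complex.ofReal_one, one_mul] at h
  exact (summable_of_wt h).of_norm

lemma conv_bound {m : ℕ} {A B : ℝ} {a b : K3 → ℂ} (ha : ∀ k, wt k ^ m * ‖a k‖ ≤ A)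
    (hb : ∀ k, wt k ^ (m + 2) * ‖b k‖ ≤ B) (k : K3) :
    wt k ^ m * ‖conv a b k‖ ≤ 2 ^ m * A * B * Lam1 := by
  have h := norm_tsum_le_of_wt (conv_term_bound ha hb k)
  rw [tsum_mul_left, norm_mul, Complex.norm_real, Real.norm_of_nonneg
    (pow_nonneg (wt_pos k).le _)] at h
  exact h

/-- Rapid decay in frequency, locally uniformly in time. -/
def Dec (a : K3 → ℝ → ℂ) : Prop :=
  ∀ (T : ℝ) (m : ℕ), ∃ C : ℝ, ∀ t ∈ Icc 0 T, ∀ k, wt k ^ m * ‖a k t‖ ≤ C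

/-- Quadratic first-order expansion in time, with rapid decay in frequency. -/
def D1 (a a' : K3 → ℝ → ℂ) : Prop :=
  ∀ (T : ℝ) (m : ℕ), ∃ C : ℝ, ∀ s ∈ Icc 0 T, ∀ t ∈ Icc 0 T, ∀ k,
    wt k ^ m * ‖a k t - a k s - (t - s : ℝ) * a' k s‖ ≤ C * |t - s| ^ 2

/-- Families of coefficients that are `n` times differentiable in time, with rapid decay. -/
def SM : ℕ → (K3 → ℝ → ℂ) → Prop
  | 0, a => Dec a
  | n + 1, a => Dec a ∧ ∃ a', D1 a a' ∧ SM n a'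

lemma SM.dec {n : ℕ} {a : K3 → ℝ → ℂ} (h : SM n a) : Dec a := by
  cases n with
  | zero => exact h
  | succ n => exact h.1

lemma SM.pred {n : ℕ} {a : K3 → ℝ → ℂ} (h : SM (n + 1) a) : SM n a := by
  induction n generalizing a with
  | zero => exact h.1
  | succ n ih =>
    obtain ⟨h1, a', h2, h3⟩ := h
    exact ⟨h1, a', h2, ih h3⟩

lemma Dec.add {a b : K3 → ℝ → ℂ} (ha : Dec a) (hb : Dec b) : Dec fun k t => a k t + b k t := by
  intro T m
  obtain ⟨A, hA⟩ := ha T m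
  obtain ⟨B, hB⟩ := hb T m
  refine ⟨A + B, fun t ht k => ?_⟩
  have := pow_nonneg (wt_pos k).le m
  calc _ ≤ wt k ^ m * (‖a k t‖ + ‖b k t‖) := by gcongr; exact norm_add_le _ _
    _ ≤ _ := by rw [mul_add]; exact add_le_add (hA t ht k) (hB t ht k)

lemma D1.add {a b a' b' : K3 → ℝ → ℂ} (ha : D1 a a') (hb : D1 b b') :
    D1 (fun k t => a k t + b k t) fun k t => a' k t + b' k t := by
  intro T m
  obtain ⟨A, hA⟩ := ha T m
  obtain ⟨B, hB⟩ := hb T m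
  refine ⟨A + B, fun s hs t ht k => ?_⟩
  have := pow_nonneg (wt_pos k).le m
  calc _ = wt k ^ m * ‖(a k t - a k s - (t - s : ℝ) * a' k s) +
        (b k t - b k s - (t - s : ℝ) * b' k s)‖ := by congr 2; ring
    _ ≤ wt k ^ m * (‖a k t - a k s - (t - s : ℝ) * a' k s‖ +
        ‖b k t - b k s - (t - s : ℝ) * b' k s‖) := by gcongr; exact norm_add_le _ _
    _ ≤ _ := by rw [mul_add, add_mul]; exact add_le_add (hA s hs t ht k) (hB s hs t ht k)

lemma SM.add {n : ℕ} {a b : K3 → ℝ → ℂ} (ha : SM n a) (hb : SM n b) :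
    SM n fun k t => a k t + b k t := by
  induction n generalizing a b with
  | zero => exact Dec.add ha hb
  | succ n ih =>
    obtain ⟨h1, a', h2, h3⟩ := ha
    obtain ⟨g1, b', g2, g3⟩ := hb
    exact ⟨h1.add g1, _, h2.add g2, ih h3 g3⟩

/-- Multipliers of polynomial growth. -/
def PolyB (p : K3 → ℂ) : Prop := ∃ (q : ℕ) (C : ℝ), ∀ k, ‖p k‖ ≤ C * wt k ^ q

lemma PolyB.bound {p : K3 → ℂ} {q : ℕ} {C A : ℝ} (hp : ∀ k, ‖p k‖ ≤ C * wt k ^ q) {m : ℕ}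
    {k : K3} {z : ℂ} (h : wt k ^ (m + q) * ‖z‖ ≤ A) : wt k ^ m * ‖p k * z‖ ≤ |C| * A := by
  have h1 := wt_pos k
  have h2 : ‖p k‖ ≤ |C| * wt k ^ q := (hp k).trans (by gcongr; exact le_abs_self C)
  calc wt k ^ m * ‖p k * z‖ ≤ wt k ^ m * (|C| * wt k ^ q * ‖z‖) := by rw [norm_mul]; gcongr
    _ = |C| * (wt k ^ (m + q) * ‖z‖) := by ring
    _ ≤ _ := by gcongr

lemma SM.mul {n : ℕ} {a : K3 → ℝ → ℂ} (ha : SM n a) {p : K3 → ℂ} (hp : PolyB p) :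
    SM n fun k t => p k * a k t := by
  obtain ⟨q, C, hp⟩ := hp
  have hd : ∀ {a : K3 → ℝ → ℂ}, Dec a → Dec fun k t => p k * a k t := by
    intro a h T m
    obtain ⟨A, hA⟩ := h T (m + q)
    exact ⟨|C| * A, fun t ht k => PolyB.bound hp (hA t ht k)⟩
  induction n generalizing a with
  | zero => exact hd ha
  | succ n ih =>
    obtain ⟨h1, a', h2, h3⟩ := ha
    refine ⟨hd h1, _, ?_, ih h3⟩
    intro T m
    obtain ⟨A, hA⟩ := h2 T (m + q)
    refine ⟨|C| * A, fun s hs t ht k => ?_⟩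
    rw [show p k * a k t - p k * a k s - (t - s : ℝ) * (p k * a' k s) =
      p k * (a k t - a k s - (t - s : ℝ) * a' k s) by ring, mul_assoc]
    exact PolyB.bound hp (hA s hs t ht k)

lemma PolyB.const (z : ℂ) : PolyB fun _ => z := ⟨0, ‖z‖, fun k => by simp⟩

lemma PolyB.mul {p q : K3 → ℂ} (hp : PolyB p) (hq : PolyB q) : PolyB fun k => p k * q k := by
  obtain ⟨m, A, hA⟩ := hp
  obtain ⟨n, B, hB⟩ := hq
  refine ⟨m + n, A * B, fun k => ?_⟩
  have := wt_pos k
  rw [norm_mul]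
  calc ‖p k‖ * ‖q k‖ ≤ (A * wt k ^ m) * (B * wt k ^ n) :=
        mul_le_mul (hA k) (hB k) (norm_nonneg _) ((norm_nonneg _).trans (hA k))
    _ = _ := by ring

lemma PolyB.coord (j : Fin 3) : PolyB fun k => (k j : ℂ) :=
  ⟨1, 1, fun k => by rw [Complex.norm_intCast, one_mul, pow_one]; exact abs_le_wt k j⟩

lemma PolyB.lam : PolyB fun k => (lam k : ℂ) :=
  ⟨1, 1, fun k => by
    rw [Complex.norm_real, Real.norm_of_nonneg (lam_nonneg k), one_mul, pow_one, wt]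
    linarith⟩

lemma PolyB.inv_lam : PolyB fun k => (NSF.lam k : ℂ)⁻¹ :=
  ⟨0, 1, fun k => by
    rw [norm_inv, Complex.norm_real, Real.norm_of_nonneg (lam_nonneg k), one_mul, pow_zero]
    by_cases hk : k = 0
    · rw [hk, lam_zero]; simp
    · exact inv_le_one_of_one_le₀ (one_le_lam hk)⟩

lemma SM.sum {n : ℕ} {ι : Type*} (s : Finset ι) {a : ι → K3 → ℝ → ℂ} (h : ∀ j ∈ s, SM n (a j)) :
    SM n fun k t => ∑ j ∈ s, a j k t := by
  classical
  induction s using Finset.induction_on with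
  | empty =>
    simp only [Finset.sum_empty]
    clear h
    induction n with
    | zero => exact fun T m => ⟨0, fun t _ k => by simp⟩
    | succ n ih =>
      exact ⟨ih.dec, fun _ _ => 0, fun T m => ⟨0, fun s _ t _ k => by simp⟩, ih⟩
  | insert j s hj ih =>
    simp only [Finset.sum_insert hj]
    exact (h j (Finset.mem_insert_self _ _)).add
      (ih fun i hi => h i (Finset.mem_insert_of_mem hi))

lemma D1.lip {a a' : K3 → ℝ → ℂ} (h : D1 a a') (h' : Dec a') (T : ℝ) (m : ℕ) :
    ∃ C : ℝ, 0 ≤ C ∧ ∀ s ∈ Icc 0 T, ∀ t ∈ Icc 0 T, ∀ k,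
      wt k ^ m * ‖a k t - a k s‖ ≤ C * |t - s| := by
  obtain ⟨A, hA⟩ := h T m
  obtain ⟨B, hB⟩ := h' T m
  refine ⟨|A| * |T| + |B|, by positivity, fun s hs t ht k => ?_⟩
  have hw := pow_nonneg (wt_pos k).le m
  have hT : |t - s| ≤ |T| := by
    rw [abs_of_nonneg (hs.1.trans hs.2), abs_le]
    constructor <;> linarith [hs.1, hs.2, ht.1, ht.2]
  calc wt k ^ m * ‖a k t - a k s‖
      = wt k ^ m * ‖(a k t - a k s - (t - s : ℝ) * a' k s) + (t - s : ℝ) * a' k s‖ := by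
        congr 2; ring
    _ ≤ wt k ^ m * (‖a k t - a k s - (t - s : ℝ) * a' k s‖ + |t - s| * ‖a' k s‖) := by
        gcongr
        refine (norm_add_le _ _).trans (le_of_eq ?_)
        rw [norm_mul, Complex.norm_real, Real.norm_eq_abs]
    _ = wt k ^ m * ‖a k t - a k s - (t - s : ℝ) * a' k s‖ +
          |t - s| * (wt k ^ m * ‖a' k s‖) := by ring
    _ ≤ |A| * |t - s| ^ 2 + |t - s| * |B| := by
        exact add_le_add ((hA s hs t ht k).trans (by gcongr; exact le_abs_self A))
          (mul_le_mul_of_nonneg_left ((hB s hs k).trans (le_abs_self B)) (abs_nonneg _))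
    _ ≤ |A| * (|T| * |t - s|) + |t - s| * |B| := by
        gcongr
        rw [sq]
        gcongr
    _ = _ := by ring

lemma Dec.conv {a b : K3 → ℝ → ℂ} (ha : Dec a) (hb : Dec b) :
    Dec fun k t => conv (fun l => a l t) (fun l => b l t) k := by
  intro T m
  obtain ⟨A, hA⟩ := ha T m
  obtain ⟨B, hB⟩ := hb T (m + 2)
  exact ⟨_, fun t ht k => conv_bound (hA t ht) (hB t ht) k⟩

lemma D1.conv {a b a' b' : K3 → ℝ → ℂ} (ha : D1 a a') (hb : D1 b b') (da : Dec a) (da' : Dec a')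
    (db : Dec b) (db' : Dec b') :
    D1 (fun k t => NSF.conv (fun l => a l t) (fun l => b l t) k) fun k t =>
      NSF.conv (fun l => a' l t) (fun l => b l t) k +
        NSF.conv (fun l => a l t) (fun l => b' l t) k := by
  intro T m
  obtain ⟨A, hA⟩ := da T m
  obtain ⟨A', hA'⟩ := da' T m
  obtain ⟨A1, hA1⟩ := ha T m
  obtain ⟨B, hB⟩ := db T (m + 2)
  obtain ⟨B', hB'⟩ := db' T (m + 2)
  obtain ⟨B1, hB1⟩ := hb T (m + 2)
  obtain ⟨LB, hLB0, hLB⟩ := hb.lip db' T (m + 2)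
  refine ⟨2 ^ m * A1 * B * Lam1 + 2 ^ m * A' * LB * Lam1 + 2 ^ m * A * B1 * Lam1,
    fun s hs t ht k => ?_⟩
  have hw := pow_nonneg (wt_pos k).le m
  set x1 : K3 → ℂ := fun l => a l t - a l s - (t - s : ℝ) * a' l s
  set y1 : K3 → ℂ := fun l => b l t - b l s
  set y2 : K3 → ℂ := fun l => b l t - b l s - (t - s : ℝ) * b' l s
  have e : NSF.conv (fun l => a l t) (fun l => b l t) k -
      NSF.conv (fun l => a l s) (fun l => b l s) k - (t - s : ℝ) *
      (NSF.conv (fun l => a' l s) (fun l => b l s) k +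
        NSF.conv (fun l => a l s) (fun l => b' l s) k) =
      NSF.conv x1 (fun l => b l t) k + (t - s : ℝ) * NSF.conv (fun l => a' l s) y1 k +
        NSF.conv (fun l => a l s) y2 k := by
    simp only [NSF.conv]
    have s1 := conv_summable (hA t ht) (hB t ht) k
    have s2 := conv_summable (hA s hs) (hB s hs) k
    have s3 := conv_summable (hA' s hs) (hB s hs) k
    have s4 := conv_summable (hA s hs) (hB' s hs) k
    have s5 := conv_summable (hA1 s hs t ht) (hB t ht) k
    have s6 := conv_summable (hA' s hs) (hLB s hs t ht) k
    have s7 := conv_summable (hA s hs) (hB1 s hs t ht) k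
    rw [← s3.tsum_add s4, ← tsum_mul_left, ← s1.tsum_sub s2,
      ← (s1.sub s2).tsum_sub ((s3.add s4).mul_left _), ← tsum_mul_left (a := ((t - s : ℝ) : ℂ)),
      ← s5.tsum_add (s6.mul_left _), ← (s5.add (s6.mul_left _)).tsum_add s7]
    refine tsum_congr fun l => ?_
    ring
  rw [e]
  have c1 := conv_bound (hA1 s hs t ht) (hB t ht) k
  have c2 := conv_bound (hA' s hs) (hLB s hs t ht) k
  have c3 := conv_bound (hA s hs) (hB1 s hs t ht) k
  calc _ ≤ wt k ^ m * (‖NSF.conv x1 (fun l => b l t) k‖ +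
        |t - s| * ‖NSF.conv (fun l => a' l s) y1 k‖ + ‖NSF.conv (fun l => a l s) y2 k‖) := by
        gcongr
        refine (norm_add₃_le ..).trans (le_of_eq ?_)
        rw [norm_mul, Complex.norm_real, Real.norm_eq_abs]
    _ = wt k ^ m * ‖NSF.conv x1 (fun l => b l t) k‖ +
        |t - s| * (wt k ^ m * ‖NSF.conv (fun l => a' l s) y1 k‖) +
          wt k ^ m * ‖NSF.conv (fun l => a l s) y2 k‖ := by ring
    _ ≤ 2 ^ m * (A1 * |t - s| ^ 2) * B * Lam1 + |t - s| * (2 ^ m * A' * (LB * |t - s|) * Lam1) +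
        2 ^ m * A * (B1 * |t - s| ^ 2) * Lam1 := by gcongr
    _ = _ := by ring

lemma SM.conv {n : ℕ} {a b : K3 → ℝ → ℂ} (ha : SM n a) (hb : SM n b) :
    SM n fun k t => conv (fun l => a l t) (fun l => b l t) k := by
  induction n generalizing a b with
  | zero => exact Dec.conv ha hb
  | succ n ih =>
    obtain ⟨h1, a', h2, h3⟩ := id ha
    obtain ⟨g1, b', g2, g3⟩ := id hb
    exact ⟨h1.conv g1, _, h2.conv g2 h1 h3.dec g1 g3.dec, (ih h3 hb.pred).add (ih ha.pred g3)⟩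

lemma D1.hasDerivWithinAt {a a' : K3 → ℝ → ℂ} (h : D1 a a') (k : K3) {s : ℝ} (hs : 0 ≤ s) :
    HasDerivWithinAt (a k) (a' k s) (Ici 0) s := by
  obtain ⟨C, hC⟩ := h (s + 1) 0
  rw [hasDerivWithinAt_iff_isLittleO]
  have h1 : (fun t => a k t - a k s - (t - s) • a' k s) =O[nhdsWithin s (Ici 0)]
      fun t => |t - s| ^ 2 := by
    refine Asymptotics.IsBigO.of_bound C ?_
    have : Iio (s + 1) ∈ nhdsWithin s (Ici 0) :=
      mem_nhdsWithin_of_mem_nhds (Iio_mem_nhds (by linarith))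
    filter_upwards [self_mem_nhdsWithin, this] with t h0 h1
    have := hC s ⟨hs, by linarith⟩ t ⟨h0, h1.le⟩ k
    simp only [pow_zero, one_mul] at this
    rw [Real.norm_of_nonneg (sq_nonneg _)]
    simpa using this
  refine h1.trans_isLittleO (Asymptotics.IsLittleO.mono ?_ nhdsWithin_le_nhds)
  simp only [sq_abs]
  simpa using (Asymptotics.isLittleO_pow_sub_sub s (m := 2) (by norm_num))

end NSF

namespace NSF

/-- The full flux in Fourier variables. -/
def fluxF (W : Fin 3 → K3 → ℂ) (c : K3 → Fin 3 → ℂ) (k : K3) (i j : Fin 3) : ℂ :=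
  conv (W i) (fun l => c l j) k + conv (W j) (fun l => c l i) k +
    conv (fun l => c l i) (fun l => c l j) k

/-- Right-hand side of the perturbation equation in Fourier variables. -/
def rhsF (ν : ℝ) (W : Fin 3 → K3 → ℂ) (c : K3 → Fin 3 → ℂ) (k : K3) (i : Fin 3) : ℂ :=
  -(ν * lam k : ℝ) * c k i - lerayP k (zdiv k (fluxF W c k)) i

lemma rhs_eq_rhsF (ν : ℝ) (W : Fin 3 → K3 → ℂ) {s : Finset K3} {c : K3 → Fin 3 → ℂ}
    (hc : ∀ k ∉ s, ∀ i, c k i = 0) (k : K3) (i : Fin 3) :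
    rhs ν W s 1 c k i = rhsF ν W c k i := by
  have h : ∀ (a : K3 → ℂ) (i : Fin 3), conv a (fun l => c l i) k = ∑ l ∈ s, a (k - l) * c l i :=
    fun a i => tsum_eq_sum fun l hl => by
      beta_reduce; rw [hc l hl, mul_zero]
  simp only [rhs, rhsF, fluxL, fluxQ, Complex.ofReal_one, one_mul]
  congr 3
  funext i j
  simp only [fluxF, h]

lemma lerayP_zdiv_sub (k : K3) (S S' : Fin 3 → Fin 3 → ℂ) (i : Fin 3) :
    lerayP k (zdiv k fun i j => S i j - S' i j) i =
      lerayP k (zdiv k S) i - lerayP k (zdiv k S') i := by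
  simp only [lerayP, zdiv, Fin.sum_univ_three]
  ring

lemma norm_lerayP_zdiv_le {k : K3} {S : Fin 3 → Fin 3 → ℂ} {β : ℝ} (hS : ∀ i j, ‖S i j‖ ≤ β)
    (i : Fin 3) : ‖lerayP k (zdiv k S) i‖ ≤ 12 * wt k ^ 3 * β := by
  have hw := one_le_wt k
  have hβ : 0 ≤ β := (norm_nonneg _).trans (hS 0 0)
  have hk : ∀ j : Fin 3, ‖(k j : ℂ)‖ ≤ wt k := fun j => by
    rw [Complex.norm_intCast]; exact abs_le_wt k j
  have h1 : ∀ i, ‖zdiv k S i‖ ≤ 3 * wt k * β := by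
    intro i
    rw [zdiv, norm_mul, Complex.norm_I, one_mul]
    calc _ ≤ ∑ j, ‖(k j : ℂ) * S i j‖ := norm_sum_le _ _
      _ ≤ ∑ _j : Fin 3, wt k * β := by
          refine Finset.sum_le_sum fun j _ => ?_
          rw [norm_mul]
          exact mul_le_mul (hk j) (hS i j) (norm_nonneg _) (by linarith)
      _ = _ := by simp; ring
  have h2 : ‖∑ j, (k j : ℂ) * zdiv k S j‖ ≤ 3 * (wt k * (3 * wt k * β)) := by
    calc _ ≤ ∑ j, ‖(k j : ℂ) * zdiv k S j‖ := norm_sum_le _ _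
      _ ≤ ∑ _j : Fin 3, wt k * (3 * wt k * β) := by
          refine Finset.sum_le_sum fun j _ => ?_
          rw [norm_mul]
          exact mul_le_mul (hk j) (h1 j) (norm_nonneg _) (by linarith)
      _ = _ := by simp
  have h3 : ‖(lam k : ℂ)⁻¹‖ ≤ 1 := by
    rw [norm_inv, Complex.norm_real, Real.norm_of_nonneg (lam_nonneg k)]
    by_cases hk : k = 0
    · rw [hk, lam_zero]; simp
    · exact inv_le_one_of_one_le₀ (one_le_lam hk)
  calc ‖lerayP k (zdiv k S) i‖ ≤ ‖zdiv k S i‖ +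
        ‖(k i : ℂ)‖ * (‖∑ j, (k j : ℂ) * zdiv k S j‖ * ‖(lam k : ℂ)⁻¹‖) := by
        refine (norm_sub_le _ _).trans (le_of_eq ?_)
        rw [div_eq_mul_inv, norm_mul, norm_mul]
    _ ≤ 3 * wt k * β + wt k * (3 * (wt k * (3 * wt k * β)) * 1) := by
        gcongr
        · exact h1 i
        · exact hk i
    _ ≤ _ := by
        have : wt k ≤ wt k ^ 3 := le_self_pow₀ hw (by norm_num)
        nlinarith

/-- Uniform decay bounds on `[0, T]`. -/
def BdT (T : ℝ) (A : ℕ → ℝ) (f : K3 → ℝ → ℂ) : Prop :=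
  ∀ m, ∀ t ∈ Icc 0 T, ∀ k, wt k ^ m * ‖f k t‖ ≤ A m

/-- Uniform Lipschitz bounds on `[0, T]`. -/
def LpT (T : ℝ) (L : ℕ → ℝ) (f : K3 → ℝ → ℂ) : Prop :=
  ∀ m, ∀ s ∈ Icc 0 T, ∀ t ∈ Icc 0 T, ∀ k, wt k ^ m * ‖f k t - f k s‖ ≤ L m * |t - s|

variable {T : ℝ} {A B L L' : ℕ → ℝ} {f g : K3 → ℝ → ℂ}

lemma BdT.add (hf : BdT T A f) (hg : BdT T B g) :
    BdT T (fun m => A m + B m) fun k t => f k t + g k t := by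
  intro m t ht k
  have := pow_nonneg (wt_pos k).le m
  calc _ ≤ wt k ^ m * (‖f k t‖ + ‖g k t‖) := by gcongr; exact norm_add_le _ _
    _ ≤ _ := by rw [mul_add]; exact add_le_add (hf m t ht k) (hg m t ht k)

lemma LpT.add (hf : LpT T L f) (hg : LpT T L' g) :
    LpT T (fun m => L m + L' m) fun k t => f k t + g k t := by
  intro m s hs t ht k
  have := pow_nonneg (wt_pos k).le m
  calc _ = wt k ^ m * ‖(f k t - f k s) + (g k t - g k s)‖ := by congr 2; ring
    _ ≤ wt k ^ m * (‖f k t - f k s‖ + ‖g k t - g k s‖) := by gcongr; exact norm_add_le _ _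
    _ ≤ _ := by rw [mul_add, add_mul]; exact add_le_add (hf m s hs t ht k) (hg m s hs t ht k)

lemma BdT.conv (hf : BdT T A f) (hg : BdT T B g) :
    BdT T (fun m => 2 ^ m * A m * B (m + 2) * Lam1)
      fun k t => conv (fun l => f l t) (fun l => g l t) k :=
  fun m t ht k => conv_bound (hf m t ht) (hg (m + 2) t ht) k

lemma LpT.conv (hf : BdT T A f) (hf' : LpT T L f) (hg : BdT T B g) (hg' : LpT T L' g) :
    LpT T (fun m => 2 ^ m * L m * B (m + 2) * Lam1 + 2 ^ m * A m * L' (m + 2) * Lam1)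
      fun k t => conv (fun l => f l t) (fun l => g l t) k := by
  intro m s hs t ht k
  have := pow_nonneg (wt_pos k).le m
  have e : NSF.conv (fun l => f l t) (fun l => g l t) k -
      NSF.conv (fun l => f l s) (fun l => g l s) k =
      NSF.conv (fun l => f l t - f l s) (fun l => g l t) k +
        NSF.conv (fun l => f l s) (fun l => g l t - g l s) k := by
    simp only [NSF.conv]
    have s1 := conv_summable (hf m t ht) (hg _ t ht) k
    have s2 := conv_summable (hf m s hs) (hg _ s hs) k
    have s3 := conv_summable (hf' m s hs t ht) (hg _ t ht) k
    have s4 := conv_summable (hf m s hs) (hg' _ s hs t ht) k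
    rw [← s1.tsum_sub s2, ← s3.tsum_add s4]
    exact tsum_congr fun l => by ring
  have c1 := conv_bound (hf' m s hs t ht) (hg _ t ht) k
  have c2 := conv_bound (hf m s hs) (hg' _ s hs t ht) k
  beta_reduce
  rw [e]
  calc _ ≤ wt k ^ m * (‖NSF.conv (fun l => f l t - f l s) (fun l => g l t) k‖ +
        ‖NSF.conv (fun l => f l s) (fun l => g l t - g l s) k‖) := by
        gcongr; exact norm_add_le _ _
    _ ≤ _ := by
        rw [mul_add, add_mul]
        refine add_le_add (c1.trans (le_of_eq ?_)) (c2.trans (le_of_eq ?_)) <;> ring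

lemma BdT.leray {S : Fin 3 → Fin 3 → K3 → ℝ → ℂ} (h : ∀ i j, BdT T A (S i j)) (i : Fin 3) :
    BdT T (fun m => 12 * A (m + 3)) fun k t => lerayP k (zdiv k fun i j => S i j k t) i := by
  intro m t ht k
  have hw := wt_pos k
  have h1 : ∀ i j, ‖S i j k t‖ ≤ A (m + 3) / wt k ^ (m + 3) := fun i j => by
    rw [le_div_iff₀ (by positivity), mul_comm]; exact h i j _ t ht k
  have := mul_le_mul_of_nonneg_left (norm_lerayP_zdiv_le (k := k) h1 i) (pow_pos hw m).le
  refine this.trans (le_of_eq ?_)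
  field_simp
  ring

lemma LpT.leray {S : Fin 3 → Fin 3 → K3 → ℝ → ℂ} (h : ∀ i j, LpT T L (S i j)) (i : Fin 3) :
    LpT T (fun m => 12 * L (m + 3)) fun k t => lerayP k (zdiv k fun i j => S i j k t) i := by
  intro m s hs t ht k
  have hw := wt_pos k
  have h1 : ∀ i j, ‖S i j k t - S i j k s‖ ≤ L (m + 3) * |t - s| / wt k ^ (m + 3) := fun i j => by
    rw [le_div_iff₀ (by positivity), mul_comm]; exact h i j _ s hs t ht k
  have := mul_le_mul_of_nonneg_left (norm_lerayP_zdiv_le (k := k) h1 i) (pow_pos hw m).le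
  rw [lerayP_zdiv_sub] at this
  refine this.trans (le_of_eq ?_)
  field_simp
  ring

lemma BdT.lam_mul (hf : BdT T A f) (ν : ℝ) :
    BdT T (fun m => |ν| * A (m + 1)) fun k t => -(ν * lam k : ℝ) * f k t := by
  intro m t ht k
  refine PolyB.bound (q := 1) (p := fun k => -(ν * lam k : ℝ)) (C := |ν|) (fun k => ?_)
    (hf (m + 1) t ht k) |>.trans_eq (by rw [abs_abs])
  rw [norm_neg, Complex.norm_real, norm_mul, Real.norm_eq_abs, Real.norm_of_nonneg (lam_nonneg k),
    pow_one, wt]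
  have := lam_nonneg k
  gcongr
  linarith

lemma LpT.lam_mul (hf : LpT T L f) (ν : ℝ) :
    LpT T (fun m => |ν| * L (m + 1)) fun k t => -(ν * lam k : ℝ) * f k t := by
  intro m s hs t ht k
  rw [← mul_sub]
  refine PolyB.bound (q := 1) (p := fun k => -(ν * lam k : ℝ)) (C := |ν|) (fun k => ?_)
    (hf (m + 1) s hs t ht k) |>.trans_eq (by rw [abs_abs, mul_assoc])
  rw [norm_neg, Complex.norm_real, norm_mul, Real.norm_eq_abs, Real.norm_of_nonneg (lam_nonneg k),
    pow_one, wt]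
  have := lam_nonneg k
  gcongr
  linarith

lemma LpT.neg (hf : LpT T L f) : LpT T L fun k t => -f k t := by
  intro m s hs t ht k
  rw [← neg_sub', norm_neg]
  exact hf m s hs t ht k

lemma BdT.neg (hf : BdT T A f) : BdT T A fun k t => -f k t := by
  intro m t ht k
  rw [norm_neg]
  exact hf m t ht k

lemma taylor_of_lip {f F : ℝ → ℂ} {T L : ℝ}
    (hf : ∀ t ∈ Icc 0 T, HasDerivWithinAt f (F t) (Icc 0 T) t)
    (hF : ∀ s ∈ Icc 0 T, ∀ t ∈ Icc 0 T, ‖F t - F s‖ ≤ L * |t - s|) {s t : ℝ} (hs : s ∈ Icc 0 T)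
    (ht : t ∈ Icc 0 T) : ‖f t - f s - (t - s : ℝ) * F s‖ ≤ |L| * |t - s| ^ 2 := by
  have hsub : uIcc s t ⊆ Icc 0 T := uIcc_subset_Icc hs ht
  have h1 : ∀ τ ∈ uIcc s t, HasDerivWithinAt (fun τ => f τ - (τ : ℂ) * F s) (F τ - F s)
      (uIcc s t) τ := by
    intro τ hτ
    have h2 : HasDerivWithinAt (fun τ : ℝ => (τ : ℂ) * F s) (F s) (uIcc s t) τ := by
      have := ((hasDerivAt_id τ).ofReal_comp.mul_const (F s)).hasDerivWithinAt (s := uIcc s t)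
      simpa using this
    exact ((hf τ (hsub hτ)).mono hsub).sub h2
  have h2 : ∀ τ ∈ uIcc s t, ‖F τ - F s‖ ≤ |L| * |t - s| := by
    intro τ hτ
    refine (hF s hs τ (hsub hτ)).trans ?_
    have : |τ - s| ≤ |t - s| := abs_sub_left_of_mem_uIcc hτ
    calc L * |τ - s| ≤ |L| * |τ - s| := by gcongr; exact le_abs_self L
      _ ≤ _ := by gcongr
  have h3 := (convex_uIcc s t).norm_image_sub_le_of_norm_hasDerivWithin_le h1 h2
    (left_mem_uIcc) (right_mem_uIcc)
  rw [Real.norm_eq_abs] at h3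
  calc _ = ‖f t - (t : ℂ) * F s - (f s - (s : ℂ) * F s)‖ := by
        congr 1; push_cast; ring
    _ ≤ _ := h3
    _ = _ := by ring

/-- Uniform quadratic expansions for solutions with uniform decay. -/
lemma gal_taylor (ν : ℝ) {T : ℝ} {W : Fin 3 → K3 → ℝ → ℂ} {AW LW : ℕ → ℝ}
    (hA : ∀ i, BdT T AW (W i)) (hL : ∀ i, LpT T LW (W i)) (A : ℕ → ℝ) :
    ∃ L : ℕ → ℝ, ∀ (s : Finset K3) (c : K3 → Fin 3 → ℝ → ℂ), Gal ν W s T (fun _ => 1) c →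
      (∀ i, BdT T A fun k t => c k i t) → ∀ m, ∀ k ∈ s, ∀ i, ∀ σ ∈ Icc 0 T, ∀ t ∈ Icc 0 T,
        wt k ^ m * ‖c k i t - c k i σ - (t - σ : ℝ) *
          rhsF ν (fun i k => W i k σ) (fun k i => c k i σ) k i‖ ≤ L m * |t - σ| ^ 2 := by
  set BF : ℕ → ℝ := fun m => |ν| * A (m + 1) + 12 * (2 ^ (m + 3) * AW (m + 3) * A (m + 3 + 2) * Lam1
    + 2 ^ (m + 3) * AW (m + 3) * A (m + 3 + 2) * Lam1
    + 2 ^ (m + 3) * A (m + 3) * A (m + 3 + 2) * Lam1) with hBF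
  set X : ℕ → ℝ := fun m => 2 ^ m * LW m * A (m + 2) * Lam1 + 2 ^ m * AW m * BF (m + 2) * Lam1
  set Y : ℕ → ℝ := fun m => 2 ^ m * BF m * A (m + 2) * Lam1 + 2 ^ m * A m * BF (m + 2) * Lam1
  refine ⟨fun m => |(|ν| * BF (m + 1) + 12 * (X (m + 3) + X (m + 3) + Y (m + 3)))|,
    fun s c hG hc => ?_⟩
  have hrhs : ∀ k t i, rhs ν (fun i k => W i k t) s 1 (fun k i => c k i t) k i =
      rhsF ν (fun i k => W i k t) (fun k i => c k i t) k i := fun k t i =>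
    rhs_eq_rhsF ν _ (fun k hk i => hG.supp k hk i t) k i
  have hode : ∀ k ∈ s, ∀ i, ∀ t ∈ Icc 0 T, HasDerivWithinAt (c k i)
      (rhsF ν (fun i k => W i k t) (fun k i => c k i t) k i) (Icc 0 T) t := fun k hk i t ht => by
    rw [← hrhs]; exact hG.ode k hk i t ht
  have hF : ∀ i, BdT T BF fun k t => rhsF ν (fun i k => W i k t) (fun k i => c k i t) k i := by
    intro i
    have h1 : ∀ i j, BdT T _ fun k t => fluxF (fun i k => W i k t) (fun k i => c k i t) k i j :=
      fun i j => (((hA i).conv (hc j)).add ((hA j).conv (hc i))).add ((hc i).conv (hc j))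
    have h2 := ((hc i).lam_mul ν).add (BdT.leray h1 i).neg
    simp only [← sub_eq_add_neg] at h2
    exact h2
  have hcL : ∀ i, LpT T BF fun k t => c k i t := by
    intro i m σ hσ t ht k
    by_cases hk : k ∈ s
    · have hw := pow_pos (wt_pos k) m
      have := (convex_Icc 0 T).norm_image_sub_le_of_norm_hasDerivWithin_le (hode k hk i)
        (C := BF m / wt k ^ m)
        (fun t ht => by rw [le_div_iff₀ hw, mul_comm]; exact hF i m t ht k) hσ ht
      rw [Real.norm_eq_abs] at this
      calc _ ≤ wt k ^ m * (BF m / wt k ^ m * |t - σ|) := by gcongr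
        _ = _ := by field_simp
    · beta_reduce
      rw [hG.supp k hk, hG.supp k hk]
      simp only [sub_zero, norm_zero, mul_zero]
      have : 0 ≤ BF m := le_trans (by have := wt_pos k; positivity) (hF i m t ht k)
      positivity
  have hFL : ∀ i, LpT T (fun m => |ν| * BF (m + 1) + 12 * (X (m + 3) + X (m + 3) + Y (m + 3)))
      fun k t => rhsF ν (fun i k => W i k t) (fun k i => c k i t) k i := by
    intro i
    have h1 : ∀ i j, LpT T (fun m => X m + X m + Y m)
        fun k t => fluxF (fun i k => W i k t) (fun k i => c k i t) k i j :=
      fun i j => ((LpT.conv (hA i) (hL i) (hc j) (hcL j)).add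
        (LpT.conv (hA j) (hL j) (hc i) (hcL i))).add (LpT.conv (hc i) (hcL i) (hc j) (hcL j))
    have h2 := ((hcL i).lam_mul ν).add (LpT.leray h1 i).neg
    simp only [← sub_eq_add_neg] at h2
    exact h2
  intro m k hk i σ hσ t ht
  have hw := pow_pos (wt_pos k) m
  have := taylor_of_lip (hode k hk i) (L := (|ν| * BF (m + 1) +
    12 * (X (m + 3) + X (m + 3) + Y (m + 3))) / wt k ^ m) (fun s hs t ht => by
      rw [div_mul_eq_mul_div, le_div_iff₀ hw, mul_comm]; exact hFL i m s hs t ht k) hσ ht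
  rw [abs_div, abs_of_pos hw] at this
  calc _ ≤ _ := mul_le_mul_of_nonneg_left this hw.le
    _ = _ := by field_simp

end NSF

namespace NSF

/-- Fourier data of the background flow. -/
structure WData (N C1 : ℝ) (r : ℕ) (W : Fin 3 → K3 → ℝ → ℂ) (M : ℕ → ℝ → ℝ) : Prop where
  contM : ∀ p, Continuous (M p)
  convBd : ∀ p t, 0 ≤ t → ConvBd (fun i k => W i k t) p (M p t)
  cont : ∀ i k, Continuous (W i k)
  symm : ∀ i k t, W i (-k) t = (starRingEnd ℂ) (W i k t)
  intB : ∀ T, IntB M N C1 r T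
  sm : ∀ i n, SM n (W i)

/-- Nonzero frequencies in a cube. -/
def Kn (n : ℕ) : Finset K3 := (Finset.Icc (fun _ => -(n : ℤ)) (fun _ => (n : ℤ))).erase 0

lemma Kn_ne_zero {n : ℕ} : ∀ k ∈ Kn n, k ≠ 0 := fun _ hk => Finset.ne_of_mem_erase hk

lemma mem_Kn {n : ℕ} {k : K3} : k ∈ Kn n ↔ k ≠ 0 ∧ ∀ j, |k j| ≤ n := by
  simp only [Kn, Finset.mem_erase, Finset.mem_Icc, Pi.le_def, abs_le, ne_eq, forall_and]

lemma Kn_neg {n : ℕ} : ∀ k ∈ Kn n, -k ∈ Kn n := by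
  intro k hk
  rw [mem_Kn] at hk ⊢
  refine ⟨neg_ne_zero.2 hk.1, fun j => ?_⟩
  rw [Pi.neg_apply, abs_neg]
  exact hk.2 j

lemma eventually_mem_Kn {k : K3} (hk : k ≠ 0) : ∀ᶠ n in Filter.atTop, k ∈ Kn n := by
  obtain ⟨m, hm⟩ : ∃ m : ℕ, ∀ j, |k j| ≤ m :=
    ⟨∑ j, (k j).natAbs, fun j => by
      rw [Int.abs_eq_natAbs]
      exact_mod_cast Finset.single_le_sum (f := fun j => (k j).natAbs) (fun _ _ => Nat.zero_le _)
        (Finset.mem_univ j)⟩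
  filter_upwards [Filter.eventually_ge_atTop m] with n hn
  exact mem_Kn.2 ⟨hk, fun j => (hm j).trans (by exact_mod_cast hn)⟩

lemma wt_le_two_lam {k : K3} (hk : k ≠ 0) : wt k ≤ 2 * lam k := by
  have := one_le_lam hk
  unfold wt
  linarith

lemma bd_of_En {s : Finset K3} (hs : ∀ k ∈ s, k ≠ 0) {c : K3 → Fin 3 → ℂ} {m : ℕ} {K : ℝ}
    (hK : En s (2 * m) c ≤ K) {k : K3} (hk : k ∈ s) (i : Fin 3) :
    wt k ^ m * ‖c k i‖ ≤ 2 ^ m * √K := by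
  have h1 : (lam k ^ m * ‖c k i‖) ^ 2 ≤ K := by
    refine le_trans ?_ hK
    calc _ = lam k ^ (2 * m) * ‖c k i‖ ^ 2 := by ring
      _ ≤ lam k ^ (2 * m) * ∑ i, ‖c k i‖ ^ 2 := by
          refine mul_le_mul_of_nonneg_left ?_ (pow_nonneg (lam_nonneg k) _)
          exact Finset.single_le_sum (f := fun i => ‖c k i‖ ^ 2) (fun _ _ => sq_nonneg _)
            (Finset.mem_univ i)
      _ ≤ _ := Finset.single_le_sum (f := fun k => lam k ^ (2 * m) * ∑ i, ‖c k i‖ ^ 2)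
            (fun k _ => mul_nonneg (pow_nonneg (lam_nonneg k) _)
              (Finset.sum_nonneg fun _ _ => sq_nonneg _)) hk
  calc wt k ^ m * ‖c k i‖ ≤ (2 * lam k) ^ m * ‖c k i‖ := by
        gcongr
        · exact (wt_pos k).le
        · exact wt_le_two_lam (hs k hk)
    _ = 2 ^ m * (lam k ^ m * ‖c k i‖) := by ring
    _ ≤ _ := by
        refine mul_le_mul_of_nonneg_left ?_ (by positivity)
        exact Real.le_sqrt_of_sq_le h1

lemma CQ_mono {m n : ℕ} (h : m ≤ n) : CQ m ≤ CQ n := by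
  have := Lam0_nonneg
  unfold CQ
  gcongr
  norm_num

/-- Global Galerkin approximations with uniform bounds. -/
lemma gal_seq {ν σ : ℝ} (hν : 0 < ν) (hσ : σ ∈ Ioo (0 : ℝ) 1) (C1 : ℝ) {r : ℕ} (hr : 1 ≤ r) :
    ∃ η D : ℝ, 0 < η ∧ 0 < D ∧ ∀ N, 1 ≤ N → ∀ W M, WData N C1 r W M →
      ∀ (c0 : K3 → Fin 3 → ℂ) (B : ℕ → ℝ), (∀ k i, c0 (-k) i = (starRingEnd ℂ) (c0 k i)) →
      (∀ m s, En s m c0 ≤ B m) → B 1 ≤ η → ∃ c : ℕ → K3 → Fin 3 → ℝ → ℂ,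
        (∀ n, Gal ν W (Kn n) n (fun _ => 1) (c n)) ∧
        (∀ n, ∀ k ∈ Kn n, ∀ i, c n k i 0 = c0 k i) ∧
        (∀ n : ℕ, ∀ k i, ∀ t ∈ Icc (0 : ℝ) n, c n (-k) i t = (starRingEnd ℂ) (c n k i t)) ∧
        (∀ n : ℕ, ∀ m ≤ r, ∀ t ∈ Icc (0 : ℝ) n,
          Et (Kn n) m (c n) t ≤ D * (N ^ (m - 1)) ^ 2 * exp (-(2 * (ν * σ) * t)) * B m) ∧
        ∀ T : ℝ, ∃ A : ℕ → ℝ, ∀ n : ℕ, T ≤ n → ∀ i, BdT T A fun k t => c n k i t := by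
  set ε : ℝ := ν * (1 - σ) / 2 with hε
  have hε0 : 0 < ε := by
    have : 0 < 1 - σ := by linarith [hσ.2]
    positivity
  set δ : ℝ := ε ^ 2 / (CQ (r + 2) + 1) with hδ
  have hCQ := CQ_nonneg (r + 2)
  have hδ0 : 0 < δ := by positivity
  have hsm : ∀ j ≤ r + 2, 2 * δ * CQ j ≤ 2 * ε ^ 2 := by
    intro j hj
    have h1 := CQ_mono hj
    have h2 : δ * (CQ (r + 2) + 1) = ε ^ 2 := by rw [hδ]; field_simp
    nlinarith
  choose D hD0 hD using fun m => apriori (C1 := C1) hν hσ m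
  refine ⟨δ / D 1, ∑ m ∈ Finset.range (r + 1), D m, div_pos hδ0 (hD0 1),
    Finset.sum_pos (fun m _ => hD0 m) (by simp), fun N hN W M hWD c0 B hc0 hB hB1 => ?_⟩
  have hB0 : ∀ m, 0 ≤ B m := fun m => by simpa [En] using hB m ∅
  choose c hG hinit hsymm using fun n : ℕ => gal_exists hν hσ hδ0 (hsm 0 (by omega)) hWD.cont
    (hWD.contM 0) (hWD.convBd 0) hWD.symm (s := Kn n) Kn_ne_zero Kn_neg (Nat.cast_nonneg n) hc0
  have hsmall : ∀ n : ℕ, ∀ j ≤ r + 2, ∀ t ∈ Icc (0 : ℝ) n,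
      cut δ (Et (Kn n) 1 (c n) t) ^ 2 * Et (Kn n) 1 (c n) t * CQ j ≤ 2 * ε ^ 2 :=
    fun n j hj t _ => (mul_le_mul_of_nonneg_right (cut_sq_mul_le hδ0) (CQ_nonneg j)).trans
      (hsm j hj)
  have hE0 : ∀ n m, Et (Kn n) m (c n) 0 ≤ B m := by
    intro n m
    refine le_of_eq_of_le ?_ (hB m (Kn n))
    exact Finset.sum_congr rfl fun k hk => by simp only [hinit n k hk]
  have hap : ∀ n : ℕ, ∀ m ≤ r, ∀ t ∈ Icc (0 : ℝ) n,
      Et (Kn n) m (c n) t ≤ D m * (N ^ (m - 1)) ^ 2 * exp (-(2 * (ν * σ) * t)) * B m := by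
    intro n m hm t ht
    refine (hD m N hN r hm W M _ _ _ _ (hG n) hWD.contM hWD.convBd (hWD.intB _)
      (fun j hj t ht => hsmall n j (by omega) t ht) t ht).trans ?_
    have := hD0 m
    exact mul_le_mul_of_nonneg_left (hE0 n m) (by positivity)
  have hcut : ∀ n : ℕ, ∀ t ∈ Icc (0 : ℝ) n, cut δ (Et (Kn n) 1 (c n) t) = 1 := by
    intro n t ht
    refine cut_eq_one hδ0 ((hap n 1 hr t ht).trans ?_)
    have h1 : exp (-(2 * (ν * σ) * t)) ≤ 1 := by
      rw [Real.exp_le_one_iff]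
      have := mul_pos hν hσ.1
      have := ht.1
      simp only [Left.neg_nonpos_iff]
      positivity
    have h2 : B 1 * D 1 ≤ δ := (le_div_iff₀ (hD0 1)).1 hB1
    have h3 := mul_nonneg (hB0 1) (hD0 1).le
    calc _ = exp (-(2 * (ν * σ) * t)) * (B 1 * D 1) := by simp; ring
      _ ≤ 1 * (B 1 * D 1) := by gcongr
      _ ≤ δ := by linarith
  refine ⟨c, fun n => ⟨(hG n).nz, (hG n).supp, fun k hk i t ht => ?_⟩, hinit, hsymm, ?_, ?_⟩
  · have := (hG n).ode k hk i t ht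
    rwa [hcut n t ht] at this
  · intro n m hm t ht
    refine (hap n m hm t ht).trans ?_
    have h1 : D m ≤ ∑ m ∈ Finset.range (r + 1), D m :=
      Finset.single_le_sum (fun m _ => (hD0 m).le) (Finset.mem_range.2 (by omega))
    have := hB0 m
    gcongr
  · intro T
    choose K hK0 hK using fun m => uniform_bound (T := T) (B2 := B 2) hν hσ hWD.contM hWD.convBd m
    refine ⟨fun m => 2 ^ m * √(K (2 * m) * B (2 * m)), fun n hn i m t ht k => ?_⟩
    by_cases hk : k ∈ Kn n
    · refine bd_of_En (s := Kn n) (c := fun k i => c n k i t) Kn_ne_zero ?_ hk i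
      refine (hK (2 * m) (Kn n) n _ _ hn (hG n) (fun t => cut_sq_le_one _ _)
        (fun j hj t ht => hsmall n j (by omega) t ⟨ht.1, ht.2.trans hn⟩) (hE0 n 2) t ht).trans ?_
      exact mul_le_mul_of_nonneg_left (hE0 n _) (hK0 _).le
    · beta_reduce
      rw [(hG n).supp k hk]
      simp

end NSF

namespace NSF

open Filter Topology

lemma tendsto_conv {F : Filter ℕ} {a b : ℕ → K3 → ℂ} {a' b' : K3 → ℂ} {A B : ℝ}
    (ha : ∀ᶠ n in F, ∀ k, ‖a n k‖ ≤ A) (hb : ∀ᶠ n in F, ∀ k, wt k ^ 2 * ‖b n k‖ ≤ B)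
    (ha' : ∀ k, Tendsto (fun n => a n k) F (𝓝 (a' k)))
    (hb' : ∀ k, Tendsto (fun n => b n k) F (𝓝 (b' k))) (k : K3) :
    Tendsto (fun n => conv (a n) (b n) k) F (𝓝 (conv a' b' k)) := by
  refine tendsto_tsum_of_dominated_convergence (bound := fun l => A * B * (wt l ^ 2)⁻¹)
    (summable_wt.mul_left _) (fun l => (ha' _).mul (hb' l)) ?_
  filter_upwards [ha, hb] with n h1 h2 l
  have hw := pow_pos (wt_pos l) 2
  rw [norm_mul, ← div_eq_mul_inv, le_div_iff₀ hw]
  have := (norm_nonneg _).trans (h1 (k - l))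
  calc _ = ‖a n (k - l)‖ * (wt l ^ 2 * ‖b n l‖) := by ring
    _ ≤ A * B := mul_le_mul (h1 _) (h2 l) (by positivity) this

lemma tendsto_lerayP_zdiv {F : Filter ℕ} {S : ℕ → Fin 3 → Fin 3 → ℂ} {S' : Fin 3 → Fin 3 → ℂ}
    (h : ∀ i j, Tendsto (fun n => S n i j) F (𝓝 (S' i j))) (k : K3) (i : Fin 3) :
    Tendsto (fun n => lerayP k (zdiv k (S n)) i) F (𝓝 (lerayP k (zdiv k S') i)) := by
  have hz : ∀ i, Tendsto (fun n => zdiv k (S n) i) F (𝓝 (zdiv k S' i)) := fun i =>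
    (tendsto_finsetSum _ fun j _ => (h i j).const_mul _).const_mul _
  exact (hz i).sub (((tendsto_finsetSum _ fun j _ => (hz j).const_mul _).div_const _).const_mul _)

lemma zdiv_zero (S : Fin 3 → Fin 3 → ℂ) (i : Fin 3) : zdiv 0 S i = 0 := by simp [zdiv]

lemma lerayP_zero (z : Fin 3 → ℂ) (i : Fin 3) : lerayP 0 z i = z i := by simp [lerayP]

lemma sum_coord_lerayP (k : K3) (z : Fin 3 → ℂ) : ∑ i, (k i : ℂ) * lerayP k z i = 0 := by
  by_cases hk : k = 0
  · simp [hk]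
  have h0 : (lam k : ℂ) ≠ 0 := by
    have := one_le_lam hk
    exact_mod_cast (by linarith : lam k ≠ 0)
  have h1 : (lam k : ℂ) = ∑ i, (k i : ℂ) * (k i : ℂ) := by
    simp only [lam]; push_cast; exact Finset.sum_congr rfl fun i _ => by ring
  simp only [lerayP, mul_sub, Finset.sum_sub_distrib]
  have : ∑ i, (k i : ℂ) * ((k i : ℂ) * ((∑ j, (k j : ℂ) * z j) / (lam k : ℂ))) =
      (∑ i, (k i : ℂ) * (k i : ℂ)) * ((∑ j, (k j : ℂ) * z j) / (lam k : ℂ)) := by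
    rw [Finset.sum_mul]
    exact Finset.sum_congr rfl fun i _ => by ring
  rw [this, ← h1, mul_div_cancel₀ _ h0, sub_self]

lemma SM.leray {n : ℕ} {S : Fin 3 → Fin 3 → K3 → ℝ → ℂ} (h : ∀ i j, SM n (S i j)) (i : Fin 3) :
    SM n fun k t => lerayP k (zdiv k fun i j => S i j k t) i := by
  have hz : ∀ i, SM n fun k t => zdiv k (fun i j => S i j k t) i := fun i =>
    (SM.sum Finset.univ fun j _ => (h i j).mul (PolyB.coord j)).mul (PolyB.const Complex.I)
  have h2 := ((SM.sum Finset.univ fun j _ => (hz j).mul (PolyB.coord j)).mul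
    (((PolyB.coord i).mul PolyB.inv_lam).mul (PolyB.const (-1)))).add (hz i)
  convert h2 using 3 with k t
  simp only [lerayP]
  ring

/-- Limit of the Galerkin approximations. -/
lemma perturb_limit {ν : ℝ} {N C1 : ℝ} {r : ℕ} {W : Fin 3 → K3 → ℝ → ℂ} {M : ℕ → ℝ → ℝ}
    (hWD : WData N C1 r W M) {c : ℕ → K3 → Fin 3 → ℝ → ℂ} {c0 : K3 → Fin 3 → ℂ}
    (hG : ∀ n : ℕ, Gal ν W (Kn n) n (fun _ => 1) (c n))
    (hinit : ∀ n, ∀ k ∈ Kn n, ∀ i, c n k i 0 = c0 k i) (hc00 : ∀ i, c0 0 i = 0)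
    (hbd : ∀ T : ℝ, ∃ A : ℕ → ℝ, ∀ n : ℕ, T ≤ n → ∀ i, BdT T A fun k t => c n k i t) :
    ∃ cl : K3 → Fin 3 → ℝ → ℂ,
      (∀ k i t, 0 ≤ t → Tendsto (fun n => c n k i t) (hyperfilter ℕ : Filter ℕ) (𝓝 (cl k i t))) ∧
      (∀ i t, 0 ≤ t → cl 0 i t = 0) ∧ (∀ k i, cl k i 0 = c0 k i) ∧
      (∀ i, Dec fun k t => cl k i t) ∧
      ∀ i, D1 (fun k t => cl k i t)
        fun k t => rhsF ν (fun i k => W i k t) (fun k i => cl k i t) k i := by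
  have hle : (hyperfilter ℕ : Filter ℕ) ≤ atTop := Nat.hyperfilter_le_atTop
  have hge : ∀ T : ℝ, ∀ᶠ n : ℕ in (hyperfilter ℕ : Filter ℕ), T ≤ (n : ℝ) := fun T =>
    hle (tendsto_natCast_atTop_atTop.eventually_ge_atTop T)
  have hex : ∀ k i t, ∃ z, 0 ≤ t →
      Tendsto (fun n => c n k i t) (hyperfilter ℕ : Filter ℕ) (𝓝 z) := by
    intro k i t
    by_cases ht : 0 ≤ t
    · obtain ⟨A, hA⟩ := hbd t
      have h1 : ∀ᶠ n in (hyperfilter ℕ : Filter ℕ), c n k i t ∈ Metric.closedBall (0 : ℂ) (A 0) := by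
        filter_upwards [hge t] with n hn
        rw [mem_closedBall_zero_iff]
        simpa using hA n hn i 0 t ⟨ht, le_rfl⟩ k
      obtain ⟨z, _, hz⟩ := (isCompact_closedBall (0 : ℂ) (A 0)).ultrafilter_le_nhds
        ((hyperfilter ℕ).map fun n => c n k i t) (le_principal_iff.2 h1)
      exact ⟨z, fun _ => hz⟩
    · exact ⟨0, fun h => absurd h ht⟩
  choose cl hcl using hex
  have hcl0 : ∀ i t, 0 ≤ t → cl 0 i t = 0 := by
    intro i t ht
    refine tendsto_nhds_unique (hcl 0 i t ht) (tendsto_const_nhds.congr fun n => ?_)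
    exact ((hG n).supp 0 (fun h => Kn_ne_zero 0 h rfl) i t).symm
  have hBdl : ∀ (T : ℝ) (A : ℕ → ℝ), (∀ n : ℕ, T ≤ n → ∀ i, BdT T A fun k t => c n k i t) →
      ∀ i, BdT T A fun k t => cl k i t := by
    intro T A hA i m t ht k
    refine le_of_tendsto (((hcl k i t ht.1).norm).const_mul _) ?_
    filter_upwards [hge T] with n hn
    exact hA n hn i m t ht k
  refine ⟨cl, hcl, hcl0, fun k i => ?_, fun i T m => ?_, fun i T m => ?_⟩
  · by_cases hk : k = 0
    · rw [hk, hcl0 i 0 le_rfl, hc00]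
    · refine tendsto_nhds_unique (hcl k i 0 le_rfl) (tendsto_const_nhds.congr' ?_)
      filter_upwards [hle (eventually_mem_Kn hk)] with n hn
      exact (hinit n k hn i).symm
  · obtain ⟨A, hA⟩ := hbd T
    exact ⟨A m, fun t ht k => hBdl T A hA i m t ht k⟩
  · obtain ⟨A, hA⟩ := hbd T
    choose AW hAW using fun i m => (hWD.sm i 0).dec T m
    have hAW' : ∀ i, BdT T (fun m => ∑ i, |AW i m|) (W i) := fun i m t ht k =>
      (hAW i m t ht k).trans ((le_abs_self _).trans
        (Finset.single_le_sum (f := fun i => |AW i m|) (fun _ _ => abs_nonneg _)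
          (Finset.mem_univ i)))
    choose W' hW1 hW2 using fun i => (hWD.sm i 1).2
    choose LW hLW0 hLW using fun i m => (hW1 i).lip (hW2 i).dec T m
    have hLW' : ∀ i, LpT T (fun m => ∑ i, |LW i m|) (W i) := fun i m s hs t ht k =>
      (hLW i m s hs t ht k).trans (mul_le_mul_of_nonneg_right ((le_abs_self _).trans
        (Finset.single_le_sum (f := fun i => |LW i m|) (fun _ _ => abs_nonneg _)
          (Finset.mem_univ i))) (abs_nonneg _))
    obtain ⟨L, hL⟩ := gal_taylor ν hAW' hLW' A
    refine ⟨|L m|, fun s hs t ht k => ?_⟩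
    by_cases hk : k = 0
    · subst hk
      beta_reduce
      rw [hcl0 i t ht.1, hcl0 i s hs.1, rhsF, hcl0 i s hs.1, lerayP_zero, zdiv_zero]
      simp only [mul_zero, sub_self, norm_zero]
      positivity
    · have hconv : ∀ f g : ℕ → K3 → ℂ, ∀ f' g' : K3 → ℂ, ∀ A B : ℕ → ℝ,
          (∀ᶠ n in (hyperfilter ℕ : Filter ℕ), ∀ m k, wt k ^ m * ‖f n k‖ ≤ A m) →
          (∀ᶠ n in (hyperfilter ℕ : Filter ℕ), ∀ m k, wt k ^ m * ‖g n k‖ ≤ B m) →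
          (∀ k, Tendsto (fun n => f n k) (hyperfilter ℕ : Filter ℕ) (𝓝 (f' k))) →
          (∀ k, Tendsto (fun n => g n k) (hyperfilter ℕ : Filter ℕ) (𝓝 (g' k))) →
          Tendsto (fun n => conv (f n) (g n) k) (hyperfilter ℕ : Filter ℕ) (𝓝 (conv f' g' k)) := by
        intro f g f' g' A B hf hg hf' hg'
        refine tendsto_conv (A := A 0) (B := B 2) ?_ (hg.mono fun n h k => h 2 k) hf' hg' k
        filter_upwards [hf] with n hn k
        simpa using hn 0 k
      have hcA : ∀ i, ∀ᶠ n in (hyperfilter ℕ : Filter ℕ), ∀ m k, wt k ^ m * ‖c n k i s‖ ≤ A m := by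
        intro i
        filter_upwards [hge T] with n hn m k
        exact hA n hn i m s hs k
      have hWA : ∀ i, ∀ᶠ n in (hyperfilter ℕ : Filter ℕ), ∀ m k,
          wt k ^ m * ‖W i k s‖ ≤ ∑ i, |AW i m| :=
        fun i => Eventually.of_forall fun n m k => hAW' i m s hs k
      have hflux : ∀ i j, Tendsto (fun n => fluxF (fun i k => W i k s) (fun k i => c n k i s) k i j)
          (hyperfilter ℕ : Filter ℕ)
          (𝓝 (fluxF (fun i k => W i k s) (fun k i => cl k i s) k i j)) := by
        intro i j
        exact ((hconv _ _ _ _ _ _ (hWA i) (hcA j) (fun k => tendsto_const_nhds)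
          (fun k => hcl k j s hs.1)).add (hconv _ _ _ _ _ _ (hWA j) (hcA i)
          (fun k => tendsto_const_nhds) (fun k => hcl k i s hs.1))).add
          (hconv _ _ _ _ _ _ (hcA i) (hcA j) (fun k => hcl k i s hs.1) (fun k => hcl k j s hs.1))
      have hrhs : Tendsto (fun n => rhsF ν (fun i k => W i k s) (fun k i => c n k i s) k i)
          (hyperfilter ℕ : Filter ℕ)
          (𝓝 (rhsF ν (fun i k => W i k s) (fun k i => cl k i s) k i)) :=
        ((hcl k i s hs.1).const_mul _).sub (tendsto_lerayP_zdiv hflux k i)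
      refine le_of_tendsto (((((hcl k i t ht.1).sub (hcl k i s hs.1)).sub
        (hrhs.const_mul _)).norm).const_mul _) ?_
      filter_upwards [hge T, hle (eventually_mem_Kn hk)] with n hn hkn
      have hG' : Gal ν W (Kn n) T (fun _ => 1) (c n) :=
        ⟨(hG n).nz, (hG n).supp, fun k hk i t ht =>
          ((hG n).ode k hk i t ⟨ht.1, ht.2.trans hn⟩).mono (Icc_subset_Icc_right hn)⟩
      refine (hL (Kn n) (c n) hG' (hA n hn) m k hkn i s hs t ht).trans ?_
      gcongr
      exact le_abs_self _

/-- Bootstrap of time regularity. -/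
lemma SM_of_rhsF {ν : ℝ} {W : Fin 3 → K3 → ℝ → ℂ} {c : K3 → Fin 3 → ℝ → ℂ}
    (hW : ∀ i n, SM n (W i)) (hd : ∀ i, Dec fun k t => c k i t)
    (h1 : ∀ i, D1 (fun k t => c k i t)
        fun k t => rhsF ν (fun i k => W i k t) (fun k i => c k i t) k i) (n : ℕ) :
    ∀ i, SM n fun k t => c k i t := by
  induction n with
  | zero => exact hd
  | succ n ih =>
    intro i
    refine ⟨hd i, _, h1 i, ?_⟩
    have hf : ∀ i j, SM n fun k t => fluxF (fun i k => W i k t) (fun k i => c k i t) k i j :=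
      fun i j => (((hW i n).conv (ih j)).add ((hW j n).conv (ih i))).add ((ih i).conv (ih j))
    have h2 := ((SM.leray hf i).mul (PolyB.const (-1))).add
      ((ih i).mul ((PolyB.const (-(ν : ℂ))).mul PolyB.lam))
    convert h2 using 3 with k t
    simp only [rhsF]
    push_cast
    ring

/-- The perturbation problem in Fourier variables. -/
theorem perturb_exists {ν σ : ℝ} (hν : 0 < ν) (hσ : σ ∈ Ioo (0 : ℝ) 1) (C1 : ℝ) {r : ℕ}
    (hr : 1 ≤ r) :
    ∃ η D : ℝ, 0 < η ∧ 0 < D ∧ ∀ N, 1 ≤ N → ∀ W M, WData N C1 r W M →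
      ∀ (c0 : K3 → Fin 3 → ℂ) (B : ℕ → ℝ), (∀ k i, c0 (-k) i = (starRingEnd ℂ) (c0 k i)) →
      (∀ i, c0 0 i = 0) → (∀ k, ∑ i, (k i : ℂ) * c0 k i = 0) →
      (∀ m s, En s m c0 ≤ B m) → B 1 ≤ η → ∃ c : K3 → Fin 3 → ℝ → ℂ,
        (∀ i n, SM n fun k t => c k i t) ∧
        (∀ i, D1 (fun k t => c k i t)
          fun k t => rhsF ν (fun i k => W i k t) (fun k i => c k i t) k i) ∧
        (∀ k i, c k i 0 = c0 k i) ∧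
        (∀ k i t, 0 ≤ t → c (-k) i t = (starRingEnd ℂ) (c k i t)) ∧
        (∀ i t, 0 ≤ t → c 0 i t = 0) ∧
        (∀ k t, 0 ≤ t → ∑ i, (k i : ℂ) * c k i t = 0) ∧
        ∀ m ≤ r, ∀ t, 0 ≤ t → ∀ s, En s m (fun k i => c k i t) ≤
          D * (N ^ (m - 1)) ^ 2 * exp (-(2 * (ν * σ) * t)) * B m := by
  obtain ⟨η, D, hη, hD, h⟩ := gal_seq hν hσ C1 hr
  refine ⟨η, D, hη, hD, fun N hN W M hWD c0 B hsymm hc00 hdiv hB hB1 => ?_⟩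
  obtain ⟨c, hG, hinit, hcs, hen, hbd⟩ := h N hN W M hWD c0 B hsymm hB hB1
  obtain ⟨cl, hcl, hcl0, hi, hd, h1⟩ := perturb_limit hWD hG hinit hc00 hbd
  have hle : (hyperfilter ℕ : Filter ℕ) ≤ atTop := Nat.hyperfilter_le_atTop
  have hge : ∀ T : ℝ, ∀ᶠ n : ℕ in (hyperfilter ℕ : Filter ℕ), T ≤ (n : ℝ) := fun T =>
    hle (tendsto_natCast_atTop_atTop.eventually_ge_atTop T)
  refine ⟨cl, fun i n => SM_of_rhsF hWD.sm hd h1 n i, h1, hi, ?_, hcl0, ?_, ?_⟩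
  · intro k i t ht
    refine tendsto_nhds_unique (hcl (-k) i t ht)
      (((Complex.continuous_conj.tendsto _).comp (hcl k i t ht)).congr' ?_)
    filter_upwards [hge t] with n hn
    exact (hcs n k i t ⟨ht, hn⟩).symm
  · intro k t ht
    set y : ℝ → ℂ := fun t => ∑ i, (k i : ℂ) * cl k i t with hy
    have hy' : ∀ τ, 0 ≤ τ → HasDerivWithinAt y (-(ν * lam k : ℝ) * y τ) (Ici 0) τ := by
      intro τ hτ
      have := HasDerivWithinAt.fun_sum (u := Finset.univ) fun i _ =>
        ((h1 i).hasDerivWithinAt k hτ).const_mul (k i : ℂ)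
      refine this.congr_deriv ?_
      simp only [rhsF, mul_sub, Finset.sum_sub_distrib, sum_coord_lerayP, sub_zero, hy,
        Finset.mul_sum]
      exact Finset.sum_congr rfl fun i _ => by ring
    have hz : ∀ τ, 0 ≤ τ → HasDerivWithinAt
        (fun τ : ℝ => Complex.exp ((ν * lam k : ℝ) * (τ : ℂ)) * y τ) 0 (Ici 0) τ := by
      intro τ hτ
      have he : HasDerivAt (fun τ : ℝ => Complex.exp ((ν * lam k : ℝ) * (τ : ℂ)))
          (Complex.exp ((ν * lam k : ℝ) * (τ : ℂ)) * ((ν * lam k : ℝ) * 1)) τ :=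
        (((hasDerivAt_id τ).ofReal_comp).const_mul _).cexp
      refine (he.hasDerivWithinAt.mul (hy' τ hτ)).congr_deriv ?_
      ring
    have hc := (convex_Ici (0 : ℝ)).norm_image_sub_le_of_norm_hasDerivWithin_le (C := 0)
      (fun τ hτ => hz τ hτ) (fun τ hτ => by simp) (self_mem_Ici) (mem_Ici.2 ht)
    rw [zero_mul, norm_le_zero_iff, sub_eq_zero] at hc
    have hy0 : y 0 = 0 := by
      simp only [hy, hi]
      exact hdiv k
    rw [hy0, mul_zero, mul_eq_zero] at hc
    exact hc.resolve_left (Complex.exp_ne_zero _)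
  · intro m hm t ht s
    have h2 : Tendsto (fun n => En s m fun k i => c n k i t) (hyperfilter ℕ : Filter ℕ)
        (𝓝 (En s m fun k i => cl k i t)) :=
      tendsto_finsetSum _ fun k _ => (tendsto_finsetSum _ fun i _ =>
        ((hcl k i t ht).norm.pow 2)).const_mul _
    have hs : ∀ᶠ n in atTop, ∀ k ∈ s, k ≠ 0 → k ∈ Kn n := by
      rw [Filter.eventually_all_finset]
      intro k _
      by_cases hk : k = 0
      · exact Eventually.of_forall fun n h => absurd hk h
      · filter_upwards [eventually_mem_Kn hk] with n hn _ using hn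
    refine le_of_tendsto h2 ?_
    filter_upwards [hge t, hle hs] with n hn hsn
    refine le_trans ?_ (hen n m hm t ⟨ht, hn⟩)
    have hnn : ∀ k, 0 ≤ lam k ^ m * ∑ i, ‖c n k i t‖ ^ 2 := fun k =>
      mul_nonneg (pow_nonneg (lam_nonneg k) _) (Finset.sum_nonneg fun _ _ => sq_nonneg _)
    calc En s m (fun k i => c n k i t) ≤ ∑ k ∈ s.erase 0, lam k ^ m * ∑ i, ‖c n k i t‖ ^ 2 := by
          refine (Finset.sum_subset (Finset.erase_subset 0 s) fun k hk hk' => ?_).ge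
          have : k = 0 := by
            by_contra h0
            exact hk' (Finset.mem_erase.2 ⟨h0, hk⟩)
          subst this
          simp [(hG n).supp 0 (fun h => Kn_ne_zero 0 h rfl)]
      _ ≤ _ := Finset.sum_le_sum_of_subset_of_nonneg (fun k hk =>
          hsn k (Finset.mem_of_mem_erase hk) (Finset.ne_of_mem_erase hk)) fun k _ _ => hnn k

end NSF

namespace NSF

/-- The inner product `k · x`. -/
def dotk (k : K3) (x : E3) : ℝ := ∑ j, (k j : ℝ) * x j

/-- Fourier characters. -/
def ek (k : K3) (x : E3) : ℂ := Complex.exp (dotk k x * Complex.I)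

/-- Fourier synthesis. -/
def syn (a : K3 → ℝ → ℂ) (x : E3) (t : ℝ) : ℂ := ∑' k, a k t * ek k x

lemma norm_ek (k : K3) (x : E3) : ‖ek k x‖ = 1 := Complex.norm_exp_ofReal_mul_I _

lemma dotk_add (k : K3) (x y : E3) : dotk k (x + y) = dotk k x + dotk k y := by
  simp only [dotk, Pi.add_apply, mul_add, Finset.sum_add_distrib]

lemma ek_add (k : K3) (x y : E3) : ek k (x + y) = ek k x * ek k y := by
  rw [ek, ek, ek, ← Complex.exp_add, dotk_add]; push_cast; ring_nf

lemma ek_add_left (k l : K3) (x : E3) : ek (k + l) x = ek k x * ek l x := by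
  rw [ek, ek, ek, ← Complex.exp_add]
  congr 1
  simp only [dotk, Pi.add_apply, Int.cast_add, add_mul, Finset.sum_add_distrib]
  push_cast; ring

lemma ek_neg (k : K3) (x : E3) : ek (-k) x = (starRingEnd ℂ) (ek k x) := by
  rw [ek, ek, ← Complex.exp_conj]
  congr 1
  simp [dotk]

lemma ek_zero (x : E3) : ek 0 x = 1 := by simp [ek, dotk]

lemma abs_dotk_le (k : K3) (x : E3) : |dotk k x| ≤ 3 * wt k * ‖x‖ := by
  refine (Finset.abs_sum_le_sum_abs _ _).trans ?_
  calc _ ≤ ∑ _j : Fin 3, wt k * ‖x‖ := Finset.sum_le_sum fun j _ => by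
        rw [abs_mul]
        exact mul_le_mul (abs_le_wt k j) (norm_le_pi_norm x j) (abs_nonneg _) (wt_pos k).le
    _ = _ := by simp; ring

lemma ek_periodic (k : K3) (x : E3) (j : Fin 3) :
    ek k (x + (2 * Real.pi) • (Pi.single j 1 : E3)) = ek k x := by
  rw [ek_add]
  have : ek k ((2 * Real.pi) • (Pi.single j 1 : E3)) = 1 := by
    rw [ek, Complex.exp_eq_one_iff]
    refine ⟨k j, ?_⟩
    simp only [dotk, Pi.smul_apply, smul_eq_mul, Pi.single_apply, mul_ite, mul_one, mul_zero,
      Finset.sum_ite_eq', Finset.mem_univ, if_true]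
    push_cast; ring
  rw [this, mul_one]

lemma ek_sub_le (k : K3) (x y : E3) : ‖ek k y - ek k x‖ ≤ 3 * wt k * ‖y - x‖ := by
  have h : ek k y - ek k x = ek k x * (Complex.exp (Complex.I * dotk k (y - x)) - 1) := by
    rw [mul_sub, mul_one, mul_comm Complex.I, ← ek, ← ek_add]; simp
  rw [h, norm_mul, norm_ek, one_mul]
  exact (Real.norm_exp_I_mul_ofReal_sub_one_le).trans (abs_dotk_le k _)

lemma norm_exp_sub_one_sub_le (θ : ℝ) :
    ‖Complex.exp (θ * Complex.I) - 1 - θ * Complex.I‖ ≤ θ ^ 2 := by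
  have h1 : ∀ τ : ℝ, HasDerivAt (fun τ : ℝ => Complex.exp (τ * Complex.I) - 1 - τ * Complex.I)
      ((Complex.exp (Complex.I * τ) - 1) * Complex.I) τ := by
    intro τ
    have h2 : HasDerivAt (fun τ : ℝ => (τ : ℂ) * Complex.I) (1 * Complex.I) τ :=
      ((hasDerivAt_id τ).ofReal_comp).mul_const _
    refine ((h2.cexp.sub_const 1).sub h2).congr_deriv ?_
    rw [mul_comm Complex.I]; ring
  have h3 := (convex_uIcc 0 θ).norm_image_sub_le_of_norm_hasDerivWithin_le (C := |θ|)
    (fun τ _ => (h1 τ).hasDerivWithinAt) (fun τ hτ => by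
      rw [norm_mul, Complex.norm_I, mul_one]
      refine (Real.norm_exp_I_mul_ofReal_sub_one_le).trans ?_
      simpa using abs_sub_left_of_mem_uIcc hτ) left_mem_uIcc right_mem_uIcc
  simpa [← sq] using h3

lemma ek_taylor (k : K3) (x y : E3) :
    ‖ek k y - ek k x - dotk k (y - x) * Complex.I * ek k x‖ ≤ 9 * wt k ^ 2 * ‖y - x‖ ^ 2 := by
  have h : ek k y - ek k x - dotk k (y - x) * Complex.I * ek k x =
      ek k x * (Complex.exp (dotk k (y - x) * Complex.I) - 1 - dotk k (y - x) * Complex.I) := by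
    rw [mul_sub, mul_sub, mul_one, ← ek, ← ek_add]; simp; ring
  rw [h, norm_mul, norm_ek, one_mul]
  refine (norm_exp_sub_one_sub_le _).trans ?_
  rw [← sq_abs]
  calc _ ≤ (3 * wt k * ‖y - x‖) ^ 2 := by gcongr; exact abs_dotk_le k _
    _ = _ := by ring

/-- Coefficients of the spatial derivative. -/
def dj (j : Fin 3) (a : K3 → ℝ → ℂ) : K3 → ℝ → ℂ := fun k t => (k j : ℂ) * Complex.I * a k t

lemma SM.dj {n : ℕ} {a : K3 → ℝ → ℂ} (h : SM n a) (j : Fin 3) : SM n (dj j a) :=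
  h.mul ((PolyB.coord j).mul (PolyB.const Complex.I))

lemma Dec.dj {a : K3 → ℝ → ℂ} (h : Dec a) (j : Fin 3) : Dec (NSF.dj j a) :=
  SM.dj (n := 0) h j

lemma Dec.summable {a : K3 → ℝ → ℂ} (h : Dec a) (x : E3) {t : ℝ} (ht : 0 ≤ t) :
    Summable fun k => ‖a k t * ek k x‖ := by
  obtain ⟨C, hC⟩ := h t 2
  simp only [norm_mul, norm_ek, mul_one]
  exact summable_of_wt (fun k => hC t ⟨ht, le_rfl⟩ k)

/-- Derivative of the synthesis. -/
def synD (a a' : K3 → ℝ → ℂ) (p : E3 × ℝ) : E3 × ℝ →L[ℝ] ℂ :=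
  (∑ j, ((ContinuousLinearMap.proj (R := ℝ) (φ := fun _ : Fin 3 => ℝ) j).comp
    (ContinuousLinearMap.fst ℝ E3 ℝ)).smulRight (syn (dj j a) p.1 p.2)) +
  (ContinuousLinearMap.snd ℝ E3 ℝ).smulRight (syn a' p.1 p.2)

/-- The space-time domain. -/
def dom : Set (E3 × ℝ) := univ ×ˢ Ici 0

lemma syn_taylor {a a' : K3 → ℝ → ℂ} (ha : Dec a) (h1 : D1 a a') (ha' : Dec a') (T : ℝ) :
    ∃ C, 0 ≤ C ∧ ∀ s ∈ Icc 0 T, ∀ t ∈ Icc 0 T, ∀ x y : E3,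
      ‖syn a y t - syn a x s - synD a a' (x, s) (y - x, t - s)‖ ≤
        C * (|t - s| ^ 2 + |t - s| * ‖y - x‖ + ‖y - x‖ ^ 2) := by
  obtain ⟨C1, hC1⟩ := h1 T 2
  obtain ⟨C2, hC2⟩ := ha' T 3
  obtain ⟨C3, hC3⟩ := ha T 4
  refine ⟨(|C1| + 3 * |C2| + 9 * |C3|) * Lam1, by have := Lam1_nonneg; positivity,
    fun s hs t ht x y => ?_⟩
  set X := ‖y - x‖ with hX
  set τ := |t - s| with hτ
  have hX0 : 0 ≤ X := norm_nonneg _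
  have hτ0 : 0 ≤ τ := abs_nonneg _
  have e1 : synD a a' (x, s) (y - x, t - s) =
      ∑' k, (a k s * (dotk k (y - x) * Complex.I * ek k x) + (t - s : ℝ) * (a' k s * ek k x)) := by
    have hs1 : ∀ j : Fin 3, Summable fun k => dj j a k s * ek k x := fun j =>
      ((ha.dj j).summable x hs.1).of_norm
    have hs2 : Summable fun k => a' k s * ek k x := (ha'.summable x hs.1).of_norm
    have e2 : ∀ k, a k s * (dotk k (y - x) * Complex.I * ek k x) =
        ∑ j, ((y - x) j : ℂ) * (dj j a k s * ek k x) := by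
      intro k
      simp only [dotk, dj]
      push_cast
      rw [Finset.sum_mul, Finset.sum_mul, Finset.mul_sum]
      exact Finset.sum_congr rfl fun j _ => by ring
    have hsum : Summable fun k => ∑ j, ((y - x) j : ℂ) * (dj j a k s * ek k x) :=
      summable_sum fun j _ => (hs1 j).mul_left _
    simp only [e2]
    rw [hsum.tsum_add (hs2.mul_left _), tsum_mul_left,
      Summable.tsum_finsetSum fun j _ => (hs1 j).mul_left _]
    simp only [tsum_mul_left, synD, syn]
    simp
  have hsa := (ha.summable x hs.1).of_norm
  have hsa2 := (ha.summable y ht.1).of_norm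
  have hterm : ∀ k, wt k ^ 2 * ‖a k t * ek k y - a k s * ek k x -
      (a k s * (dotk k (y - x) * Complex.I * ek k x) + (t - s : ℝ) * (a' k s * ek k x))‖ ≤
      (|C1| + 3 * |C2| + 9 * |C3|) * (τ ^ 2 + τ * X + X ^ 2) := by
    intro k
    have hw := wt_pos k
    have e : a k t * ek k y - a k s * ek k x -
        (a k s * (dotk k (y - x) * Complex.I * ek k x) + (t - s : ℝ) * (a' k s * ek k x)) =
        (a k t - a k s - (t - s : ℝ) * a' k s) * ek k y +
        (t - s : ℝ) * (a' k s * (ek k y - ek k x)) +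
        a k s * (ek k y - ek k x - dotk k (y - x) * Complex.I * ek k x) := by ring
    rw [e]
    have n1 : wt k ^ 2 * ‖(a k t - a k s - (t - s : ℝ) * a' k s) * ek k y‖ ≤ |C1| * τ ^ 2 := by
      rw [norm_mul, norm_ek, mul_one]
      exact (hC1 s hs t ht k).trans (by gcongr; exact le_abs_self _)
    have n2 : wt k ^ 2 * ‖((t - s : ℝ) : ℂ) * (a' k s * (ek k y - ek k x))‖ ≤
        3 * |C2| * (τ * X) := by
      rw [norm_mul, norm_mul, Complex.norm_real, Real.norm_eq_abs, ← hτ]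
      calc wt k ^ 2 * (τ * (‖a' k s‖ * ‖ek k y - ek k x‖))
          ≤ wt k ^ 2 * (τ * (‖a' k s‖ * (3 * wt k * X))) := by gcongr; exact ek_sub_le k x y
        _ = 3 * (wt k ^ 3 * ‖a' k s‖) * (τ * X) := by ring
        _ ≤ _ := by gcongr; exact (hC2 s hs k).trans (le_abs_self _)
    have n3 : wt k ^ 2 * ‖a k s * (ek k y - ek k x - dotk k (y - x) * Complex.I * ek k x)‖ ≤
        9 * |C3| * X ^ 2 := by
      rw [norm_mul]
      calc wt k ^ 2 * (‖a k s‖ * _) ≤ wt k ^ 2 * (‖a k s‖ * (9 * wt k ^ 2 * X ^ 2)) := by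
            gcongr; exact ek_taylor k x y
        _ = 9 * (wt k ^ 4 * ‖a k s‖) * X ^ 2 := by ring
        _ ≤ _ := by gcongr; exact (hC3 s hs k).trans (le_abs_self _)
    have n4 := mul_le_mul_of_nonneg_left (norm_add₃_le
      (a := (a k t - a k s - (t - s : ℝ) * a' k s) * ek k y)
      (b := ((t - s : ℝ) : ℂ) * (a' k s * (ek k y - ek k x)))
      (c := a k s * (ek k y - ek k x - dotk k (y - x) * Complex.I * ek k x)))
      (pow_pos hw 2).le
    have := mul_nonneg hτ0 hX0
    have := sq_nonneg τ
    have := sq_nonneg X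
    nlinarith [abs_nonneg C1, abs_nonneg C2, abs_nonneg C3,
      mul_nonneg (abs_nonneg C1) (mul_nonneg hτ0 hX0), mul_nonneg (abs_nonneg C1) (sq_nonneg X),
      mul_nonneg (abs_nonneg C2) (sq_nonneg τ), mul_nonneg (abs_nonneg C2) (sq_nonneg X),
      mul_nonneg (abs_nonneg C3) (mul_nonneg hτ0 hX0), mul_nonneg (abs_nonneg C3) (sq_nonneg τ)]
  have hsd : Summable fun k => a k s * (dotk k (y - x) * Complex.I * ek k x) +
      (t - s : ℝ) * (a' k s * ek k x) := by
    have := (hsa2.sub hsa).sub (summable_of_wt hterm).of_norm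
    refine this.congr fun k => by ring
  have e3 : syn a y t - syn a x s - synD a a' (x, s) (y - x, t - s) =
      ∑' k, (a k t * ek k y - a k s * ek k x -
      (a k s * (dotk k (y - x) * Complex.I * ek k x) + (t - s : ℝ) * (a' k s * ek k x))) := by
    rw [e1, syn, syn, (hsa2.sub hsa).tsum_sub hsd, hsa2.tsum_sub hsa]
  rw [e3]
  refine (norm_tsum_le_of_wt hterm).trans (le_of_eq (by ring))

lemma syn_hasFDerivWithinAt {a a' : K3 → ℝ → ℂ} (ha : Dec a) (h1 : D1 a a') (ha' : Dec a')
    {p : E3 × ℝ} (hp : p ∈ dom) :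
    HasFDerivWithinAt (fun q : E3 × ℝ => syn a q.1 q.2) (synD a a' p) dom p := by
  obtain ⟨x, s⟩ := p
  have hs : 0 ≤ s := hp.2
  obtain ⟨C, hC0, hC⟩ := syn_taylor ha h1 ha' (s + 1)
  rw [hasFDerivWithinAt_iff_isLittleO]
  refine Asymptotics.IsBigO.trans_isLittleO (g := fun q : E3 × ℝ => ‖q - (x, s)‖ ^ 2) ?_ ?_
  · refine Asymptotics.IsBigO.of_bound (3 * C) ?_
    have hnear : ∀ᶠ q in nhdsWithin (x, s) dom, q ∈ Metric.ball (x, s) 1 :=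
      nhdsWithin_le_nhds (Metric.ball_mem_nhds _ one_pos)
    filter_upwards [hnear, self_mem_nhdsWithin] with q hq hqd
    obtain ⟨y, t⟩ := q
    have ht : 0 ≤ t := hqd.2
    rw [mem_ball_iff_norm] at hq
    have n1 : ‖y - x‖ ≤ ‖(y, t) - (x, s)‖ := norm_fst_le ((y, t) - (x, s))
    have n2 : |t - s| ≤ ‖(y, t) - (x, s)‖ := norm_snd_le ((y, t) - (x, s))
    have ht1 : t ≤ s + 1 := by linarith [le_abs_self (t - s)]
    refine (hC s ⟨hs, by linarith⟩ t ⟨ht, ht1⟩ x y).trans ?_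
    rw [norm_pow, norm_norm]
    have n3 := norm_nonneg (y - x)
    have n4 := abs_nonneg (t - s)
    have : |t - s| ^ 2 + |t - s| * ‖y - x‖ + ‖y - x‖ ^ 2 ≤ 3 * ‖(y, t) - (x, s)‖ ^ 2 := by
      nlinarith
    nlinarith
  · have h0 : Filter.Tendsto (fun q : E3 × ℝ => ‖q - (x, s)‖) (nhdsWithin (x, s) dom) (nhds 0) := by
      have : Continuous fun q : E3 × ℝ => ‖q - (x, s)‖ := by fun_prop
      have h := this.tendsto (x, s)
      simp only [sub_self, norm_zero] at h
      exact h.mono_left nhdsWithin_le_nhds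
    have := ((Asymptotics.isLittleO_one_iff ℝ).2 h0).mul_isBigO
      (Asymptotics.isBigO_refl (fun q : E3 × ℝ => ‖q - (x, s)‖) _)
    simp only [one_mul, ← sq] at this
    exact this.of_norm_right

lemma uniqueDiffOn_dom : UniqueDiffOn ℝ dom := uniqueDiffOn_univ.prod (uniqueDiffOn_Ici 0)

lemma syn_contDiffOn (n : ℕ) : ∀ a : K3 → ℝ → ℂ, SM (n + 1) a →
    ContDiffOn ℝ n (fun q : E3 × ℝ => syn a q.1 q.2) dom := by
  induction n with
  | zero =>
    rintro a ⟨ha, a', h1, ha'⟩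
    exact contDiffOn_zero.2 fun p hp =>
      (syn_hasFDerivWithinAt ha h1 ha'.dec hp).continuousWithinAt
  | succ n ih =>
    intro a hSM
    obtain ⟨ha, a', h1, ha'⟩ := id hSM
    have hd := fun p hp => syn_hasFDerivWithinAt ha h1 ha'.dec (p := p) hp
    rw [show ((n + 1 : ℕ) : WithTop ℕ∞) = (n : WithTop ℕ∞) + 1 by norm_cast,
      contDiffOn_succ_iff_fderivWithin uniqueDiffOn_dom]
    refine ⟨fun p hp => (hd p hp).differentiableWithinAt, by simp, ?_⟩
    refine ContDiffOn.congr (f := synD a a') ?_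
      fun p hp => (hd p hp).fderivWithin (uniqueDiffOn_dom p hp)
    refine ContDiffOn.add (ContDiffOn.sum fun j _ => ?_) ?_
    · exact contDiffOn_const.smulRight (ih _ (hSM.pred.dj j))
    · exact contDiffOn_const.smulRight (ih _ ha')

end NSF

namespace NSF

lemma syn_re_contDiffOn {a : K3 → ℝ → ℂ} (h : ∀ n, SM n a) :
    ContDiffOn ℝ (⊤ : ℕ∞) (fun q : E3 × ℝ => (syn a q.1 q.2).re) dom := by
  rw [contDiffOn_infty]
  exact fun n => Complex.reCLM.contDiff.comp_contDiffOn (syn_contDiffOn n a (h _))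

lemma hasFDerivAt_syn {a : K3 → ℝ → ℂ} (h : SM 1 a) {t : ℝ} (ht : 0 ≤ t) (x : E3) :
    HasFDerivAt (fun x => syn a x t) (∑ j, (ContinuousLinearMap.proj (R := ℝ)
      (φ := fun _ : Fin 3 => ℝ) j).smulRight (syn (dj j a) x t)) x := by
  obtain ⟨ha, a', h1, ha'⟩ := h
  have h2 := syn_hasFDerivWithinAt ha h1 ha' (p := (x, t)) ⟨mem_univ _, ht⟩
  have h3 : HasFDerivAt (fun y : E3 => (y, t)) (ContinuousLinearMap.inl ℝ E3 ℝ) x :=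
    hasFDerivAt_prodMk_left x t
  have h4 := HasFDerivWithinAt.comp (s := univ) (t := dom) x h2 h3.hasFDerivWithinAt
    (fun y _ => show (y, t) ∈ dom from ⟨mem_univ _, ht⟩)
  rw [hasFDerivWithinAt_univ] at h4
  refine h4.congr_fderiv ?_
  ext v
  simp [synD]

lemma pd_re_syn {a : K3 → ℝ → ℂ} (h : SM 1 a) {t : ℝ} (ht : 0 ≤ t) (j : Fin 3) :
    pd j (fun x => (syn a x t).re) = fun x => (syn (dj j a) x t).re := by
  funext x
  have h1 := Complex.reCLM.hasFDerivAt.comp x (hasFDerivAt_syn h ht x)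
  have h2 : fderiv ℝ (fun x => (syn a x t).re) x = _ := h1.fderiv
  rw [pd, h2]
  simp [Pi.single_apply]

lemma hasDerivWithinAt_syn {a a' : K3 → ℝ → ℂ} (ha : Dec a) (h1 : D1 a a') (ha' : Dec a')
    {t : ℝ} (ht : 0 ≤ t) (x : E3) :
    HasDerivWithinAt (fun τ => (syn a x τ).re) (syn a' x t).re (Ici 0) t := by
  have h2 := syn_hasFDerivWithinAt ha h1 ha' (p := (x, t)) ⟨mem_univ _, ht⟩
  have h3 : HasFDerivAt (fun τ : ℝ => (x, τ)) (ContinuousLinearMap.inr ℝ E3 ℝ) t :=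
    hasFDerivAt_prodMk_right x t
  have h4 := HasFDerivWithinAt.comp (s := Ici 0) (t := dom) t h2 h3.hasFDerivWithinAt
    (fun τ hτ => show (x, τ) ∈ dom from ⟨mem_univ _, hτ⟩)
  have h5 := (Complex.reCLM.hasFDerivAt.comp_hasFDerivWithinAt t h4).hasDerivWithinAt
  refine h5.congr_deriv ?_
  simp [synD]

lemma syn_add {a b : K3 → ℝ → ℂ} (ha : Dec a) (hb : Dec b) {t : ℝ} (ht : 0 ≤ t) (x : E3) :
    syn (fun k t => a k t + b k t) x t = syn a x t + syn b x t := by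
  simp only [syn, add_mul]
  exact (ha.summable x ht).of_norm.tsum_add (hb.summable x ht).of_norm

lemma syn_const_mul (z : ℂ) (a : K3 → ℝ → ℂ) (t : ℝ) (x : E3) :
    syn (fun k t => z * a k t) x t = z * syn a x t := by
  simp only [syn, mul_assoc, tsum_mul_left]

lemma syn_sum {ι : Type*} (s : Finset ι) {a : ι → K3 → ℝ → ℂ} (ha : ∀ i ∈ s, Dec (a i)) {t : ℝ}
    (ht : 0 ≤ t) (x : E3) :
    syn (fun k t => ∑ i ∈ s, a i k t) x t = ∑ i ∈ s, syn (a i) x t := by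
  simp only [syn, Finset.sum_mul]
  exact Summable.tsum_finsetSum fun i hi => ((ha i hi).summable x ht).of_norm

lemma syn_mul {a b : K3 → ℝ → ℂ} (ha : Dec a) (hb : Dec b) {t : ℝ} (ht : 0 ≤ t) (x : E3) :
    syn a x t * syn b x t = syn (fun k t => conv (fun l => a l t) (fun l => b l t) k) x t := by
  have hsa := ha.summable x ht
  have hsb := hb.summable x ht
  rw [syn, syn, tsum_mul_tsum_of_summable_norm hsa hsb]
  have hs := summable_mul_of_summable_norm hsa hsb
  let e : K3 × K3 ≃ K3 × K3 :=
    { toFun := fun p => (p.1 - p.2, p.2)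
      invFun := fun p => (p.1 + p.2, p.2)
      left_inv := fun p => by simp
      right_inv := fun p => by simp }
  rw [← e.tsum_eq]
  have hs' : Summable fun c => a (e c).1 t * ek (e c).1 x * (b (e c).2 t * ek (e c).2 x) :=
    e.summable_iff.2 hs
  rw [hs'.tsum_prod' fun k => hs'.comp_injective fun l l' h => (Prod.mk.inj h).2]
  rw [syn]
  refine tsum_congr fun k => ?_
  rw [conv, ← tsum_mul_right]
  refine tsum_congr fun l => ?_
  have : ek k x = ek (k - l) x * ek l x := by rw [← ek_add_left, sub_add_cancel]
  simp only [e, Equiv.coe_fn_mk, this]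
  ring

lemma syn_im {a : K3 → ℝ → ℂ} {t : ℝ} (h : ∀ k, a (-k) t = (starRingEnd ℂ) (a k t)) (x : E3) :
    (syn a x t).im = 0 := by
  rw [← Complex.conj_eq_iff_im, syn, Complex.conj_tsum, ← (Equiv.neg K3).tsum_eq]
  refine tsum_congr fun k => ?_
  simp only [Equiv.neg_apply, map_mul, h, ek_neg, Complex.conj_conj]

lemma syn_periodic (a : K3 → ℝ → ℂ) (t : ℝ) : SpacePeriodic fun x => syn a x t := by
  intro x j
  simp only [syn, ek_periodic]

end NSF

namespace NSF

lemma T3_eq : T3 = Icc (0 : Fin 3 → ℝ) (fun _ => 2 * Real.pi) := rfl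

lemma isCompact_T3 : IsCompact T3 := isCompact_Icc

lemma volume_T3 : (volume T3).toReal = (2 * Real.pi) ^ 3 := by
  rw [T3_eq, Real.volume_Icc_pi_toReal]
  · simp
  · intro i; simp [Real.pi_pos.le]

lemma T3_integrable {E : Type*} [NormedAddCommGroup E] {f : E3 → E} (hf : Continuous f) :
    IntegrableOn f T3 := hf.continuousOn.integrableOn_compact isCompact_T3

lemma periodic_nat {ι : Type*} {f : E3 → ι} (hf : SpacePeriodic f) (j : Fin 3) (n : ℕ) :
    ∀ x, f (x + (2 * Real.pi * n) • (Pi.single j 1 : E3)) = f x := by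
  induction n with
  | zero => intro x; simp
  | succ n ih =>
    intro x
    rw [← ih x, ← hf (x + (2 * Real.pi * n) • (Pi.single j 1 : E3)) j]
    congr 1
    push_cast
    module

lemma periodic_int {ι : Type*} {f : E3 → ι} (hf : SpacePeriodic f) (j : Fin 3) (n : ℤ) (x : E3) :
    f (x + (2 * Real.pi * n) • (Pi.single j 1 : E3)) = f x := by
  obtain ⟨m, rfl | rfl⟩ := n.eq_nat_or_neg
  · exact_mod_cast periodic_nat hf j m x
  · rw [← periodic_nat hf j m]
    congr 1
    push_cast
    module

lemma periodic_lattice {ι : Type*} {f : E3 → ι} (hf : SpacePeriodic f) (n : K3) (x : E3) :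
    f (x + fun j => 2 * Real.pi * n j) = f x := by
  refine Eq.trans ?_ ((periodic_int hf 2 (n 2) _).trans
    ((periodic_int hf 1 (n 1) _).trans (periodic_int hf 0 (n 0) x)))
  congr 1
  ext i
  fin_cases i <;> simp

/-- Every point is congruent to a point of the fundamental cell. -/
lemma exists_T3_repr (x : E3) : ∃ n : K3, (x + fun j => 2 * Real.pi * n j) ∈ T3 := by
  have h2 : (0 : ℝ) < 2 * Real.pi := by positivity
  refine ⟨fun j => -⌊x j / (2 * Real.pi)⌋, fun j => ?_, fun j => ?_⟩
  · have := Int.floor_le (x j / (2 * Real.pi))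
    rw [le_div_iff₀ h2] at this
    simp only [Pi.zero_apply, Pi.add_apply, Int.cast_neg]
    linarith
  · have := (Int.lt_floor_add_one (x j / (2 * Real.pi))).le
    rw [div_le_iff₀ h2] at this
    simp only [Pi.add_apply, Int.cast_neg]
    linarith

lemma periodic_exists_T3 {ι : Type*} {f : E3 → ι} (hf : SpacePeriodic f) (x : E3) :
    ∃ y ∈ T3, f y = f x := by
  obtain ⟨n, hn⟩ := exists_T3_repr x
  exact ⟨_, hn, periodic_lattice hf n x⟩

lemma setIntegral_deriv_eq_zero {h : E3 → ℂ} {h' : E3 → E3 →L[ℝ] ℂ}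
    (hh : ∀ x, HasFDerivAt h (h' x) x) (hp : SpacePeriodic h) (j : Fin 3)
    (hc : Continuous fun x => h' x (Pi.single j 1 : E3)) :
    ∫ x in T3, h' x (Pi.single j 1 : E3) = 0 := by
  have key := integral_divergence_of_hasFDerivAt_off_countable' (n := 2) (E := ℂ)
    (0 : Fin 3 → ℝ) (fun _ => 2 * Real.pi) (fun i => by simp [Real.pi_pos.le])
    (fun i => if i = j then h else 0) (fun i => if i = j then h' else 0) ∅ countable_empty
    (fun i => by
      split_ifs
      · exact (continuous_iff_continuousAt.2 fun x => (hh x).continuousAt).continuousOn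
      · exact continuousOn_const)
    (fun x _ i => by
      split_ifs
      · exact hh x
      · exact hasFDerivAt_const _ _)
    (by
      have e : (fun x : Fin 3 → ℝ => ∑ i, (if i = j then h' else 0) x (Pi.single i 1 : E3)) =
          fun x => h' x (Pi.single j 1 : E3) := by
        funext x
        rw [Finset.sum_eq_single j]
        · simp
        · intro i _ hi; simp [hi]
        · simp
      rw [e]
      exact T3_integrable hc)
  have e : (fun x : Fin 3 → ℝ => ∑ i, (if i = j then h' else 0) x (Pi.single i 1 : E3)) =
      fun x => h' x (Pi.single j 1 : E3) := by
    funext x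
    rw [Finset.sum_eq_single j]
    · simp
    · intro i _ hi; simp [hi]
    · simp
  rw [e] at key
  rw [T3_eq, key]
  refine Finset.sum_eq_zero fun i _ => ?_
  by_cases hi : i = j
  · subst hi
    simp only [if_true]
    rw [sub_eq_zero]
    refine integral_congr_ae (Filter.Eventually.of_forall fun x => ?_)
    simp only [Pi.zero_apply]
    rw [← hp (i.insertNth 0 x) i]
    congr 1
    ext l
    rcases Fin.eq_self_or_eq_succAbove i l with rfl | ⟨m, rfl⟩
    · simp
    · simp [Fin.succAbove_ne]
  · simp [hi]

lemma continuous_ek (k : K3) : Continuous (ek k) := by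
  unfold ek dotk; fun_prop

lemma hasFDerivAt_ek (k : K3) (x : E3) : HasFDerivAt (ek k)
    (∑ j, (ContinuousLinearMap.proj (R := ℝ) (φ := fun _ : Fin 3 => ℝ) j).smulRight
      ((k j : ℂ) * Complex.I * ek k x)) x := by
  have h1 : HasFDerivAt (fun x : E3 => (dotk k x : ℂ))
      (∑ j, (ContinuousLinearMap.proj (R := ℝ) (φ := fun _ : Fin 3 => ℝ) j).smulRight
        (k j : ℂ)) x := by
    have : (fun x : E3 => (dotk k x : ℂ)) = 
      (∑ j, (ContinuousLinearMap.proj (R := ℝ) (φ := fun _ : Fin 3 => ℝ) j).smulRight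
        (k j : ℂ)) := by
      funext x
      simp [dotk, mul_comm]
    rw [this]
    exact ContinuousLinearMap.hasFDerivAt _
  refine (h1.mul_const Complex.I).cexp.congr_fderiv ?_
  ext v
  simp [ek, Finset.mul_sum]
  refine Finset.sum_congr rfl fun j _ => ?_
  ring

/-- Fourier coefficients. -/
def fc (f : E3 → ℂ) (k : K3) : ℂ := (((2 * Real.pi) ^ 3)⁻¹ : ℝ) * ∫ x in T3, ek (-k) x * f x

lemma cell_pos : (0 : ℝ) < (2 * Real.pi) ^ 3 := by positivity

lemma setIntegral_ek (k : K3) : ∫ x in T3, ek k x = if k = 0 then (((2 * Real.pi) ^ 3 : ℝ) : ℂ) else 0 := by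
  split_ifs with hk
  · subst hk
    simp only [ek_zero]
    rw [setIntegral_const, Measure.real, volume_T3]
    simp
  · obtain ⟨j, hj⟩ : ∃ j, k j ≠ 0 := by
      by_contra! h
      exact hk (funext h)
    have h := setIntegral_deriv_eq_zero (hasFDerivAt_ek k) (ek_periodic k) j (by
      simp only [_root_.sum_apply,
        ContinuousLinearMap.smulRight_apply, ContinuousLinearMap.proj_apply]
      have := continuous_ek k
      fun_prop)
    have e : ∀ x, (∑ i, (ContinuousLinearMap.proj (R := ℝ) (φ := fun _ : Fin 3 => ℝ) i).smulRight
      ((k i : ℂ) * Complex.I * ek k x)) (Pi.single j 1 : E3) = (k j : ℂ) * Complex.I * ek k x := by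
      intro x
      simp [Pi.single_apply]
    simp only [e] at h
    rw [integral_const_mul] at h
    simpa [hj] using h

lemma fc_ek (k l : K3) : fc (ek l) k = if k = l then 1 else 0 := by
  have h := cell_pos
  simp only [fc, ← ek_add_left]
  rw [setIntegral_ek]
  have : (-k + l = 0) ↔ k = l := by rw [neg_add_eq_zero]
  simp only [this]
  split_ifs
  · rw [← Complex.ofReal_mul, inv_mul_cancel₀ h.ne', Complex.ofReal_one]
  · simp

lemma fc_const_mul (z : ℂ) (f : E3 → ℂ) (k : K3) : fc (fun x => z * f x) k = z * fc f k := by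
  simp only [fc, mul_left_comm _ z]
  rw [integral_const_mul]; ring

lemma fc_sub {f g : E3 → ℂ} (hf : Continuous f) (hg : Continuous g) (k : K3) :
    fc (fun x => f x - g x) k = fc f k - fc g k := by
  have h1 := continuous_ek (-k)
  simp only [fc, mul_sub]
  rw [integral_sub (T3_integrable (by fun_prop)) (T3_integrable (by fun_prop)), mul_sub]

lemma fc_sum {ι : Type*} (s : Finset ι) {f : ι → E3 → ℂ} (hf : ∀ i ∈ s, Continuous (f i)) (k : K3) :
    fc (fun x => ∑ i ∈ s, f i x) k = ∑ i ∈ s, fc (f i) k := by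
  have h1 := continuous_ek (-k)
  simp only [fc, Finset.mul_sum]
  rw [integral_finsetSum _ fun i hi => T3_integrable (by have := hf i hi; fun_prop), Finset.mul_sum]

lemma norm_fc_le {f : E3 → ℂ} {B : ℝ} (hB : ∀ x ∈ T3, ‖f x‖ ≤ B) (k : K3) : ‖fc f k‖ ≤ B := by
  have hpos := cell_pos
  have h1 : ‖∫ x in T3, ek (-k) x * f x‖ ≤ B * (volume T3).toReal :=
    norm_setIntegral_le_of_norm_le_const (isCompact_T3.measure_lt_top) fun x hx => by
      rw [norm_mul, norm_ek, one_mul]; exact hB x hx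
  rw [volume_T3] at h1
  rw [fc, norm_mul, Complex.norm_real, Real.norm_eq_abs, abs_of_pos (inv_pos.2 hpos)]
  rw [inv_mul_le_iff₀ hpos, mul_comm]
  exact h1

lemma fc_fderiv {f : E3 → ℂ} {f' : E3 → E3 →L[ℝ] ℂ} (hf : ∀ x, HasFDerivAt f (f' x) x)
    (hp : SpacePeriodic f) (j : Fin 3) (hc : Continuous fun x => f' x (Pi.single j 1 : E3))
    (k : K3) : fc (fun x => f' x (Pi.single j 1 : E3)) k = (k j : ℂ) * Complex.I * fc f k := by
  have hfc : Continuous f := continuous_iff_continuousAt.2 fun x => (hf x).continuousAt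
  have hek := continuous_ek (-k)
  have hd := fun x => (hasFDerivAt_ek (-k) x).fun_mul (hf x)
  have e : ∀ x, (ek (-k) x • f' x + f x • (∑ i, (ContinuousLinearMap.proj (R := ℝ)
      (φ := fun _ : Fin 3 => ℝ) i).smulRight (((-k) i : ℤ) * Complex.I * ek (-k) x)))
      (Pi.single j 1 : E3) = ek (-k) x * f' x (Pi.single j 1 : E3) -
        (k j : ℂ) * Complex.I * (ek (-k) x * f x) := by
    intro x
    simp [Pi.single_apply]
    ring
  have h0 := setIntegral_deriv_eq_zero hd (fun x i => by beta_reduce; rw [ek_periodic, hp x i]) j (by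
    simp only [e]; fun_prop)
  simp only [e] at h0
  rw [integral_sub (T3_integrable (by fun_prop)) (T3_integrable (by fun_prop)),
    integral_const_mul, sub_eq_zero] at h0
  rw [fc, fc, h0]
  ring

lemma fc_conj (f : E3 → ℂ) (hf : ∀ x, (starRingEnd ℂ) (f x) = f x) (k : K3) :
    fc f (-k) = (starRingEnd ℂ) (fc f k) := by
  simp only [fc, map_mul, Complex.conj_ofReal, ← integral_conj, hf, neg_neg, ek_neg, Complex.conj_conj]

end NSF

namespace NSF
open scoped Pointwise

/-- Trigonometric polynomials. -/
def trig (B : Finset K3) (b : K3 → ℂ) (x : E3) : ℂ := ∑ l ∈ B, b l * ek l x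

lemma continuous_trig (B : Finset K3) (b : K3 → ℂ) : Continuous (trig B b) := by
  unfold trig
  exact continuous_finsetSum _ fun l _ => continuous_const.mul (continuous_ek l)

lemma setIntegral_ek_mul (g : E3 → ℂ) (k : K3) :
    ∫ x in T3, ek (-k) x * g x = ((2 * Real.pi) ^ 3 : ℝ) * fc g k := by
  rw [fc, ← mul_assoc, ← Complex.ofReal_mul, mul_inv_cancel₀ cell_pos.ne', Complex.ofReal_one,
    one_mul]

lemma fc_trig (B : Finset K3) (b : K3 → ℂ) (k : K3) :
    fc (trig B b) k = if k ∈ B then b k else 0 := by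
  unfold trig
  rw [fc_sum B (f := fun l x => b l * ek l x) fun l _ => continuous_const.mul (continuous_ek l)]
  simp only [fc_const_mul, fc_ek]
  simp

lemma setIntegral_conj_trig_mul (B : Finset K3) (b : K3 → ℂ) {g : E3 → ℂ} (hg : Continuous g) :
    ∫ x in T3, (starRingEnd ℂ) (trig B b x) * g x =
      ((2 * Real.pi) ^ 3 : ℝ) * ∑ l ∈ B, (starRingEnd ℂ) (b l) * fc g l := by
  have e : ∀ x, (starRingEnd ℂ) (trig B b x) * g x =
      ∑ l ∈ B, (starRingEnd ℂ) (b l) * (ek (-l) x * g x) := by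
    intro x
    simp only [trig, map_sum, map_mul, Finset.sum_mul, ek_neg, mul_assoc]
  simp only [e]
  rw [integral_finsetSum (f := fun l x => (starRingEnd ℂ) (b l) * (ek (-l) x * g x)) _
    fun l _ => T3_integrable (continuous_const.mul ((continuous_ek _).mul hg)), Finset.mul_sum]
  refine Finset.sum_congr rfl fun l _ => ?_
  rw [integral_const_mul, setIntegral_ek_mul]; ring

lemma setIntegral_norm_trig_sq (B : Finset K3) (b : K3 → ℂ) :
    ∫ x in T3, ‖trig B b x‖ ^ 2 = (2 * Real.pi) ^ 3 * ∑ l ∈ B, ‖b l‖ ^ 2 := by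
  have h := setIntegral_conj_trig_mul B b (continuous_trig B b)
  have e : ∀ x, (starRingEnd ℂ) (trig B b x) * trig B b x = ((‖trig B b x‖ ^ 2 : ℝ) : ℂ) := by
    intro x; rw [Complex.conj_mul']; push_cast; rfl
  have e2 : ∑ l ∈ B, (starRingEnd ℂ) (b l) * fc (trig B b) l = ((∑ l ∈ B, ‖b l‖ ^ 2 : ℝ) : ℂ) := by
    push_cast
    refine Finset.sum_congr rfl fun l hl => ?_
    rw [fc_trig, if_pos hl, Complex.conj_mul']
  simp only [e] at h
  rw [e2, integral_complex_ofReal] at h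
  exact_mod_cast h

lemma bessel {g : E3 → ℂ} (hg : Continuous g) (A : Finset K3) :
    (2 * Real.pi) ^ 3 * ∑ k ∈ A, ‖fc g k‖ ^ 2 ≤ ∫ x in T3, ‖g x‖ ^ 2 := by
  have hq := continuous_trig A (fc g)
  have h0 : 0 ≤ ∫ x in T3, ‖g x - trig A (fc g) x‖ ^ 2 := integral_nonneg fun x => sq_nonneg _
  have e : ∀ x, ‖g x - trig A (fc g) x‖ ^ 2 = ‖g x‖ ^ 2 + ‖trig A (fc g) x‖ ^ 2 -
      2 * ((starRingEnd ℂ) (trig A (fc g) x) * g x).re := by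
    intro x
    simp only [← Complex.normSq_eq_norm_sq, Complex.normSq_apply, Complex.mul_re, Complex.conj_re,
      Complex.conj_im, Complex.sub_re, Complex.sub_im]
    ring
  simp only [e] at h0
  have hi : IntegrableOn (fun x => (starRingEnd ℂ) (trig A (fc g) x) * g x) T3 :=
    T3_integrable (by fun_prop)
  have e1 : ∫ x in T3, ((starRingEnd ℂ) (trig A (fc g) x) * g x).re =
      (2 * Real.pi) ^ 3 * ∑ k ∈ A, ‖fc g k‖ ^ 2 := by
    have h1 := integral_re hi
    simp only [RCLike.re_eq_complex_re] at h1
    rw [h1, setIntegral_conj_trig_mul A _ hg]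
    have e2 : ∑ l ∈ A, (starRingEnd ℂ) (fc g l) * fc g l =
        ((∑ l ∈ A, ‖fc g l‖ ^ 2 : ℝ) : ℂ) := by
      push_cast
      exact Finset.sum_congr rfl fun l hl => by rw [Complex.conj_mul']
    rw [e2, ← Complex.ofReal_mul, Complex.ofReal_re]
  rw [integral_sub (T3_integrable (by fun_prop)) (T3_integrable (by fun_prop)),
    integral_add (T3_integrable (by fun_prop)) (T3_integrable (by fun_prop)),
    integral_const_mul, e1, setIntegral_norm_trig_sq] at h0
  linarith

lemma setIntegral_re_syn_sq_le {a : K3 → ℝ → ℂ} {t B : ℝ} (ha : Summable fun k => ‖a k t‖)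
    (hB : ∀ s : Finset K3, ∑ k ∈ s, ‖a k t‖ ^ 2 ≤ B) :
    ∫ x in T3, (syn a x t).re ^ 2 ≤ (2 * Real.pi) ^ 3 * B := by
  have hlim : ∀ x, Filter.Tendsto (fun s => trig s (fun k => a k t) x) Filter.atTop
      (nhds (syn a x t)) := by
    intro x
    have : Summable fun k => a k t * ek k x := by
      refine Summable.of_norm (ha.congr fun k => ?_)
      rw [norm_mul, norm_ek, mul_one]
    exact this.hasSum
  have h := tendsto_integral_filter_of_dominated_convergence (μ := volume.restrict T3)
    (l := (Filter.atTop : Filter (Finset K3)))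
    (F := fun s x => (trig s (fun k => a k t) x).re ^ 2) (f := fun x => (syn a x t).re ^ 2)
    (fun _ => (∑' k, ‖a k t‖) ^ 2)
    (Filter.Eventually.of_forall fun s => by
      have := continuous_trig s (fun k => a k t)
      exact ((Complex.continuous_re.comp this).pow 2).aestronglyMeasurable)
    (Filter.Eventually.of_forall fun s => Filter.Eventually.of_forall fun x => by
      rw [norm_pow]
      gcongr
      refine (Complex.abs_re_le_norm _).trans ((norm_sum_le _ _).trans ?_)
      simp only [norm_mul, norm_ek, mul_one]
      exact ha.sum_le_tsum s fun _ _ => norm_nonneg _)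
    (T3_integrable continuous_const)
    (Filter.Eventually.of_forall fun x =>
      (((Complex.continuous_re.tendsto _).comp (hlim x)).pow 2))
  refine le_of_tendsto h (Filter.Eventually.of_forall fun s => ?_)
  have hc := continuous_trig s (fun k => a k t)
  calc ∫ x in T3, (trig s (fun k => a k t) x).re ^ 2
      ≤ ∫ x in T3, ‖trig s (fun k => a k t) x‖ ^ 2 := by
        refine integral_mono (T3_integrable (by fun_prop)) (T3_integrable (by fun_prop)) fun x => ?_
        beta_reduce
        rw [← sq_abs]
        gcongr
        exact Complex.abs_re_le_norm _
    _ = (2 * Real.pi) ^ 3 * ∑ l ∈ s, ‖a l t‖ ^ 2 := setIntegral_norm_trig_sq _ _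
    _ ≤ _ := by have := cell_pos; gcongr; exact hB s

/-- The function on the unit torus induced by a periodic function. -/
def torusLift (f : E3 → ℂ) (z : UnitAddTorus (Fin 3)) : ℂ :=
  f ((2 * Real.pi) • fun i => ((AddCircle.equivIco (1 : ℝ) 0 (z i)).1 : ℝ))

lemma torusLift_coe {f : E3 → ℂ} (hf : SpacePeriodic f) (y : E3) :
    torusLift f (fun i => (y i : UnitAddCircle)) = f ((2 * Real.pi) • y) := by
  have h : ∀ i, ∃ n : ℤ, ((AddCircle.equivIco (1 : ℝ) 0 (y i : UnitAddCircle)).1 : ℝ) = y i + n := by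
    intro i
    have h1 : (((AddCircle.equivIco (1 : ℝ) 0 (y i : UnitAddCircle)).1 : ℝ) : UnitAddCircle) =
      (y i : UnitAddCircle) := AddCircle.coe_equivIco
    rw [← sub_eq_zero, ← AddCircle.coe_sub, AddCircle.coe_eq_zero_iff] at h1
    obtain ⟨n, hn⟩ := h1
    exact ⟨n, by rw [zsmul_eq_mul, mul_one] at hn; linarith⟩
  choose n hn using h
  rw [torusLift, ← periodic_lattice hf n ((2 * Real.pi) • y)]
  congr 1
  ext i
  simp [hn, mul_add]

lemma continuous_torusLift {f : E3 → ℂ} (hf : SpacePeriodic f) (hc : Continuous f) :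
    Continuous (torusLift f) := by
  have hq : IsOpenQuotientMap (Pi.map fun (_ : Fin 3) (y : ℝ) => (y : UnitAddCircle)) :=
    IsOpenQuotientMap.piMap fun _ => QuotientAddGroup.isOpenQuotientMap_mk
  rw [← hq.continuous_comp_iff]
  have : torusLift f ∘ (Pi.map fun (_ : Fin 3) (y : ℝ) => (y : UnitAddCircle)) =
      fun y => f ((2 * Real.pi) • y) := funext fun y => torusLift_coe hf y
  rw [this]
  fun_prop

lemma mFourier_coe (k : K3) (y : E3) :
    UnitAddTorus.mFourier k (fun i => (y i : UnitAddCircle)) = ek k ((2 * Real.pi) • y) := by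
  simp only [UnitAddTorus.mFourier, ContinuousMap.coe_mk, fourier_coe_apply]
  rw [ek, ← Complex.exp_sum]
  congr 1
  simp [dotk, Finset.sum_mul]
  exact Finset.sum_congr rfl fun j _ => by ring

lemma mFourierCoeff_torusLift {f : E3 → ℂ} (hf : SpacePeriodic f) (k : K3) :
    UnitAddTorus.mFourierCoeff (torusLift f) k = fc f k := by
  rw [UnitAddTorus.mFourierCoeff_eq_integral _ _ 0]
  simp only [torusLift_coe hf, mFourier_coe]
  have hs : {x : Fin 3 → ℝ | ∀ i, x i ∈ Ioc ((0 : Fin 3 → ℝ) i) ((0 : Fin 3 → ℝ) i + 1)} =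
      Set.pi univ fun i => Ioc ((0 : Fin 3 → ℝ) i) ((fun _ => 1 : Fin 3 → ℝ) i) := by
    ext x; simp
  rw [hs, volume_pi, setIntegral_congr_set Measure.univ_pi_Ioc_ae_eq_Icc, ← volume_pi]
  rw [Measure.setIntegral_comp_smul_of_pos volume (fun x => ek (-k) x • f x) _
    (by positivity : (0 : ℝ) < 2 * Real.pi)]
  have h2 : (0 : ℝ) < 2 * Real.pi := by positivity
  have hT : (2 * Real.pi) • Icc (0 : Fin 3 → ℝ) (fun _ => 1) = T3 := by
    ext x
    rw [Set.mem_smul_set_iff_inv_smul_mem₀ h2.ne', T3_eq]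
    simp only [mem_Icc, Pi.le_def, Pi.smul_apply, smul_eq_mul, Pi.zero_apply,
      le_inv_mul_iff₀ h2, inv_mul_le_iff₀ h2, mul_zero, mul_one]
  rw [hT, fc]
  simp

lemma fourier_inversion {f : E3 → ℂ} (hf : SpacePeriodic f) (hc : Continuous f)
    (hs : Summable (fc f)) (x : E3) : f x = ∑' k, fc f k * ek k x := by
  have e : UnitAddTorus.mFourierCoeff (torusLift f) = fc f := funext (mFourierCoeff_torusLift hf)
  have h := UnitAddTorus.hasSum_mFourier_series_apply_of_summable
    (f := ⟨torusLift f, continuous_torusLift hf hc⟩) (by simpa [e] using hs)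
    (fun i => (((2 * Real.pi)⁻¹ • x) i : UnitAddCircle))
  simp only [ContinuousMap.coe_mk, e, mFourier_coe, torusLift_coe hf, smul_eq_mul] at h
  rw [smul_smul, mul_inv_cancel₀ (by positivity), one_smul] at h
  exact h.tsum_eq.symm

end NSF

namespace NSF

/-- Smooth space-periodic functions on the space-time domain. -/
def Sp (f : E3 → ℝ → ℝ) : Prop :=
  SmoothOnTimeS f (Ici 0) ∧ ∀ t, 0 ≤ t → SpacePeriodic fun x => f x t

/-- Spatial derivative. -/
def dx (j : Fin 3) (f : E3 → ℝ → ℝ) : E3 → ℝ → ℝ := fun x t => pd j (fun y => f y t) x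

/-- Time derivative on the half line. -/
def dt (f : E3 → ℝ → ℝ) : E3 → ℝ → ℝ := fun x t => derivWithin (fun τ => f x τ) (Ici 0) t

/-- Space-time derivative. -/
def dst (f : E3 → ℝ → ℝ) (p : E3 × ℝ) : E3 × ℝ →L[ℝ] ℝ :=
  fderivWithin ℝ (fun p : E3 × ℝ => f p.1 p.2) dom p

variable {f g : E3 → ℝ → ℝ}

lemma mem_dom {x : E3} {t : ℝ} (ht : 0 ≤ t) : (x, t) ∈ dom := ⟨mem_univ _, ht⟩

lemma Sp.contDiffOn (h : Sp f) : ContDiffOn ℝ (⊤ : ℕ∞) (fun p : E3 × ℝ => f p.1 p.2) dom := h.1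

lemma Sp.hasFDerivWithinAt (h : Sp f) {x : E3} {t : ℝ} (ht : 0 ≤ t) :
    HasFDerivWithinAt (fun p : E3 × ℝ => f p.1 p.2) (dst f (x, t)) dom (x, t) :=
  ((h.contDiffOn.differentiableOn (by simp)) _ (mem_dom ht)).hasFDerivWithinAt

lemma Sp.contDiffOn_dst (h : Sp f) : ContDiffOn ℝ (⊤ : ℕ∞) (dst f) dom :=
  h.contDiffOn.fderivWithin uniqueDiffOn_dom (by simp)

lemma Sp.hasFDerivAt (h : Sp f) {t : ℝ} (ht : 0 ≤ t) (x : E3) :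
    HasFDerivAt (fun y => f y t) ((dst f (x, t)).comp (ContinuousLinearMap.inl ℝ E3 ℝ)) x := by
  have h3 : HasFDerivAt (fun y : E3 => (y, t)) (ContinuousLinearMap.inl ℝ E3 ℝ) x :=
    hasFDerivAt_prodMk_left x t
  have h4 := HasFDerivWithinAt.comp (s := univ) (t := dom) x (h.hasFDerivWithinAt ht)
    h3.hasFDerivWithinAt (fun y _ => mem_dom ht)
  rwa [hasFDerivWithinAt_univ] at h4

lemma Sp.dx_eq (h : Sp f) {t : ℝ} (ht : 0 ≤ t) (j : Fin 3) (x : E3) :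
    dx j f x t = dst f (x, t) (Pi.single j 1, 0) := by
  rw [NSF.dx, pd, (h.hasFDerivAt ht x).fderiv]
  simp

lemma Sp.hasDerivWithinAt (h : Sp f) {t : ℝ} (ht : 0 ≤ t) (x : E3) :
    HasDerivWithinAt (fun τ => f x τ) (dt f x t) (Ici 0) t := by
  have h3 : HasFDerivAt (fun τ : ℝ => (x, τ)) (ContinuousLinearMap.inr ℝ E3 ℝ) t :=
    hasFDerivAt_prodMk_right x t
  have h4 := HasFDerivWithinAt.comp (s := Ici 0) (t := dom) t (h.hasFDerivWithinAt ht)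
    h3.hasFDerivWithinAt (fun τ hτ => mem_dom hτ)
  exact h4.differentiableWithinAt.hasDerivWithinAt

lemma Sp.dt_eq (h : Sp f) {t : ℝ} (ht : 0 ≤ t) (x : E3) :
    dt f x t = dst f (x, t) (0, 1) := by
  have h3 : HasFDerivAt (fun τ : ℝ => (x, τ)) (ContinuousLinearMap.inr ℝ E3 ℝ) t :=
    hasFDerivAt_prodMk_right x t
  have h4 := HasFDerivWithinAt.comp (s := Ici 0) (t := dom) t (h.hasFDerivWithinAt ht)
    h3.hasFDerivWithinAt (fun τ hτ => mem_dom hτ)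
  have h5 := h4.hasDerivWithinAt.derivWithin (uniqueDiffOn_Ici 0 t ht)
  rw [NSF.dt]
  refine Eq.trans h5 ?_
  simp

lemma periodic_pd {f : E3 → ℝ} (h : SpacePeriodic f) (j : Fin 3) : SpacePeriodic (pd j f) := by
  intro x i
  have e : (fun y => f (y + (2 * Real.pi) • (Pi.single i 1 : E3))) = f := funext fun y => h y i
  rw [pd, pd, ← fderiv_comp_add_right, e]

lemma Sp.dx (h : Sp f) (j : Fin 3) : Sp (dx j f) := by
  refine ⟨?_, fun t ht => periodic_pd (h.2 t ht) j⟩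
  have h1 : ContDiffOn ℝ (⊤ : ℕ∞) (fun p => dst f p (Pi.single j 1, 0)) dom :=
    h.contDiffOn_dst.clm_apply contDiffOn_const
  exact h1.congr fun p hp => h.dx_eq hp.2 j p.1

lemma Sp.dt (h : Sp f) : Sp (dt f) := by
  refine ⟨?_, fun t ht x j => ?_⟩
  · have h1 : ContDiffOn ℝ (⊤ : ℕ∞) (fun p => dst f p (0, 1)) dom :=
      h.contDiffOn_dst.clm_apply contDiffOn_const
    exact h1.congr fun p hp => h.dt_eq hp.2 p.1
  · exact derivWithin_congr (fun τ hτ => h.2 τ hτ x j) (h.2 t ht x j)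

lemma Sp.continuous (h : Sp f) {t : ℝ} (ht : 0 ≤ t) : Continuous fun x => f x t :=
  continuous_iff_continuousAt.2 fun x => (h.hasFDerivAt ht x).continuousAt

lemma Sp.bound (h : Sp f) (T : ℝ) : ∃ B, 0 ≤ B ∧ ∀ t ∈ Icc 0 T, ∀ x, |f x t| ≤ B := by
  have hK : IsCompact (T3 ×ˢ Icc 0 T) := isCompact_T3.prod isCompact_Icc
  obtain ⟨B, hB⟩ := hK.exists_bound_of_continuousOn
    (h.contDiffOn.continuousOn.mono (t := T3 ×ˢ Icc 0 T) fun p hp => ⟨mem_univ _, hp.2.1⟩)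
  refine ⟨|B|, abs_nonneg _, fun t ht x => ?_⟩
  obtain ⟨y, hy, hyx⟩ := periodic_exists_T3 (h.2 t ht.1) x
  rw [← hyx]
  exact (hB (y, t) ⟨hy, ht⟩).trans (le_abs_self _)

/-- Fourier coefficients of a real function of space and time. -/
def Fc (f : E3 → ℝ → ℝ) (k : K3) (t : ℝ) : ℂ := fc (fun x => (f x t : ℂ)) k

lemma Sp.Fc_dx (h : Sp f) {t : ℝ} (ht : 0 ≤ t) (j : Fin 3) (k : K3) :
    Fc (NSF.dx j f) k t = (k j : ℂ) * Complex.I * Fc f k t := by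
  have h1 : ∀ x, HasFDerivAt (fun y => (f y t : ℂ)) (Complex.ofRealCLM.comp
      ((dst f (x, t)).comp (ContinuousLinearMap.inl ℝ E3 ℝ))) x := fun x =>
    Complex.ofRealCLM.hasFDerivAt.comp x (h.hasFDerivAt ht x)
  have e : (fun x => (Complex.ofRealCLM.comp ((dst f (x, t)).comp
      (ContinuousLinearMap.inl ℝ E3 ℝ))) (Pi.single j 1 : E3)) =
      fun x => (NSF.dx j f x t : ℂ) := by
    funext x
    rw [h.dx_eq ht]
    simp
  have h2 := fc_fderiv h1 (fun x i => congrArg Complex.ofReal (h.2 t ht x i)) j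
    (by rw [e]; exact Complex.continuous_ofReal.comp ((h.dx j).continuous ht)) k
  rw [e] at h2
  exact h2

lemma Sp.dec_Fc_aux (T : ℝ) (m : ℕ) : ∀ f, Sp f → ∃ C : ℝ, ∀ t ∈ Icc 0 T, ∀ k,
    wt k ^ m * ‖Fc f k t‖ ≤ C := by
  induction m with
  | zero =>
    intro f h
    obtain ⟨B, hB0, hB⟩ := h.bound T
    refine ⟨B, fun t ht k => ?_⟩
    rw [pow_zero, one_mul]
    refine norm_fc_le (fun x _ => ?_) k
    rw [Complex.norm_real]
    exact hB t ht x
  | succ m ih =>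
    intro f h
    obtain ⟨C0, hC0⟩ := ih f h
    choose C hC using fun j => ih _ ((h.dx j).dx j)
    refine ⟨C0 + ∑ j, C j, fun t ht k => ?_⟩
    have e : ∀ j, ((k j : ℝ) ^ 2) * ‖Fc f k t‖ = ‖Fc (NSF.dx j (NSF.dx j f)) k t‖ := by
      intro j
      rw [(h.dx j).Fc_dx ht.1, h.Fc_dx ht.1]
      simp only [norm_mul, Complex.norm_I, Complex.norm_intCast, mul_one]
      rw [← sq_abs]; ring
    calc wt k ^ (m + 1) * ‖Fc f k t‖
        = wt k ^ m * ‖Fc f k t‖ + ∑ j, wt k ^ m * ((k j : ℝ) ^ 2 * ‖Fc f k t‖) := by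
          rw [← Finset.mul_sum, ← Finset.sum_mul, pow_succ, wt, lam]; ring
      _ ≤ _ := by
          refine add_le_add (hC0 t ht k) (Finset.sum_le_sum fun j _ => ?_)
          rw [e]; exact hC j t ht k

lemma Sp.dec_Fc (h : Sp f) : Dec (Fc f) := fun T m => Sp.dec_Fc_aux T m f h

lemma Sp.ofReal_hasDerivWithinAt (h : Sp f) {T t : ℝ} (ht : t ∈ Icc 0 T) (x : E3) :
    HasDerivWithinAt (fun τ => (f x τ : ℂ)) (NSF.dt f x t : ℂ) (Icc 0 T) t :=
  ((h.hasDerivWithinAt ht.1 x).mono fun _ hτ => hτ.1).ofReal_comp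

lemma lip_of_deriv {F G : ℝ → ℂ} {T B : ℝ}
    (hF : ∀ t ∈ Icc 0 T, HasDerivWithinAt F (G t) (Icc 0 T) t) (hG : ∀ t ∈ Icc 0 T, ‖G t‖ ≤ B)
    {s t : ℝ} (hs : s ∈ Icc 0 T) (ht : t ∈ Icc 0 T) : ‖F t - F s‖ ≤ B * |t - s| :=
  (convex_Icc 0 T).norm_image_sub_le_of_norm_hasDerivWithin_le hF hG hs ht

lemma Sp.Fc_taylor (h : Sp f) (T : ℝ) : ∃ B, ∀ s ∈ Icc 0 T, ∀ t ∈ Icc 0 T, ∀ k,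
    ‖Fc f k t - Fc f k s - (t - s : ℝ) * Fc (NSF.dt f) k s‖ ≤ B * |t - s| ^ 2 := by
  obtain ⟨B, hB0, hB⟩ := h.dt.dt.bound T
  refine ⟨|B|, fun s hs t ht k => ?_⟩
  have c1 := Complex.continuous_ofReal.comp (h.continuous ht.1)
  have c2 := Complex.continuous_ofReal.comp (h.continuous hs.1)
  have c3 := Complex.continuous_ofReal.comp (h.dt.continuous hs.1)
  have e : Fc f k t - Fc f k s - (t - s : ℝ) * Fc (NSF.dt f) k s =
      fc (fun x => (f x t : ℂ) - f x s - (t - s : ℝ) * NSF.dt f x s) k := by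
    rw [fc_sub (f := fun x => (f x t : ℂ) - f x s) (g := fun x => (t - s : ℝ) * NSF.dt f x s)
      (c1.sub c2) (continuous_const.mul c3), fc_const_mul,
      fc_sub (f := fun x => (f x t : ℂ)) (g := fun x => (f x s : ℂ)) c1 c2]
    rfl
  rw [e]
  refine norm_fc_le (fun x _ => ?_) k
  refine taylor_of_lip (fun τ hτ => h.ofReal_hasDerivWithinAt hτ x) (fun s hs t ht => ?_) hs ht
  refine lip_of_deriv (fun τ hτ => h.dt.ofReal_hasDerivWithinAt hτ x) (fun τ hτ => ?_) hs ht
  rw [Complex.norm_real]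
  exact hB τ hτ x

lemma hasDerivWithinAt_of_taylor {F G : ℝ → ℂ} {T B : ℝ}
    (h : ∀ s ∈ Icc 0 T, ∀ t ∈ Icc 0 T, ‖F t - F s - (t - s : ℝ) * G s‖ ≤ B * |t - s| ^ 2)
    {s : ℝ} (hs : s ∈ Icc 0 T) : HasDerivWithinAt F (G s) (Icc 0 T) s := by
  rw [hasDerivWithinAt_iff_isLittleO]
  refine Asymptotics.IsBigO.trans_isLittleO (g := fun t : ℝ => (t - s) ^ 2) ?_ ?_
  · refine Asymptotics.IsBigO.of_bound B ?_
    filter_upwards [self_mem_nhdsWithin] with t ht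
    rw [norm_pow, Real.norm_eq_abs]
    simpa using h s hs t ht
  · have h0 : (fun t : ℝ => t - s) =o[nhds s] fun _ => (1 : ℝ) := by
      rw [Asymptotics.isLittleO_one_iff]
      have : Continuous fun t : ℝ => t - s := by fun_prop
      simpa using this.tendsto s
    have := (h0.mono nhdsWithin_le_nhds).mul_isBigO
      (Asymptotics.isBigO_refl (fun t : ℝ => t - s) (nhdsWithin s (Icc 0 T)))
    simpa [← sq] using this

lemma Sp.Fc_hasDerivWithinAt (h : Sp f) {T t : ℝ} (ht : t ∈ Icc 0 T) (k : K3) :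
    HasDerivWithinAt (Fc f k) (Fc (NSF.dt f) k t) (Icc 0 T) t := by
  obtain ⟨B, hB⟩ := h.Fc_taylor T
  exact hasDerivWithinAt_of_taylor (F := Fc f k) (G := Fc (NSF.dt f) k)
    (fun s hs t ht => hB s hs t ht k) ht

lemma Sp.d1_Fc (h : Sp f) : D1 (Fc f) (Fc (NSF.dt f)) := by
  intro T m
  obtain ⟨C, hC⟩ := h.dt.dt.dec_Fc T m
  refine ⟨|C|, fun s hs t ht k => ?_⟩
  have hw : 0 < wt k ^ m := pow_pos (wt_pos k) m
  have := taylor_of_lip (L := C / wt k ^ m) (fun τ hτ => h.Fc_hasDerivWithinAt hτ k)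
    (fun s hs t ht => lip_of_deriv (fun τ hτ => h.dt.Fc_hasDerivWithinAt hτ k)
      (fun τ hτ => by rw [le_div_iff₀ hw, mul_comm]; exact hC τ hτ k) hs ht) hs ht
  rw [abs_div, abs_of_pos hw] at this
  calc _ ≤ _ := mul_le_mul_of_nonneg_left this hw.le
    _ = _ := by field_simp

lemma Sp.sm_Fc (n : ℕ) : ∀ f, Sp f → SM n (Fc f) := by
  induction n with
  | zero => exact fun f h => h.dec_Fc
  | succ n ih => exact fun f h => ⟨h.dec_Fc, _, h.d1_Fc, ih _ h.dt⟩

lemma Sp.Fc_neg (f : E3 → ℝ → ℝ) (k : K3) (t : ℝ) :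
    Fc f (-k) t = (starRingEnd ℂ) (Fc f k t) :=
  fc_conj _ (fun _ => Complex.conj_ofReal _) k

lemma Sp.eq_syn (h : Sp f) {t : ℝ} (ht : 0 ≤ t) (x : E3) : (f x t : ℂ) = syn (Fc f) x t := by
  refine fourier_inversion (f := fun x => (f x t : ℂ)) (fun x i => congrArg Complex.ofReal (h.2 t ht x i))
    (Complex.continuous_ofReal.comp (h.continuous ht)) ?_ x
  obtain ⟨C, hC⟩ := h.dec_Fc t 2
  exact (summable_of_wt fun k => hC t ⟨ht, le_rfl⟩ k).of_norm

end NSF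

namespace NSF

variable {f : E3 → ℝ → ℝ}

/-- Iterated mixed spatial derivatives. -/
def dxM (β : Fin 3 → ℕ) (f : E3 → ℝ → ℝ) : E3 → ℝ → ℝ :=
  (dx 0)^[β 0] ((dx 1)^[β 1] ((dx 2)^[β 2] f))

lemma iterate_pd (j : Fin 3) (n : ℕ) : ∀ (f : E3 → ℝ → ℝ) (t : ℝ),
    (pd j)^[n] (fun y => f y t) = fun x => (dx j)^[n] f x t := by
  induction n with
  | zero => intro f t; rfl
  | succ n ih =>
    intro f t
    rw [Function.iterate_succ_apply, Function.iterate_succ_apply, ← ih]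
    rfl

lemma pdM_eq (β : Fin 3 → ℕ) (f : E3 → ℝ → ℝ) (t : ℝ) :
    pdM β (fun y => f y t) = fun x => dxM β f x t := by
  rw [pdM, iterate_pd, iterate_pd, iterate_pd]
  rfl

lemma Sp.iterate (h : Sp f) (j : Fin 3) (n : ℕ) : Sp ((NSF.dx j)^[n] f) := by
  induction n with
  | zero => exact h
  | succ n ih => rw [Function.iterate_succ_apply']; exact ih.dx j

lemma Sp.dxM (h : Sp f) (β : Fin 3 → ℕ) : Sp (dxM β f) :=
  ((h.iterate 2 _).iterate 1 _).iterate 0 _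

lemma Sp.Fc_iterate (h : Sp f) {t : ℝ} (ht : 0 ≤ t) (j : Fin 3) (n : ℕ) (k : K3) :
    Fc ((NSF.dx j)^[n] f) k t = ((k j : ℂ) * Complex.I) ^ n * Fc f k t := by
  induction n with
  | zero => simp
  | succ n ih =>
    rw [Function.iterate_succ_apply', (h.iterate j n).Fc_dx ht, ih]; ring

lemma pdM_single (a : Fin 3) (p : ℕ) (f : E3 → ℝ) : pdM (Pi.single a p) f = (pd a)^[p] f := by
  fin_cases a <;> simp [pdM]

lemma single_mem_midx (a : Fin 3) (p : ℕ) : (Pi.single a p : Fin 3 → ℕ) ∈ midx p := by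
  rw [midx, Finset.Nat.mem_antidiagonalTuple]
  simp

lemma gradSq_nonneg {ι : Type*} [Fintype ι] (p : ℕ) (u : E3 → ι → ℝ) (x : E3) :
    0 ≤ gradSq p u x := Finset.sum_nonneg fun _ _ => Finset.sum_nonneg fun _ _ => sq_nonneg _

lemma sq_pdM_le_gradSq {ι : Type*} [Fintype ι] (u : E3 → ι → ℝ) (i : ι) {p : ℕ} {β : Fin 3 → ℕ}
    (hβ : β ∈ midx p) (x : E3) : (pdM β (fun y => u y i) x) ^ 2 ≤ gradSq p u x :=
  (Finset.single_le_sum (f := fun β => (pdM β (fun y => u y i) x) ^ 2)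
    (fun _ _ => sq_nonneg _) hβ).trans
    (Finset.single_le_sum (f := fun i => ∑ β ∈ midx p, (pdM β (fun y => u y i) x) ^ 2)
      (fun _ _ => Finset.sum_nonneg fun _ _ => sq_nonneg _) (Finset.mem_univ i))

lemma Fc_mul_trig {t : ℝ} (ht : 0 ≤ t) (h : Sp f) (B : Finset K3) (b : K3 → ℂ) (k : K3) :
    fc (fun x => f x t * trig B b x) k = ∑ l ∈ B, Fc f (k - l) t * b l := by
  have hc : Continuous fun x => (f x t : ℂ) := Complex.continuous_ofReal.comp (h.continuous ht)
  simp only [trig, Finset.mul_sum]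
  rw [fc_sum B (f := fun l x => (f x t : ℂ) * (b l * ek l x))
    fun l _ => hc.mul (continuous_const.mul (continuous_ek l))]
  refine Finset.sum_congr rfl fun l _ => ?_
  have e : ∀ x, (f x t : ℂ) * (b l * ek l x) = b l * (ek l x * f x t) := fun x => by ring
  simp only [e]
  rw [fc_const_mul, mul_comm]
  congr 1
  simp only [Fc, fc]
  congr 1
  refine integral_congr_ae (Filter.Eventually.of_forall fun x => ?_)
  beta_reduce
  rw [← mul_assoc, ← ek_add_left]
  congr 2
  abel

lemma sum_norm_conv_le {t : ℝ} (ht : 0 ≤ t) (h : Sp f) {M : ℝ} (hM : ∀ x, |f x t| ≤ M)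
    (A B : Finset K3) (b : K3 → ℂ) :
    ∑ k ∈ A, ‖∑ l ∈ B, Fc f (k - l) t * b l‖ ^ 2 ≤ M ^ 2 * ∑ l ∈ B, ‖b l‖ ^ 2 := by
  have hc : Continuous fun x => (f x t : ℂ) := Complex.continuous_ofReal.comp (h.continuous ht)
  have hq := continuous_trig B b
  have h1 := bessel (g := fun x => (f x t : ℂ) * trig B b x) (hc.mul hq) A
  have h2 : ∫ x in T3, ‖(f x t : ℂ) * trig B b x‖ ^ 2 ≤ ∫ x in T3, M ^ 2 * ‖trig B b x‖ ^ 2 := by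
    refine integral_mono (T3_integrable (by fun_prop)) (T3_integrable (by fun_prop)) fun x => ?_
    beta_reduce
    rw [norm_mul, mul_pow, Complex.norm_real]
    gcongr
    exact hM x
  rw [integral_const_mul, setIntegral_norm_trig_sq] at h2
  simp only [Fc_mul_trig ht h] at h1
  have := cell_pos
  have h3 := h1.trans h2
  refine le_of_mul_le_mul_left ?_ this
  linarith

section Background

variable (w : E3 → ℝ → E3)

/-- Components of the background flow, frozen for negative times. -/
def wc (i : Fin 3) (x : E3) (t : ℝ) : ℝ := w x (max t 0) i

/-- Fourier coefficients of the background flow. -/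
def Wf (i : Fin 3) : K3 → ℝ → ℂ := Fc (wc w i)

/-- Sup norms of the derivatives of the background flow. -/
def Mf (p : ℕ) (t : ℝ) : ℝ := wNormInf p w (max t 0)

variable {w}

lemma sp_wc (hw : SmoothOnTime w (Ici 0)) (hp : ∀ t, SpacePeriodic fun x => w x t) (i : Fin 3) :
    Sp (wc w i) := by
  refine ⟨?_, fun t _ x j => congrFun (hp (max t 0) x j) i⟩
  have h1 : ContDiffOn ℝ (⊤ : ℕ∞) (fun p : E3 × ℝ => w p.1 p.2 i) dom := contDiffOn_pi.1 hw i
  refine h1.congr fun p hp => ?_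
  rw [wc, max_eq_left hp.2]

lemma gradSq_eq (p : ℕ) (t : ℝ) (x : E3) :
    gradSq p (fun y => w y (max t 0)) x = ∑ i, ∑ β ∈ midx p, dxM β (wc w i) x t ^ 2 := by
  unfold gradSq
  refine Finset.sum_congr rfl fun i _ => Finset.sum_congr rfl fun β _ => ?_
  have := congrFun (pdM_eq β (wc w i) t) x
  rw [← this]
  rfl

lemma wc_max (i : Fin 3) (x : E3) (t : ℝ) : wc w i x (max t 0) = wc w i x t := by
  simp [wc]

lemma iterate_dx_max (j : Fin 3) (n : ℕ) (g : E3 → ℝ → ℝ) (hg : ∀ x t, g x (max t 0) = g x t) :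
    ∀ x t, (dx j)^[n] g x (max t 0) = (dx j)^[n] g x t := by
  intro x t
  rw [← congrFun (iterate_pd j n g t) x, ← congrFun (iterate_pd j n g (max t 0)) x]
  simp only [hg]

lemma dxM_max (β : Fin 3 → ℕ) (i : Fin 3) (x : E3) (t : ℝ) :
    dxM β (wc w i) x (max t 0) = dxM β (wc w i) x t :=
  iterate_dx_max 0 _ _ (iterate_dx_max 1 _ _ (iterate_dx_max 2 _ _ (wc_max i))) x t

lemma continuous_of_max {g : E3 → ℝ → ℝ} (h : Sp g) (hg : ∀ x t, g x (max t 0) = g x t) :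
    Continuous fun p : E3 × ℝ => g p.1 p.2 := by
  have h1 : Continuous fun p : E3 × ℝ => g p.1 (max p.2 0) :=
    h.contDiffOn.continuousOn.comp_continuous (f := fun p : E3 × ℝ => (p.1, max p.2 0))
      (by fun_prop) fun p => ⟨mem_univ _, mem_Ici.2 (le_max_right _ _)⟩
  simpa only [hg] using h1

lemma continuous_gradSq (hw : SmoothOnTime w (Ici 0)) (hp : ∀ t, SpacePeriodic fun x => w x t)
    (p : ℕ) :
    Continuous fun q : E3 × ℝ => gradSq p (fun y => w y (max q.2 0)) q.1 := by
  simp only [gradSq_eq]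
  refine continuous_finsetSum _ fun i _ => continuous_finsetSum _ fun β _ => ?_
  exact (continuous_of_max ((sp_wc hw hp i).dxM β) (dxM_max β i)).pow 2

lemma periodic_gradSq (hw : SmoothOnTime w (Ici 0)) (hp : ∀ t, SpacePeriodic fun x => w x t)
    (p : ℕ) (t : ℝ) :
    SpacePeriodic fun x => gradSq p (fun y => w y (max t 0)) x := by
  intro x j
  have h : ∀ i β, SpacePeriodic (pdM β (fun y => w y (max t 0) i)) := by
    intro i β x j
    have := ((sp_wc hw hp i).dxM β).2 (max t 0) (le_max_right _ _) x j
    have e := pdM_eq β (wc w i) (max t 0)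
    simp only [wc_max] at e
    have e2 : pdM β (fun y => w y (max t 0) i) = fun x => dxM β (wc w i) x (max t 0) := e
    rw [e2]
    exact this
  simp only [gradSq]
  refine Finset.sum_congr rfl fun i _ => Finset.sum_congr rfl fun β _ => ?_
  rw [h i β x j]

lemma range_eq_image (hw : SmoothOnTime w (Ici 0)) (hp : ∀ t, SpacePeriodic fun x => w x t)
    (p : ℕ) (t : ℝ) :
    range (fun x => √(gradSq p (fun y => w y (max t 0)) x)) =
      (fun x => √(gradSq p (fun y => w y (max t 0)) x)) '' T3 := by
  refine Subset.antisymm ?_ (image_subset_range _ _)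
  rintro _ ⟨x, rfl⟩
  obtain ⟨y, hy, hyx⟩ := periodic_exists_T3 (periodic_gradSq hw hp p t) x
  exact ⟨y, hy, congrArg Real.sqrt hyx⟩

lemma continuous_Mf (hw : SmoothOnTime w (Ici 0)) (hp : ∀ t, SpacePeriodic fun x => w x t)
    (p : ℕ) : Continuous (Mf w p) := by
  have hc := continuous_gradSq hw hp p
  have hc2 : Continuous fun q : ℝ × E3 => √(gradSq p (fun y => w y (max q.1 0)) q.2) :=
    (Continuous.comp (g := fun q : E3 × ℝ => gradSq p (fun y => w y (max q.2 0)) q.1)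
      (f := Prod.swap) hc continuous_swap).sqrt
  have h := isCompact_T3.continuous_sSup
    (f := fun (t : ℝ) x => √(gradSq p (fun y => w y (max t 0)) x)) hc2
  refine h.congr fun t => ?_
  rw [← range_eq_image hw hp]
  rfl

lemma sqrt_gradSq_le_Mf (hw : SmoothOnTime w (Ici 0)) (hp : ∀ t, SpacePeriodic fun x => w x t)
    (p : ℕ) (t : ℝ) (x : E3) :
    √(gradSq p (fun y => w y (max t 0)) x) ≤ Mf w p t := by
  refine le_ciSup (f := fun x => √(gradSq p (fun y => w y (max t 0)) x)) ?_ x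
  rw [range_eq_image hw hp]
  have hc : Continuous fun x => gradSq p (fun y => w y (max t 0)) x :=
    Continuous.comp (g := fun q : E3 × ℝ => gradSq p (fun y => w y (max q.2 0)) q.1)
      (f := fun x => (x, t)) (continuous_gradSq hw hp p) (by fun_prop)
  exact (isCompact_T3.image hc.sqrt).bddAbove

lemma convBd_Wf (hw : SmoothOnTime w (Ici 0)) (hp : ∀ t, SpacePeriodic fun x => w x t)
    (p : ℕ) {t : ℝ} (ht : 0 ≤ t) : ConvBd (fun i k => Wf w i k t) p (Mf w p t) := by
  intro i a A B b
  have hS := sp_wc hw hp i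
  have hF := hS.iterate a p
  have hM : ∀ x, |(dx a)^[p] (wc w i) x t| ≤ Mf w p t := by
    intro x
    refine le_trans (Real.abs_le_sqrt ?_) (sqrt_gradSq_le_Mf hw hp p t x)
    refine le_trans (le_of_eq ?_)
      (sq_pdM_le_gradSq (fun y => w y (max t 0)) i (single_mem_midx a p) x)
    rw [pdM_single, ← congrFun (iterate_pd a p (wc w i) t) x]
    rfl
  refine le_trans (le_of_eq ?_) (sum_norm_conv_le ht hF hM A B b)
  refine Finset.sum_congr rfl fun k _ => ?_
  have e : ∑ l ∈ B, Fc ((dx a)^[p] (wc w i)) (k - l) t * b l =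
      Complex.I ^ p * ∑ l ∈ B, (((k - l) a : ℤ) : ℂ) ^ p * Wf w i (k - l) t * b l := by
    rw [Finset.mul_sum]
    refine Finset.sum_congr rfl fun l _ => ?_
    rw [hS.Fc_iterate ht, Wf]; ring
  rw [e, norm_mul, norm_pow, Complex.norm_I, one_pow, one_mul]

lemma continuous_Wf (hw : SmoothOnTime w (Ici 0)) (hp : ∀ t, SpacePeriodic fun x => w x t)
    (i : Fin 3) (k : K3) : Continuous (Wf w i k) := by
  have h1 : ContinuousOn (Wf w i k) (Ici 0) := by
    intro t ht
    have h := ((sp_wc hw hp i).d1_Fc).hasDerivWithinAt k ht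
    exact h.continuousWithinAt
  have h2 : Continuous fun t => Wf w i k (max t 0) :=
    h1.comp_continuous (by fun_prop) fun t => mem_Ici.2 (le_max_right _ _)
  have e : ∀ t, Wf w i k (max t 0) = Wf w i k t := fun t => by
    simp only [Wf, Fc, wc_max]
  simpa only [e] using h2

end Background

lemma one_add_zpow_le {N : ℝ} (hN : 1 ≤ N) (p : ℕ) : 1 + N ^ ((p : ℤ) - 1) ≤ 2 * N ^ (p - 1) := by
  rcases p with _ | p
  · have : N ^ ((0 : ℤ) - 1) ≤ 1 := zpow_le_one_of_nonpos₀ hN (by norm_num)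
    simp at this ⊢
    linarith
  · have : (1 : ℝ) ≤ N ^ p := one_le_pow₀ hN
    simp
    linarith

lemma wdata {w : E3 → ℝ → E3} (hw : SmoothOnTime w (Ici 0))
    (hp : ∀ t, SpacePeriodic fun x => w x t) {N C₀ : ℝ} (hN : 1 ≤ N) (hC : 0 < C₀) {r : ℕ}
    (hInt : ∀ m ≤ r, IntegrableOn (fun t => (wNormInf m w t) ^ 2) (Set.Ioi (0:ℝ)))
    (hbd : ∀ m ≤ r, Real.sqrt (∫ t in Set.Ioi (0:ℝ), (wNormInf m w t) ^ 2) ≤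
      C₀ * (1 + N ^ ((m : ℤ) - 1))) :
    WData N (2 * C₀) r (Wf w) (Mf w) where
  contM := continuous_Mf hw hp
  convBd p _ ht := convBd_Wf hw hp p ht
  cont := continuous_Wf hw hp
  symm i k t := Sp.Fc_neg _ k t
  sm i n := Sp.sm_Fc n _ (sp_wc hw hp i)
  intB T := by
    intro p hpr τ hτ
    have e : ∀ t ∈ Ioc 0 τ, Mf w p t ^ 2 = wNormInf p w t ^ 2 := fun t ht => by
      rw [Mf, max_eq_left ht.1.le]
    rw [intervalIntegral.integral_of_le hτ.1, setIntegral_congr_fun measurableSet_Ioc e]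
    have h1 : ∫ t in Ioc 0 τ, wNormInf p w t ^ 2 ≤ ∫ t in Ioi 0, wNormInf p w t ^ 2 :=
      setIntegral_mono_set (hInt p hpr) (Filter.Eventually.of_forall fun _ => sq_nonneg _)
        (Filter.Eventually.of_forall fun _ h => h.1)
    have h2 : √(∫ t in Set.Ioi (0:ℝ), (wNormInf p w t) ^ 2) ≤ 2 * C₀ * N ^ (p - 1) := by
      refine (hbd p hpr).trans ?_
      have := mul_le_mul_of_nonneg_left (one_add_zpow_le hN p) hC.le
      linarith
    exact h1.trans (Real.sqrt_le_left (by positivity) |>.mp h2)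

end NSF

namespace NSF

lemma gradSq_eq_dxM (F : Fin 3 → E3 → ℝ → ℝ) (p : ℕ) (t : ℝ) (x : E3) :
    gradSq p (fun y i => F i y t) x = ∑ i, ∑ β ∈ midx p, dxM β (F i) x t ^ 2 := by
  unfold gradSq
  exact Finset.sum_congr rfl fun i _ => Finset.sum_congr rfl fun β _ => by
    rw [← congrFun (pdM_eq β (F i) t) x]

lemma continuous_gradSq_of_Sp {F : Fin 3 → E3 → ℝ → ℝ} (hF : ∀ i, Sp (F i)) (p : ℕ) {t : ℝ}
    (ht : 0 ≤ t) : Continuous (gradSq p fun y i => F i y t) := by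
  rw [funext (gradSq_eq_dxM F p t)]
  exact continuous_finsetSum _ fun i _ => continuous_finsetSum _ fun β _ =>
    (((hF i).dxM β).continuous ht).pow 2

lemma setIntegral_gradSq_nonneg {ι : Type*} [Fintype ι] (p : ℕ) (u : E3 → ι → ℝ) :
    0 ≤ ∫ x in T3, gradSq p u x := integral_nonneg fun x => gradSq_nonneg p u x

lemma HnormSq_nonneg {ι : Type*} [Fintype ι] (p : ℕ) (u : E3 → ι → ℝ) : 0 ≤ HnormSq p u :=
  Finset.sum_nonneg fun _ _ => setIntegral_gradSq_nonneg _ u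

lemma HnormSq_mono {ι : Type*} [Fintype ι] {p q : ℕ} (h : p ≤ q) (u : E3 → ι → ℝ) :
    HnormSq p u ≤ HnormSq q u :=
  Finset.sum_le_sum_of_subset_of_nonneg (Finset.range_mono (by omega))
    fun _ _ _ => setIntegral_gradSq_nonneg _ u

lemma setIntegral_gradSq_le_HnormSq {ι : Type*} [Fintype ι] (p : ℕ) (u : E3 → ι → ℝ) :
    ∫ x in T3, gradSq p u x ≤ HnormSq p u :=
  Finset.single_le_sum (f := fun m => ∫ x in T3, gradSq m u x)
    (fun _ _ => setIntegral_gradSq_nonneg _ u) (Finset.self_mem_range_succ p)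

/-- The constant comparing Fourier energies and Sobolev norms. -/
def Kc (m : ℕ) : ℝ := 3 ^ (m + 1) / (2 * Real.pi) ^ 3

lemma Kc_pos (m : ℕ) : 0 < Kc m := div_pos (by positivity) cell_pos

lemma sum_norm_Fc_iterate_le {F : Fin 3 → E3 → ℝ → ℝ} (hF : ∀ i, Sp (F i)) {t : ℝ} (ht : 0 ≤ t)
    (m : ℕ) (a : Fin 3) (s : Finset K3) :
    (2 * Real.pi) ^ 3 * ∑ i, ∑ k ∈ s, ‖Fc ((dx a)^[m] (F i)) k t‖ ^ 2 ≤
      ∫ x in T3, gradSq m (fun y i => F i y t) x := by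
  have hc : ∀ i, Continuous fun x => (dx a)^[m] (F i) x t := fun i =>
    ((hF i).iterate a m).continuous ht
  have h1 : ∀ i, (2 * Real.pi) ^ 3 * ∑ k ∈ s, ‖Fc ((dx a)^[m] (F i)) k t‖ ^ 2 ≤
      ∫ x in T3, ((dx a)^[m] (F i) x t) ^ 2 := fun i => by
    refine (bessel (Complex.continuous_ofReal.comp (hc i)) s).trans (le_of_eq ?_)
    simp only [Function.comp_apply, Complex.norm_real, Real.norm_eq_abs, sq_abs]
  rw [Finset.mul_sum]
  refine (Finset.sum_le_sum fun i _ => h1 i).trans ?_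
  rw [← integral_finsetSum _ fun i _ => T3_integrable (f := fun x => (dx a)^[m] (F i) x t ^ 2) ((hc i).pow 2)]
  refine integral_mono (T3_integrable (continuous_finsetSum _ fun i _ => (hc i).pow 2))
    (T3_integrable (continuous_gradSq_of_Sp hF m ht)) fun x => ?_
  refine Finset.sum_le_sum fun i _ => ?_
  refine le_trans (le_of_eq ?_) (Finset.single_le_sum
    (f := fun β => (pdM β (fun y => F i y t) x) ^ 2) (fun _ _ => sq_nonneg _)
    (single_mem_midx a m))
  beta_reduce
  rw [pdM_single, iterate_pd]

lemma En_Fc_le {F : Fin 3 → E3 → ℝ → ℝ} (hF : ∀ i, Sp (F i)) {t : ℝ} (ht : 0 ≤ t) (m : ℕ)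
    (s : Finset K3) :
    En s m (fun k i => Fc (F i) k t) ≤ Kc m * HnormSq m fun y i => F i y t := by
  have h0 := cell_pos
  have h1 : En s m (fun k i => Fc (F i) k t) ≤
      3 ^ m * ∑ a, ∑ i, ∑ k ∈ s, ‖Fc ((dx a)^[m] (F i)) k t‖ ^ 2 := by
    have e : ∀ a i k, ‖Fc ((dx a)^[m] (F i)) k t‖ ^ 2 = ((k a : ℝ) ^ m) ^ 2 * ‖Fc (F i) k t‖ ^ 2 := by
      intro a i k
      rw [(hF i).Fc_iterate ht, norm_mul, norm_pow, norm_mul, Complex.norm_I, mul_one,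
        Complex.norm_intCast, mul_pow, pow_right_comm, sq_abs, pow_right_comm]
    calc _ ≤ ∑ k ∈ s, 3 ^ m * (∑ a, ((k a : ℝ) ^ m) ^ 2) * ∑ i, ‖Fc (F i) k t‖ ^ 2 := by
          refine Finset.sum_le_sum fun k _ => ?_
          exact mul_le_mul_of_nonneg_right (lam_pow_le m k)
            (Finset.sum_nonneg fun _ _ => sq_nonneg _)
      _ = _ := by
          simp only [e, Fin.sum_univ_three, Finset.mul_sum, ← Finset.sum_add_distrib]
          exact Finset.sum_congr rfl fun k _ => by ring
  have h2 : ∑ a : Fin 3, ∑ i, ∑ k ∈ s, ‖Fc ((dx a)^[m] (F i)) k t‖ ^ 2 ≤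
      ∑ _a : Fin 3, (HnormSq m fun y i => F i y t) / (2 * Real.pi) ^ 3 := by
    refine Finset.sum_le_sum fun a _ => ?_
    rw [le_div_iff₀ h0, mul_comm]
    exact (sum_norm_Fc_iterate_le hF ht m a s).trans (setIntegral_gradSq_le_HnormSq m _)
  refine h1.trans ((mul_le_mul_of_nonneg_left h2 (by positivity)).trans (le_of_eq ?_))
  rw [Finset.sum_const, Kc]
  simp
  ring

lemma iterate_dj (j : Fin 3) (n : ℕ) (a : K3 → ℝ → ℂ) (k : K3) (t : ℝ) :
    (dj j)^[n] a k t = ((k j : ℂ) * Complex.I) ^ n * a k t := by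
  induction n with
  | zero => simp
  | succ n ih => rw [Function.iterate_succ_apply', dj, ih]; ring

lemma SM.iterate_dj {n : ℕ} {a : K3 → ℝ → ℂ} (h : SM n a) (j : Fin 3) (p : ℕ) :
    SM n ((NSF.dj j)^[p] a) := by
  induction p with
  | zero => exact h
  | succ p ih => rw [Function.iterate_succ_apply']; exact ih.dj j

/-- Fourier multiplier of a mixed derivative. -/
def djM (β : Fin 3 → ℕ) (a : K3 → ℝ → ℂ) : K3 → ℝ → ℂ :=
  (dj 0)^[β 0] ((dj 1)^[β 1] ((dj 2)^[β 2] a))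

lemma SM.djM {n : ℕ} {a : K3 → ℝ → ℂ} (h : SM n a) (β : Fin 3 → ℕ) : SM n (NSF.djM β a) :=
  ((h.iterate_dj 2 _).iterate_dj 1 _).iterate_dj 0 _

lemma iterate_pd_re_syn {a : K3 → ℝ → ℂ} (h : SM 1 a) {t : ℝ} (ht : 0 ≤ t) (j : Fin 3) (n : ℕ) :
    (pd j)^[n] (fun x => (syn a x t).re) = fun x => (syn ((dj j)^[n] a) x t).re := by
  induction n with
  | zero => rfl
  | succ n ih =>
    rw [Function.iterate_succ_apply', ih, pd_re_syn (h.iterate_dj j n) ht,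
      Function.iterate_succ_apply']

lemma pdM_re_syn {a : K3 → ℝ → ℂ} (h : SM 1 a) {t : ℝ} (ht : 0 ≤ t) (β : Fin 3 → ℕ) :
    pdM β (fun x => (syn a x t).re) = fun x => (syn (djM β a) x t).re := by
  rw [pdM, iterate_pd_re_syn h ht, iterate_pd_re_syn (h.iterate_dj 2 _) ht,
    iterate_pd_re_syn ((h.iterate_dj 2 _).iterate_dj 1 _) ht]
  rfl

lemma norm_djM_sq_le {p : ℕ} {β : Fin 3 → ℕ} (hβ : β ∈ midx p) (a : K3 → ℝ → ℂ) (k : K3) (t : ℝ) :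
    ‖djM β a k t‖ ^ 2 ≤ lam k ^ p * ‖a k t‖ ^ 2 := by
  rw [midx, Finset.Nat.mem_antidiagonalTuple, Fin.sum_univ_three] at hβ
  have e : ‖djM β a k t‖ ^ 2 = ((k 0 : ℝ) ^ 2) ^ β 0 * ((k 1 : ℝ) ^ 2) ^ β 1 *
      ((k 2 : ℝ) ^ 2) ^ β 2 * ‖a k t‖ ^ 2 := by
    rw [djM, iterate_dj, iterate_dj, iterate_dj]
    simp only [norm_mul, norm_pow, Complex.norm_I, Complex.norm_intCast, mul_pow]
    simp only [← pow_mul, mul_comm _ 2]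
    simp only [pow_mul, sq_abs]
    ring
  rw [e, ← hβ, pow_add, pow_add]
  have h := lam_nonneg k
  gcongr <;> exact sq_le_lam k _

lemma continuous_re_syn {a : K3 → ℝ → ℂ} (h : SM 1 a) {t : ℝ} (ht : 0 ≤ t) :
    Continuous fun x => (syn a x t).re :=
  Complex.continuous_re.comp
    (continuous_iff_continuousAt.2 fun x => (hasFDerivAt_syn h ht x).continuousAt)

/-- Summing derivatives of the components. -/
lemma setIntegral_gradSq_syn_le {c : K3 → Fin 3 → ℝ → ℂ} (h : ∀ i, SM 1 fun k t => c k i t)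
    {t : ℝ} (ht : 0 ≤ t) {p : ℕ} {B : ℝ} (hB : ∀ s, En s p (fun k i => c k i t) ≤ B) :
    ∫ x in T3, gradSq p (fun y i => (syn (fun k t => c k i t) y t).re) x ≤
      3 * (midx p).card * (2 * Real.pi) ^ 3 * B := by
  have e : ∀ x, gradSq p (fun y i => (syn (fun k t => c k i t) y t).re) x =
      ∑ i, ∑ β ∈ midx p, (syn (djM β fun k t => c k i t) x t).re ^ 2 := fun x =>
    Finset.sum_congr rfl fun i _ => Finset.sum_congr rfl fun β _ => by
      rw [pdM_re_syn (h i) ht]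
  have hc : ∀ i β, Continuous fun x => (syn (djM β fun k t => c k i t) x t).re ^ 2 := fun i β =>
    (continuous_re_syn ((h i).djM β) ht).pow 2
  simp only [e]
  rw [integral_finsetSum _ fun i _ => T3_integrable (continuous_finsetSum _ fun β _ => hc i β)]
  have h1 : ∀ i, ∫ x in T3, ∑ β ∈ midx p, (syn (djM β fun k t => c k i t) x t).re ^ 2 ≤
      ∑ β ∈ midx p, (2 * Real.pi) ^ 3 * B := by
    intro i
    rw [integral_finsetSum _ fun β _ => T3_integrable (hc i β)]
    refine Finset.sum_le_sum fun β hβ => setIntegral_re_syn_sq_le ?_ fun s => ?_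
    · have := ((h i).djM β).dec.summable 0 ht
      simpa only [norm_mul, norm_ek, mul_one] using this
    · refine le_trans (Finset.sum_le_sum fun k _ => ?_) (hB s)
      refine (norm_djM_sq_le hβ _ k t).trans ?_
      exact mul_le_mul_of_nonneg_left
        (Finset.single_le_sum (f := fun i => ‖c k i t‖ ^ 2) (fun _ _ => sq_nonneg _)
          (Finset.mem_univ i)) (pow_nonneg (lam_nonneg k) _)
  refine (Finset.sum_le_sum fun i _ => h1 i).trans (le_of_eq ?_)
  simp only [Finset.sum_const, nsmul_eq_mul, Finset.card_univ, Fintype.card_fin]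
  push_cast
  ring

/-- Sobolev norm of a synthesized field in terms of Fourier energies. -/
lemma Hnorm_syn_le {c : K3 → Fin 3 → ℝ → ℂ} (h : ∀ i, SM 1 fun k t => c k i t) {r : ℕ}
    {D N θ t : ℝ} (hD : 0 ≤ D) (hN : 1 ≤ N) (ht : 0 ≤ t) (z : E3 → Fin 3 → ℝ)
    (hB : ∀ m ≤ r, ∀ s, En s m (fun k i => c k i t) ≤
      D * (N ^ (m - 1)) ^ 2 * Real.exp (-(2 * θ)) * (Kc m * HnormSq m z)) {m : ℕ} (hm : m ≤ r) :
    Hnorm m (fun y i => (syn (fun k t => c k i t) y t).re) ≤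
      √(∑ p ∈ Finset.range (r + 1), 3 * (midx p).card * (2 * Real.pi) ^ 3 * D * Kc p) *
        N ^ (m - 1) * Real.exp (-θ) * Hnorm m z := by
  have h0 := cell_pos
  have hK := fun p => (Kc_pos p).le
  have hHm := HnormSq_nonneg m z
  have hexp : Real.exp (-(2 * θ)) = Real.exp (-θ) ^ 2 := by rw [← Real.exp_nat_mul]; congr 1; ring
  have hA : ∀ p, 0 ≤ 3 * (midx p).card * (2 * Real.pi) ^ 3 * D * Kc p := fun p => by
    have := hK p
    positivity
  have hN0 : 0 ≤ N ^ (m - 1) := by positivity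
  have key : HnormSq m (fun y i => (syn (fun k t => c k i t) y t).re) ≤
      (∑ p ∈ Finset.range (r + 1), 3 * (midx p).card * (2 * Real.pi) ^ 3 * D * Kc p) *
        ((N ^ (m - 1)) ^ 2 * Real.exp (-θ) ^ 2 * HnormSq m z) := by
    calc _ ≤ ∑ p ∈ Finset.range (m + 1), 3 * (midx p).card * (2 * Real.pi) ^ 3 * D * Kc p *
          ((N ^ (m - 1)) ^ 2 * Real.exp (-θ) ^ 2 * HnormSq m z) := by
          refine Finset.sum_le_sum fun p hp => ?_
          have hpm : p ≤ m := Nat.lt_succ_iff.1 (Finset.mem_range.1 hp)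
          refine (setIntegral_gradSq_syn_le h ht (hB p (hpm.trans hm))).trans ?_
          have h1 : N ^ (p - 1) ≤ N ^ (m - 1) := pow_le_pow_right₀ hN (by omega)
          have h2 := HnormSq_mono hpm z
          have h3 := HnormSq_nonneg p z
          have h4 : (N ^ (p - 1)) ^ 2 * HnormSq p z ≤ (N ^ (m - 1)) ^ 2 * HnormSq m z := by
            gcongr
          rw [hexp]
          have h5 : 0 ≤ 3 * (midx p).card * (2 * Real.pi) ^ 3 * D * Kc p * Real.exp (-θ) ^ 2 :=
            mul_nonneg (hA p) (sq_nonneg _)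
          have := mul_le_mul_of_nonneg_left h4 h5
          linarith
      _ ≤ _ := by
          rw [Finset.sum_mul]
          refine Finset.sum_le_sum_of_subset_of_nonneg (Finset.range_mono (by omega))
            fun p _ _ => mul_nonneg (hA p) (by positivity)
  refine (Real.sqrt_le_sqrt key).trans (le_of_eq ?_)
  rw [Real.sqrt_mul (Finset.sum_nonneg fun p _ => hA p), Real.sqrt_mul (by positivity),
    Real.sqrt_mul (by positivity), Real.sqrt_sq hN0, Real.sqrt_sq (Real.exp_pos _).le, Hnorm]
  ring

lemma Sp.sum_mul_Fc {f : Fin 3 → E3 → ℝ → ℝ} (h : ∀ j, Sp (f j)) {t : ℝ} (ht : 0 ≤ t)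
    (hd : ∀ x, ∑ j, NSF.dx j (f j) x t = 0) (k : K3) : ∑ j, (k j : ℂ) * Fc (f j) k t = 0 := by
  have h1 : fc (fun x => ∑ j, (NSF.dx j (f j) x t : ℂ)) k = 0 := by
    have e : ∀ x, ∑ j, (NSF.dx j (f j) x t : ℂ) = 0 := fun x => by exact_mod_cast hd x
    simp [e, fc]
  rw [fc_sum Finset.univ (f := fun j x => (NSF.dx j (f j) x t : ℂ))
    fun j _ => Complex.continuous_ofReal.comp (((h j).dx j).continuous ht)] at h1
  have h2 : ∑ j, (k j : ℂ) * Complex.I * Fc (f j) k t = 0 := by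
    rw [← h1]
    exact Finset.sum_congr rfl fun j _ => ((h j).Fc_dx ht j k).symm
  have h3 : Complex.I * ∑ j, (k j : ℂ) * Fc (f j) k t = 0 := by
    rw [← h2, Finset.mul_sum]
    exact Finset.sum_congr rfl fun j _ => by ring
  exact (mul_eq_zero.1 h3).resolve_left Complex.I_ne_zero

lemma Fc_zero_of_mean {f : E3 → ℝ → ℝ} {t : ℝ} (h : ∫ x in T3, f x t = 0) : Fc f 0 t = 0 := by
  rw [Fc, fc]
  simp only [neg_zero, ek_zero, one_mul]
  rw [integral_complex_ofReal, h]
  simp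

lemma Sp.sub {f g : E3 → ℝ → ℝ} (hf : Sp f) (hg : Sp g) : Sp fun x t => f x t - g x t :=
  ⟨hf.1.sub hg.1, fun t ht x j => congrArg₂ (· - ·) (hf.2 t ht x j) (hg.2 t ht x j)⟩

lemma Sp.Fc_sub {f g : E3 → ℝ → ℝ} (hf : Sp f) (hg : Sp g) {t : ℝ} (ht : 0 ≤ t) (k : K3) :
    Fc (fun x t => f x t - g x t) k t = Fc f k t - Fc g k t := by
  have := fc_sub (Complex.continuous_ofReal.comp (hf.continuous ht))
    (Complex.continuous_ofReal.comp (hg.continuous ht)) k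
  refine Eq.trans ?_ this
  simp [Fc]

end NSF

namespace NSF

lemma SM.fluxF {n : ℕ} {W : Fin 3 → K3 → ℝ → ℂ} {c : K3 → Fin 3 → ℝ → ℂ} (hW : ∀ i, SM n (W i))
    (hc : ∀ i, SM n fun k t => c k i t) (i j : Fin 3) :
    SM n fun k t => fluxF (fun i k => W i k t) (fun k i => c k i t) k i j :=
  (((hW i).conv (hc j)).add ((hW j).conv (hc i))).add ((hc i).conv (hc j))

/-- Fourier coefficients of the pressure generated by a flux. -/
def presF (S : Fin 3 → Fin 3 → K3 → ℝ → ℂ) (k : K3) (t : ℝ) : ℂ :=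
  Complex.I * ((∑ j, (k j : ℂ) * zdiv k (fun i j => S i j k t) j) / (lam k : ℂ))

lemma SM.presF {n : ℕ} {S : Fin 3 → Fin 3 → K3 → ℝ → ℂ} (h : ∀ i j, SM n (S i j)) :
    SM n (presF S) := by
  have hz : ∀ i, SM n fun k t => zdiv k (fun i j => S i j k t) i := fun i =>
    (SM.sum Finset.univ fun j _ => (h i j).mul (PolyB.coord j)).mul (PolyB.const Complex.I)
  have h2 := (SM.sum Finset.univ fun j _ => (hz j).mul (PolyB.coord j)).mul
    ((PolyB.const Complex.I).mul PolyB.inv_lam)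
  have e : NSF.presF S = fun k t => Complex.I * (lam k : ℂ)⁻¹ *
      ∑ j, (k j : ℂ) * zdiv k (fun i j => S i j k t) j := by
    funext k t
    rw [NSF.presF, div_eq_mul_inv]; ring
  rw [e]
  exact h2

lemma syn_rhs {ν : ℝ} {c : K3 → Fin 3 → ℝ → ℂ} {S : Fin 3 → Fin 3 → K3 → ℝ → ℂ}
    (hc : ∀ i, Dec fun k t => c k i t) (hS : ∀ i j, Dec (S i j)) {t : ℝ} (ht : 0 ≤ t) (i : Fin 3)
    (x : E3) :
    syn (fun k t => -(ν * lam k : ℝ) * c k i t - lerayP k (zdiv k fun i j => S i j k t) i) x t =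
      ν * ∑ j, syn (dj j (dj j fun k t => c k i t)) x t - ∑ j, syn (dj j (S i j)) x t -
        syn (dj i (presF S)) x t := by
  have hp : Dec (presF S) := SM.presF (n := 0) hS
  have h1 : ∀ j ∈ (Finset.univ : Finset (Fin 3)), Dec (dj j (dj j fun k t => c k i t)) :=
    fun j _ => ((hc i).dj j).dj j
  have h2 : ∀ j ∈ (Finset.univ : Finset (Fin 3)), Dec (dj j (S i j)) := fun j _ => (hS i j).dj j
  have d1 : Dec fun k t => (ν : ℂ) * ∑ j, dj j (dj j fun k t => c k i t) k t :=
    SM.mul (n := 0) (SM.sum (n := 0) _ h1) (PolyB.const _)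
  have d2 : Dec fun k t => (-1 : ℂ) * ∑ j, dj j (S i j) k t :=
    SM.mul (n := 0) (SM.sum (n := 0) _ h2) (PolyB.const _)
  have d3 : Dec fun k t => (-1 : ℂ) * dj i (presF S) k t :=
    SM.mul (n := 0) (hp.dj i) (PolyB.const _)
  have e : (fun (k : K3) (t : ℝ) => -(ν * lam k : ℝ) * c k i t -
      lerayP k (zdiv k fun i j => S i j k t) i) = fun k t =>
      ((ν : ℂ) * ∑ j, dj j (dj j fun k t => c k i t) k t + (-1 : ℂ) * ∑ j, dj j (S i j) k t) +
        (-1 : ℂ) * dj i (presF S) k t := by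
    funext k t
    have hl : ((lam k : ℝ) : ℂ) = (k 0 : ℂ) ^ 2 + (k 1 : ℂ) ^ 2 + (k 2 : ℂ) ^ 2 := by
      simp [lam, Fin.sum_univ_three]
    have hI : Complex.I ^ 2 = -1 := Complex.I_sq
    rw [lerayP]
    simp only [dj, presF]
    generalize (∑ j, (k j : ℂ) * zdiv k (fun i j => S i j k t) j) / (lam k : ℂ) = X
    simp only [zdiv, Fin.sum_univ_three]
    push_cast
    rw [hl]
    linear_combination (-(ν : ℂ) * ((k 0 : ℂ) ^ 2 + (k 1 : ℂ) ^ 2 + (k 2 : ℂ) ^ 2) * c k i t +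
      (k i : ℂ) * X) * hI
  rw [e, syn_add (Dec.add d1 d2) d3 ht, syn_add d1 d2 ht, syn_const_mul, syn_const_mul,
    syn_const_mul, syn_sum _ h1 ht, syn_sum _ h2 ht]
  ring

lemma pd_mul {f g : E3 → ℝ} {x : E3} (hf : DifferentiableAt ℝ f x) (hg : DifferentiableAt ℝ g x)
    (j : Fin 3) : pd j (fun y => f y * g y) x = f x * pd j g x + pd j f x * g x := by
  rw [pd, fderiv_fun_mul hf hg, pd, pd]
  simp
  ring

lemma pd_add {f g : E3 → ℝ} {x : E3} (hf : DifferentiableAt ℝ f x) (hg : DifferentiableAt ℝ g x)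
    (j : Fin 3) : pd j (fun y => f y + g y) x = pd j f x + pd j g x := by
  rw [pd, fderiv_fun_add hf hg, pd, pd]
  simp

/-- The divergence of the flux of a perturbation, for solenoidal fields. -/
lemma sum_pd_flux {a b : Fin 3 → E3 → ℝ} {x : E3} (ha : ∀ i, DifferentiableAt ℝ (a i) x)
    (hb : ∀ i, DifferentiableAt ℝ (b i) x) (da : ∑ j, pd j (a j) x = 0)
    (db : ∑ j, pd j (b j) x = 0) (i : Fin 3) :
    ∑ j, pd j (fun y => a i y * b j y + a j y * b i y + b i y * b j y) x =
      ∑ j, (a j x + b j x) * (pd j (a i) x + pd j (b i) x) - ∑ j, a j x * pd j (a i) x := by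
  have e : ∀ j, pd j (fun y => a i y * b j y + a j y * b i y + b i y * b j y) x =
      (a i x * pd j (b j) x + pd j (a i) x * b j x) + (a j x * pd j (b i) x + pd j (a j) x * b i x) +
        (b i x * pd j (b j) x + pd j (b i) x * b j x) := by
    intro j
    rw [pd_add (f := fun y => a i y * b j y + a j y * b i y) (g := fun y => b i y * b j y)
      (((ha i).mul (hb j)).add ((ha j).mul (hb i))) ((hb i).mul (hb j)),
      pd_add (f := fun y => a i y * b j y) (g := fun y => a j y * b i y) ((ha i).mul (hb j)) ((ha j).mul (hb i)),
      pd_mul (ha i) (hb j), pd_mul (ha j) (hb i), pd_mul (hb i) (hb j)]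
  simp only [e, Fin.sum_univ_three] at da db ⊢
  linear_combination (a i x + b i x) * db + b i x * da

lemma lap_add {f g : E3 → ℝ} (hf : Differentiable ℝ f) (hg : Differentiable ℝ g)
    (hf' : ∀ j, Differentiable ℝ (pd j f)) (hg' : ∀ j, Differentiable ℝ (pd j g)) (x : E3) :
    lap (fun y => f y + g y) x = lap f x + lap g x := by
  simp only [lap, ← Finset.sum_add_distrib]
  refine Finset.sum_congr rfl fun j _ => ?_
  rw [funext fun y => pd_add (hf y) (hg y) j]
  exact pd_add (hf' j x) (hg' j x) j

lemma differentiable_re_syn {a : K3 → ℝ → ℂ} (h : SM 1 a) {t : ℝ} (ht : 0 ≤ t) :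
    Differentiable ℝ fun x => (syn a x t).re := fun x =>
  (Complex.reCLM.hasFDerivAt.comp x (hasFDerivAt_syn h ht x)).differentiableAt

lemma re_syn_flux {W : Fin 3 → K3 → ℝ → ℂ} {c : K3 → Fin 3 → ℝ → ℂ} (hW : ∀ i, Dec (W i))
    (hc : ∀ i, Dec fun k t => c k i t) {t : ℝ} (ht : 0 ≤ t) {x : E3} {a : Fin 3 → ℝ}
    (ha : ∀ i, (a i : ℂ) = syn (W i) x t) (him : ∀ i, (syn (fun k t => c k i t) x t).im = 0)
    (i j : Fin 3) :
    (syn (fun k t => fluxF (fun i k => W i k t) (fun k i => c k i t) k i j) x t).re =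
      a i * (syn (fun k t => c k j t) x t).re + a j * (syn (fun k t => c k i t) x t).re +
        (syn (fun k t => c k i t) x t).re * (syn (fun k t => c k j t) x t).re := by
  have e : syn (fun k t => fluxF (fun i k => W i k t) (fun k i => c k i t) k i j) x t =
      syn (W i) x t * syn (fun k t => c k j t) x t + syn (W j) x t * syn (fun k t => c k i t) x t +
        syn (fun k t => c k i t) x t * syn (fun k t => c k j t) x t := by
    rw [syn_mul (hW i) (hc j) ht, syn_mul (hW j) (hc i) ht, syn_mul (hc i) (hc j) ht,
      ← syn_add ((hW i).conv (hc j)) ((hW j).conv (hc i)) ht,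
      ← syn_add (((hW i).conv (hc j)).add ((hW j).conv (hc i))) ((hc i).conv (hc j)) ht]
    rfl
  rw [e, ← ha, ← ha]
  simp [Complex.mul_re, him]

section Solution

variable {ν : ℝ} {w : E3 → ℝ → E3} {Pw : E3 → ℝ → ℝ} {c : K3 → Fin 3 → ℝ → ℂ}

/-- Velocity perturbation with given Fourier coefficients. -/
def vel (c : K3 → Fin 3 → ℝ → ℂ) (x : E3) (t : ℝ) : E3 := fun i => (syn (fun k t => c k i t) x t).re

/-- Fourier coefficients of the flux of a perturbation of the background flow. -/
def fluxC (w : E3 → ℝ → E3) (c : K3 → Fin 3 → ℝ → ℂ) (i j : Fin 3) (k : K3) (t : ℝ) : ℂ :=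
  fluxF (fun i k => Wf w i k t) (fun k i => c k i t) k i j

/-- Pressure perturbation. -/
def pres (w : E3 → ℝ → E3) (c : K3 → Fin 3 → ℝ → ℂ) (x : E3) (t : ℝ) : ℝ :=
  (syn (presF (fluxC w c)) x t).re

lemma smoothOnTime_vel (hc : ∀ i n, SM n fun k t => c k i t) : SmoothOnTime (vel c) (Ici 0) :=
  contDiffOn_pi.2 fun i => syn_re_contDiffOn (hc i)

lemma periodic_vel (t : ℝ) : SpacePeriodic fun x => vel c x t := fun x j => funext fun i =>
  congrArg Complex.re (syn_periodic (fun k t => c k i t) t x j)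

lemma periodic_pres (t : ℝ) : SpacePeriodic fun x => pres w c x t := fun x j =>
  congrArg Complex.re (syn_periodic _ t x j)

lemma vdiv_vel (hc : ∀ i n, SM n fun k t => c k i t)
    (hdiv : ∀ k t, 0 ≤ t → ∑ i, (k i : ℂ) * c k i t = 0) {t : ℝ} (ht : 0 ≤ t) (x : E3) :
    ∑ j, pd j (fun y => vel c y t j) x = 0 := by
  have e : ∀ j, pd j (fun y => vel c y t j) x = (syn (dj j fun k t => c k j t) x t).re := fun j =>
    congrFun (pd_re_syn (hc j 1) ht j) x
  simp only [e]
  rw [← Complex.re_sum, ← syn_sum (a := fun j => dj j fun k t => c k j t) Finset.univ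
    (fun j _ => ((hc j 0).dj j).dec) ht]
  have e2 : ∀ k, ∑ j, dj j (fun k t => c k j t) k t = 0 := fun k => by
    have h := hdiv k t ht
    simp only [dj]
    rw [← mul_zero Complex.I, ← h, Finset.mul_sum]
    exact Finset.sum_congr rfl fun j _ => by ring
  simp [syn, e2]

lemma SM_fluxC (hw : SmoothOnTime w (Ici 0)) (hp : ∀ t, SpacePeriodic fun x => w x t)
    (hc : ∀ i n, SM n fun k t => c k i t)
    (n : ℕ) (i j : Fin 3) : SM n (fluxC w c i j) :=
  SM.fluxF (fun i => Sp.sm_Fc n _ (sp_wc hw hp i)) (fun i => hc i n) i j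

lemma smoothOnTimeS_pres (hw : SmoothOnTime w (Ici 0)) (hp : ∀ t, SpacePeriodic fun x => w x t)
    (hc : ∀ i n, SM n fun k t => c k i t) : SmoothOnTimeS (pres w c) (Ici 0) :=
  syn_re_contDiffOn fun n => SM.presF (SM_fluxC hw hp hc n)

lemma isNS_add (hw : SmoothOnTime w (Ici 0)) (hp : ∀ t, SpacePeriodic fun x => w x t)
    (hc : ∀ i n, SM n fun k t => c k i t)
    (hNS : IsNS ν (Ici 0) w Pw) (hP : SmoothOnTimeS Pw (Ici 0))
    (h1 : ∀ i, D1 (fun k t => c k i t)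
      fun k t => rhsF ν (fun i k => Wf w i k t) (fun k i => c k i t) k i)
    (hsymm : ∀ k i t, 0 ≤ t → c (-k) i t = (starRingEnd ℂ) (c k i t))
    (hdiv : ∀ k t, 0 ≤ t → ∑ i, (k i : ℂ) * c k i t = 0) :
    IsNS ν (Ici 0) (fun x t => w x t + vel c x t) fun x t => Pw x t + pres w c x t := by
  have hS := SM_fluxC hw hp hc
  have hQ : ∀ n, SM n (presF (fluxC w c)) := fun n => SM.presF (hS n)
  have dw : ∀ t, 0 ≤ t → ∀ i, Differentiable ℝ fun y => w y t i := fun t ht i x => by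
    have := ((sp_wc hw hp i).hasFDerivAt ht x).differentiableAt
    simpa only [wc, max_eq_left ht] using this
  have dw' : ∀ t, 0 ≤ t → ∀ i j, Differentiable ℝ (pd j fun y => w y t i) := fun t ht i j x => by
    have := (((sp_wc hw hp i).dx j).hasFDerivAt ht x).differentiableAt
    unfold NSF.dx at this
    simpa only [wc, max_eq_left ht] using this
  have dv : ∀ t, 0 ≤ t → ∀ i, Differentiable ℝ fun y => vel c y t i := fun t ht i =>
    differentiable_re_syn (hc i 1) ht
  have pv : ∀ t, 0 ≤ t → ∀ i j, pd j (fun y => vel c y t i) =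
      fun x => (syn (dj j fun k t => c k i t) x t).re := fun t ht i j => pd_re_syn (hc i 1) ht j
  have dv' : ∀ t, 0 ≤ t → ∀ i j, Differentiable ℝ (pd j fun y => vel c y t i) := fun t ht i j => by
    rw [pv t ht]; exact differentiable_re_syn ((hc i 1).dj j) ht
  have divw : ∀ t, 0 ≤ t → ∀ x, ∑ j, pd j (fun y => w y t j) x = 0 := hNS.2
  have divv := fun t ht x => vdiv_vel hc hdiv (t := t) ht x
  refine ⟨fun t ht x i => ?_, fun t ht x => ?_⟩
  · have ht : 0 ≤ t := ht
    have hwt : HasDerivWithinAt (fun τ => w x τ i) (derivWithin (fun τ => w x τ i) (Ici 0) t)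
        (Ici 0) t := by
      have h := (sp_wc hw hp i).hasDerivWithinAt ht x
      have h' := h.congr (f₁ := fun τ => w x τ i)
        (fun τ hτ => by rw [wc, max_eq_left (mem_Ici.1 hτ)]) (by rw [wc, max_eq_left ht])
      exact h'.differentiableWithinAt.hasDerivWithinAt
    have hrd : Dec fun k t => rhsF ν (fun i k => Wf w i k t) (fun k i => c k i t) k i := by
      have h2 := ((hc i 0).mul ((PolyB.const (-(ν : ℂ))).mul PolyB.lam)).add
        ((SM.leray (hS 0) i).mul (PolyB.const (-1)))
      refine (congrArg Dec (funext fun k => funext fun t => ?_)).mp h2.dec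
      simp only [rhsF, fluxC]
      push_cast
      ring
    have hvt := hasDerivWithinAt_syn (hc i 0).dec (h1 i) hrd ht x
    have hder : derivWithin (fun τ => w x τ i + vel c x τ i) (Ici 0) t = _ :=
      (hwt.add hvt).derivWithin (uniqueDiffOn_Ici 0 t ht)
    have hrhs := syn_rhs (ν := ν) (c := c) (S := fluxC w c) (fun i => (hc i 0).dec)
      (fun i j => (hS 0 i j).dec) ht i x
    have hrhs' : (syn (fun k t => rhsF ν (fun i k => Wf w i k t) (fun k i => c k i t) k i) x t).re =
        ν * lap (fun y => vel c y t i) x -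
          ∑ j, pd j (fun y => (syn (fluxC w c i j) y t).re) x -
          pd i (fun y => pres w c y t) x := by
      have e1 : lap (fun y => vel c y t i) x =
          ∑ j, (syn (dj j (dj j fun k t => c k i t)) x t).re :=
        Finset.sum_congr rfl fun j _ => by
          rw [pv t ht, pd_re_syn ((hc i 1).dj j) ht]
      have e2 : ∀ j, pd j (fun y => (syn (fluxC w c i j) y t).re) x =
          (syn (dj j (fluxC w c i j)) x t).re := fun j =>
        congrFun (pd_re_syn (hS 1 i j) ht j) x
      have e3 : pd i (fun y => pres w c y t) x = (syn (dj i (presF (fluxC w c))) x t).re :=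
        congrFun (pd_re_syn (hQ 1) ht i) x
      rw [e1, e3]
      simp only [e2]
      refine (congrArg Complex.re hrhs).trans ?_
      simp only [Complex.sub_re, Complex.re_sum, Complex.re_ofReal_mul]
    have hflux : ∀ j, (fun y => (syn (fluxC w c i j) y t).re) = fun y =>
        w y t i * vel c y t j + w y t j * vel c y t i + vel c y t i * vel c y t j := by
      intro j
      funext y
      refine re_syn_flux (a := fun i => w y t i) (fun i => (sp_wc hw hp i).dec_Fc)
        (fun i => (hc i 0).dec) ht (fun i => ?_) (fun i => syn_im (fun k => hsymm k i t ht) y) i j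
      rw [← (sp_wc hw hp i).eq_syn ht y, wc, max_eq_left ht]
    have hsum := sum_pd_flux (a := fun i y => w y t i) (b := fun i y => vel c y t i)
      (fun i => dw t ht i x) (fun i => dv t ht i x) (divw t ht x) (divv t ht x) i
    have hPd : DifferentiableAt ℝ (fun y => Pw y t) x := by
      have h2 := (hP.differentiableOn (by simp)) _ (mem_dom (x := x) ht)
      have h3 : HasFDerivAt (fun y : E3 => (y, t)) (ContinuousLinearMap.inl ℝ E3 ℝ) x :=
        hasFDerivAt_prodMk_left x t
      have h4 := HasFDerivWithinAt.comp (s := univ) (t := dom) x h2.hasFDerivWithinAt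
        h3.hasFDerivWithinAt (fun y _ => mem_dom ht)
      rw [hasFDerivWithinAt_univ] at h4
      exact h4.differentiableAt
    have hns := hNS.1 t ht x i
    simp only [Pi.add_apply]
    rw [hder, hrhs', pd_add (g := fun y => pres w c y t) hPd (differentiable_re_syn (hQ 1) ht x),
      lap_add (dw t ht i) (dv t ht i) (dw' t ht i) (dv' t ht i)]
    simp only [hflux, hsum, pd_add (dw t ht i x) (dv t ht i x)]
    linarith
  · have ht : 0 ≤ t := ht
    have e : ∀ j, pd j (fun y => w y t j + vel c y t j) x =
        pd j (fun y => w y t j) x + pd j (fun y => vel c y t j) x := fun j =>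
      pd_add (dw t ht j x) (dv t ht j x) j
    simp only [vdiv, Pi.add_apply, e, Finset.sum_add_distrib, divw t ht, divv t ht, add_zero]

end Solution

end NSF

namespace NSF

lemma pow_pred_le_zpow {N : ℝ} (hN : 1 ≤ N) (m : ℕ) : N ^ (m - 1) ≤ N ^ ((m : ℤ) - 1) + 1 := by
  rcases m with _ | m
  · have : 0 ≤ N ^ (((0 : ℕ) : ℤ) - 1) := by positivity
    simpa using this
  · have : N ^ (((m + 1 : ℕ) : ℤ) - 1) = N ^ m := by
      rw [← zpow_natCast]; congr 1; push_cast; ring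
    rw [this]
    simp

/-- Difference of a fixed field and a flow, in components. -/
def diffC (u₀ : E3 → E3) (w : E3 → ℝ → E3) (i : Fin 3) (x : E3) (t : ℝ) : ℝ := u₀ x i - wc w i x t

lemma sp_fixed {u₀ : E3 → E3} (hu : ContDiff ℝ (⊤ : ℕ∞) u₀) (hp : SpacePeriodic u₀) (i : Fin 3) :
    Sp fun x _ => u₀ x i :=
  ⟨((contDiff_pi.1 hu i).comp contDiff_fst).contDiffOn, fun _ _ x j => congrFun (hp x j) i⟩

lemma diffC_zero (u₀ : E3 → E3) (w : E3 → ℝ → E3) :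
    (fun x i => diffC u₀ w i x 0) = fun x => u₀ x - w x 0 := by
  funext x i
  simp [diffC, wc]

end NSF

/-- Corollary of the stability theorem, with explicit dependence on the
frequency `N`: the constants `c`, `C` depend only on `r`, `σ`, `ν`, `C₀`. -/
theorem navier_stokes_stability_frequency
    (r : ℕ) (hr : 1 ≤ r) (σ ν C₀ : ℝ) (hσ : σ ∈ Set.Ioo (0:ℝ) 1) (hν : 0 < ν)
    (hC₀ : 0 < C₀) :
    ∃ c C : ℝ, 0 < c ∧ 0 < C ∧
      ∀ (N : ℝ), 1 ≤ N →
      ∀ (w : E3 → ℝ → E3) (Pw : E3 → ℝ → ℝ),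
        SmoothOnTime w (Set.Ici 0) →
        SmoothOnTimeS Pw (Set.Ici 0) →
        (∀ t, SpacePeriodic (fun x => w x t)) →
        (∀ t, SpacePeriodic (fun x => Pw x t)) →
        IsNS ν (Set.Ici 0) w Pw →
        ZeroMean (fun x => w x 0) →
        (∀ m ≤ r, IntegrableOn (fun t => (wNormInf m w t) ^ 2) (Set.Ioi (0:ℝ))) →
        (∀ m ≤ r,
          Real.sqrt (∫ t in Set.Ioi (0:ℝ), (wNormInf m w t) ^ 2) ≤
            C₀ * (1 + N ^ ((m : ℤ) - 1))) →
        ∀ u₀ : E3 → E3,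
          ContDiff ℝ (⊤ : ℕ∞) u₀ → SpacePeriodic u₀ →
          (∀ x, vdiv u₀ x = 0) → ZeroMean u₀ →
          Hnorm r (fun x => u₀ x - w x 0) ≤ c * N ^ (1 - (r : ℤ)) →
          ∃ (u : E3 → ℝ → E3) (P : E3 → ℝ → ℝ),
            SmoothOnTime u (Set.Ici 0) ∧
            SmoothOnTimeS P (Set.Ici 0) ∧
            (∀ t, SpacePeriodic (fun x => u x t)) ∧
            (∀ t, SpacePeriodic (fun x => P x t)) ∧
            IsNS ν (Set.Ici 0) u P ∧
            (∀ x, u x 0 = u₀ x) ∧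
            ∀ m ≤ r, ∀ t : ℝ, 0 < t →
              Hnorm m (fun x => u x t - w x t) ≤
                C * (N ^ ((m : ℤ) - 1) + 1) * Real.exp (-ν * σ * t) *
                  Hnorm m (fun x => u₀ x - w x 0) := by
  open NSF in
  obtain ⟨η, D, hη, hD, hex⟩ := perturb_exists hν hσ (2 * C₀) hr
  obtain ⟨A, hA⟩ : ∃ A, A =
    √(∑ p ∈ Finset.range (r + 1), 3 * (midx p).card * (2 * Real.pi) ^ 3 * D * Kc p) := ⟨_, rfl⟩
  have hA0 : 0 ≤ A := hA ▸ Real.sqrt_nonneg _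
  refine ⟨√(η / Kc 1), A + 1, Real.sqrt_pos.2 (div_pos hη (Kc_pos 1)), by linarith, ?_⟩
  intro N hN w Pw hw hPw hwp hPwp hNS hw0 hInt hbd u₀ hu hup hud hu0 hsmall
  have hU := sp_fixed hu hup
  have hW := sp_wc hw hwp
  have hz : ∀ i, Sp (diffC u₀ w i) := fun i => (hU i).sub (hW i)
  have hFz : ∀ i k, Fc (diffC u₀ w i) k 0 = Fc (fun x _ => u₀ x i) k 0 - Fc (wc w i) k 0 :=
    fun i k => (hU i).Fc_sub (hW i) le_rfl k
  have hB1 : Kc 1 * HnormSq 1 (fun x i => diffC u₀ w i x 0) ≤ η := by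
    rw [diffC_zero]
    have h1 : Hnorm r (fun x => u₀ x - w x 0) ≤ √(η / Kc 1) := by
      refine hsmall.trans (mul_le_of_le_one_right (Real.sqrt_nonneg _) ?_)
      exact zpow_le_one_of_nonpos₀ hN (by omega)
    have h2 : HnormSq r (fun x => u₀ x - w x 0) ≤ η / Kc 1 :=
      (Real.sqrt_le_sqrt_iff (div_nonneg hη.le (Kc_pos 1).le)).1 h1
    rw [le_div_iff₀ (Kc_pos 1)] at h2
    have h3 := mul_le_mul_of_nonneg_left (HnormSq_mono hr fun x => u₀ x - w x 0) (Kc_pos 1).le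
    linarith
  obtain ⟨c, hc, hD1, hc0, hsymm, -, hdiv, hbound⟩ := hex N hN (Wf w) (Mf w)
    (wdata hw hwp hN hC₀ hInt hbd) (fun k i => Fc (diffC u₀ w i) k 0)
    (fun m => Kc m * HnormSq m fun x i => diffC u₀ w i x 0)
    (fun k i => Sp.Fc_neg _ k 0)
    (fun i => by
      rw [hFz, Fc_zero_of_mean (hu0 i), Fc_zero_of_mean (by simpa [wc] using hw0 i), sub_zero])
    (fun k => by
      simp only [hFz, mul_sub, Finset.sum_sub_distrib]
      rw [Sp.sum_mul_Fc hU le_rfl (fun x => hud x) k, Sp.sum_mul_Fc hW le_rfl (fun x => ?_) k,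
        sub_zero]
      simpa [NSF.dx, wc, vdiv] using hNS.2 0 (mem_Ici.2 le_rfl) x)
    (fun m s => En_Fc_le hz le_rfl m s) hB1
  refine ⟨fun x t => w x t + vel c x t, fun x t => Pw x t + pres w c x t,
    hw.add (smoothOnTime_vel hc), hPw.add (smoothOnTimeS_pres hw hwp hc),
    fun t x j => congrArg₂ (· + ·) (hwp t x j) (periodic_vel t x j),
    fun t x j => congrArg₂ (· + ·) (hPwp t x j) (periodic_pres t x j),
    isNS_add hw hwp hc hNS hPw hD1 hsymm hdiv, fun x => ?_, fun m hm t ht => ?_⟩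
  · funext i
    have h1 : vel c x 0 i = diffC u₀ w i x 0 := by
      have h2 := (hz i).eq_syn le_rfl x
      have h3 : syn (fun k t => c k i t) x 0 = syn (Fc (diffC u₀ w i)) x 0 := by
        simp only [syn, hc0]
      rw [vel, h3, ← h2, Complex.ofReal_re]
    change w x 0 i + vel c x 0 i = u₀ x i
    rw [h1]
    simp [diffC, wc]
  · have e : (fun x => w x t + vel c x t - w x t) =
        fun y i => (syn (fun k t => c k i t) y t).re := by
      funext y i
      simp [vel]
    rw [e, ← diffC_zero]
    refine (Hnorm_syn_le (fun i => hc i 1) (D := D) (N := N) (θ := ν * σ * t) hD.le hN ht.le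
      (fun x i => diffC u₀ w i x 0) (fun m hm s => ?_) hm).trans ?_
    · have := hbound m hm t ht.le s
      rwa [mul_assoc 2 (ν * σ) t] at this
    · have h1 := pow_pred_le_zpow hN m
      have h2 : 0 ≤ N ^ (m - 1) := by positivity
      have h3 : -(ν * σ * t) = -ν * σ * t := by ring
      rw [h3, ← hA]
      have h4 : 0 ≤ Hnorm m fun x i => diffC u₀ w i x 0 := Real.sqrt_nonneg _
      gcongr
      exact le_add_of_nonneg_right zero_le_one
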